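/- For all integers g ≥ 0 and d ≥ 3, every (g,d)-framed multigraph is contained in H ⊠ P ⊠ K_ℓ for some planar graph H with treewidth at most 3 and for some path P, where ℓ = max{2g⌊d/2⌋, d + 3⌊d/2⌋ − 3}. -/

import Mathlib

/-!
Common definitions: multigraphs, combinatorial (cellular) surface embeddings,
Euler genus, framed graphs, strong products, treewidth, partitions and layerings.
-/

/-- A multigraph on vertex type `V` with edge type `E`, given by its endpoints map. -/
structure Multigraph (V E : Type) where
  ends : E → Sym2 V

namespace Multigraph

variable {V E F : Type}

/-- The simple graph underlying a multigraph. -/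
def simple (G : Multigraph V E) : SimpleGraph V where
  Adj u v := u ≠ v ∧ ∃ e, G.ends e = s(u, v)
  symm := by
    constructor
    rintro u v ⟨hne, e, he⟩
    exact ⟨hne.symm, e, he.trans Sym2.eq_swap⟩
  loopless := by constructor; rintro u ⟨hne, -⟩; exact hne rfl

/-- The simple graph on `V` whose edges are the edges of `G` lying in `S`. -/
def simpleOn (G : Multigraph V E) (S : Set E) : SimpleGraph V where
  Adj u v := u ≠ v ∧ ∃ e ∈ S, G.ends e = s(u, v)
  symm := by
    constructor
    rintro u v ⟨hne, e, heS, he⟩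
    exact ⟨hne.symm, e, heS, he.trans Sym2.eq_swap⟩
  loopless := by constructor; rintro u ⟨hne, -⟩; exact hne rfl

/-- A multigraph is simple: no loops and no parallel edges. -/
def IsSimple (G : Multigraph V E) : Prop :=
  (∀ e, ¬ (G.ends e).IsDiag) ∧ Function.Injective G.ends

/-- A set `S` of edges of `G` forms a spanning tree of `G`. -/
def IsSpanningTree (G : Multigraph V E) (S : Set E) : Prop :=
  (G.simpleOn S).IsTree ∧ (∀ e ∈ S, ¬ (G.ends e).IsDiag) ∧
    ∀ e ∈ S, ∀ e' ∈ S, G.ends e = G.ends e' → e = e'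

/-- A closed walk in a multigraph, recorded as periodic sequences of vertices and
edges: the walk visits `vtx 0, vtx 1, …, vtx (len - 1)` and returns to
`vtx len = vtx 0`, traversing the edge `edge i` between `vtx i` and `vtx (i+1)`. -/
structure CWalk (G : Multigraph V E) where
  len : ℕ
  len_pos : 0 < len
  vtx : ℕ → V
  edge : ℕ → E
  vtx_per : ∀ i, vtx (i + len) = vtx i
  edge_per : ∀ i, edge (i + len) = edge i
  compat : ∀ i, G.ends (edge i) = s(vtx i, vtx (i + 1))

namespace CWalk

variable {G : Multigraph V E}

/-- The vertex `v` lies on the closed walk `W`. -/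
def HasVtx (W : G.CWalk) (v : V) : Prop := ∃ i, i < W.len ∧ W.vtx i = v

/-- The edge `e` lies on the closed walk `W`. -/
def HasEdge (W : G.CWalk) (e : E) : Prop := ∃ i, i < W.len ∧ W.edge i = e

/-- The closed walk `W` is a cycle: it repeats no vertex and no edge. -/
def IsCycle (W : G.CWalk) : Prop :=
  (∀ i j, i < W.len → j < W.len → W.vtx i = W.vtx j → i = j) ∧
  (∀ i j, i < W.len → j < W.len → W.edge i = W.edge j → i = j)

end CWalk

/-- `p = (f, i)` is an occurrence of the edge `e` in the family `bd` of closed walks: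
the walk of face `f` traverses `e` at position `i`. -/
def IsOcc {G : Multigraph V E} (bd : F → G.CWalk) (e : E) (p : F × ℕ) : Prop :=
  p.2 < (bd p.1).len ∧ (bd p.1).edge p.2 = e

/-- `c = (f, i)` is a corner of the vertex `v`: the walk of face `f` visits `v`
at position `i`. -/
def IsCorner {G : Multigraph V E} (bd : F → G.CWalk) (v : V) (c : F × ℕ) : Prop :=
  c.2 < (bd c.1).len ∧ (bd c.1).vtx c.2 = v

/-- The corner `c` is one of the two end corners of the edge occurrence `p`. -/
def EndOf {G : Multigraph V E} (bd : F → G.CWalk) (c p : F × ℕ) : Prop :=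
  c.1 = p.1 ∧ (c.2 = p.2 ∨ c.2 = (p.2 + 1) % (bd p.1).len)

/-- Two corners of `v` are linked if they are end corners (at `v`) of the two
distinct occurrences of a common edge; this is the edge-to-edge gluing relation
around the vertex `v`. -/
def CornerLinked {G : Multigraph V E} (bd : F → G.CWalk) (v : V) (c c' : F × ℕ) : Prop :=
  IsCorner bd v c ∧ IsCorner bd v c' ∧
    ∃ (e : E) (p p' : F × ℕ), p ≠ p' ∧ IsOcc bd e p ∧ IsOcc bd e p' ∧
      EndOf bd c p ∧ EndOf bd c' p'

/-- A combinatorial (cellular) embedding of a connected multigraph `G` in a closed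
surface, with face set `F`: every face is given by its closed boundary walk, every
edge of `G` is traversed exactly twice in total by the boundary walks, and the link
of every vertex is connected (so the embedding is in a genuine surface, with no
pinch points). -/
structure Embedding (G : Multigraph V E) (F : Type) where
  boundary : F → G.CWalk
  conn : G.simple.Connected
  edge_twice : ∀ e : E, {p : F × ℕ | IsOcc boundary e p}.ncard = 2
  link_conn : ∀ (v : V) (c c' : F × ℕ), IsCorner boundary v c → IsCorner boundary v c' →
    Relation.EqvGen (CornerLinked boundary v) c c'

/-- The Euler genus `2 - (|V| - |E| + |F|)` of an embedding, via Euler's formula. -/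
noncomputable def Embedding.eulerGenus {G : Multigraph V E} {F : Type}
    (_ : Embedding G F) : ℤ :=
  2 - ((Nat.card V : ℤ) - Nat.card E + Nat.card F)

/-- The simple graph underlying the framed multigraph `G^{(d)}`: two distinct
vertices are adjacent iff they are joined by an edge of `G` or lie on a common
face of length at most `d` (in which case `G^{(d)}` has a chord between them). -/
def framedGraph {G : Multigraph V E} {F : Type} (emb : Embedding G F) (d : ℕ) :
    SimpleGraph V where
  Adj u v := u ≠ v ∧ ((∃ e, G.ends e = s(u, v)) ∨
    ∃ f, (emb.boundary f).len ≤ d ∧ (emb.boundary f).HasVtx u ∧ (emb.boundary f).HasVtx v)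
  symm := by
    constructor
    rintro u v ⟨hne, (⟨e, he⟩ | ⟨f, h1, h2, h3⟩)⟩
    · exact ⟨hne.symm, Or.inl ⟨e, he.trans Sym2.eq_swap⟩⟩
    · exact ⟨hne.symm, Or.inr ⟨f, h1, h3, h2⟩⟩
  loopless := by constructor; rintro u ⟨hne, -⟩; exact hne rfl

end Multigraph

namespace SimpleGraph

/-- `G` is contained in `X`: `G` is isomorphic to a subgraph of `X`. -/
def IsContainedIn {α β : Type} (G : SimpleGraph α) (X : SimpleGraph β) : Prop :=
  ∃ f : G →g X, Function.Injective f

/-- The strong product of two simple graphs. -/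
def strongProd {α β : Type} (G : SimpleGraph α) (H : SimpleGraph β) :
    SimpleGraph (α × β) where
  Adj x y := x ≠ y ∧ (x.1 = y.1 ∨ G.Adj x.1 y.1) ∧ (x.2 = y.2 ∨ H.Adj x.2 y.2)
  symm := by
    constructor
    rintro x y ⟨hne, h1, h2⟩
    exact ⟨hne.symm, h1.imp Eq.symm (fun h => G.symm.symm _ _ h), h2.imp Eq.symm (fun h => H.symm.symm _ _ h)⟩
  loopless := by constructor; rintro x ⟨hne, -⟩; exact hne rfl

end SimpleGraph

/-- `G` has treewidth at most `k`: it has a tree-decomposition with all bags of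
size at most `k + 1`. -/
def TreewidthLE {α : Type} (G : SimpleGraph α) (k : ℕ) : Prop :=
  ∃ (ι : Type) (T : SimpleGraph ι) (B : ι → Set α),
    T.IsTree ∧
    (∀ v, ∃ i, v ∈ B i) ∧
    (∀ u v, G.Adj u v → ∃ i, u ∈ B i ∧ v ∈ B i) ∧
    (∀ v, (T.induce {i | v ∈ B i}).Connected) ∧
    ∀ i, (B i).encard ≤ (k : ℕ∞) + 1

/-- `G` has Euler genus at most `g`: `G` is (isomorphic to) a subgraph of a
multigraph having a combinatorial embedding of Euler genus at most `g`. -/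
def HasEulerGenusLE {α : Type} (G : SimpleGraph α) (g : ℕ) : Prop :=
  ∃ (V' E' F' : Type), Finite V' ∧ Finite E' ∧ Finite F' ∧
    ∃ (M : Multigraph V' E') (emb : M.Embedding F'),
      emb.eulerGenus ≤ (g : ℤ) ∧ G.IsContainedIn M.simple

/-- A planar graph: a graph of Euler genus `0`. -/
def IsPlanar {α : Type} (G : SimpleGraph α) : Prop := HasEulerGenusLE G 0

/-- An apex graph: deleting some vertex leaves a planar graph. -/
def IsApex {α : Type} (G : SimpleGraph α) : Prop :=
  ∃ v : α, IsPlanar (G.induce {w | w ≠ v})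

/-- `A` indexes a partition of the vertices of `G` into nonempty parts `A x`, and the
quotient of `G` by this partition is (isomorphic to) `H`, via the indexing: this is an
`H`-partition of `G`. -/
def IsHPartition {α W : Type} (G : SimpleGraph α) (H : SimpleGraph W) (A : W → Set α) : Prop :=
  (∀ x, (A x).Nonempty) ∧ (∀ v, ∃! x, v ∈ A x) ∧
    ∀ x y, x ≠ y → (H.Adj x y ↔ ∃ u ∈ A x, ∃ v ∈ A y, G.Adj u v)

/-- `(L 0, L 1, …)` is a layering of `G`: an ordered partition of the vertices such
that every edge joins vertices in the same or in consecutive layers. -/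
def IsLayering {α : Type} (G : SimpleGraph α) (L : ℕ → Set α) : Prop :=
  (∀ v, ∃! j, v ∈ L j) ∧
    ∀ u v, G.Adj u v → ∀ i j, u ∈ L i → v ∈ L j → i ≤ j + 1 ∧ j ≤ i + 1

/-- `b` lies on every walk from `a` to `c` in `T` (for a tree: `b` is on the unique
`a`–`c` path). -/
def BtwIn {α : Type} (T : SimpleGraph α) (a b c : α) : Prop :=
  ∀ p : T.Walk a c, b ∈ p.support

/-- `Q` is the vertex set of a vertical path in the tree `T` rooted at `r` with upper
end `w` and lower end `u`: `w` lies on the path from `r` to `u`, and `Q` is the set of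
vertices of the `w`–`u` path. -/
def IsVerticalPathBtw {α : Type} (T : SimpleGraph α) (r : α) (Q : Set α) (w u : α) : Prop :=
  BtwIn T r w u ∧ Q = {x | BtwIn T w x u}

/-- `Q` is the vertex set of a vertical path in the tree `T` rooted at `r`. -/
def IsVerticalPath {α : Type} (T : SimpleGraph α) (r : α) (Q : Set α) : Prop :=
  ∃ w u, IsVerticalPathBtw T r Q w u

/-- `Y` is the union of at most `k` vertical paths in the tree `T` rooted at `r`. -/
def IsUnionOfVPaths {α : Type} (T : SimpleGraph α) (r : α) (k : ℕ) (Y : Set α) : Prop :=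
  ∃ m, m ≤ k ∧ ∃ Q : Fin m → Set α, (∀ i, IsVerticalPath T r (Q i)) ∧ Y = ⋃ i, Q i


set_option linter.unusedSectionVars false
set_option linter.unusedVariables false

namespace FPS
noncomputable section
open Finset Relation
open scoped Classical

/-- Abstract polygonal surface complex. -/
structure Cx (V E F : Type) where
  ends : E → Sym2 V
  len : F → ℕ
  vtx : F → ℕ → V
  edge : F → ℕ → E
  two_le : ∀ f, 2 ≤ len f
  vper : ∀ f i, vtx f (i + len f) = vtx f i
  eper : ∀ f i, edge f (i + len f) = edge f i
  compat : ∀ f i, ends (edge f i) = s(vtx f i, vtx f (i + 1))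
  vinj : ∀ f i j, i < len f → j < len f → vtx f i = vtx f j → i = j
  einj : ∀ f i j, i < len f → j < len f → edge f i = edge f j → i = j
  two : ∀ e, ∃ f f', f ≠ f' ∧ ∀ o, (∃ i, edge o i = e) ↔ o = f ∨ o = f'
  star : ∀ v f f', (∃ i, vtx f i = v) → (∃ i, vtx f' i = v) →
    EqvGen (fun o o' => ∃ e, v ∈ ends e ∧ (∃ i, edge o i = e) ∧ (∃ i, edge o' i = e)) f f'
  conn : ∀ u v, ReflTransGen (fun a b => ∃ e, ends e = s(a, b)) u v

variable {V E F : Type} [Fintype V] [Fintype E] [Fintype F]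

namespace Cx
variable (C : Cx V E F)

def On (e : E) (f : F) : Prop := ∃ i, C.edge f i = e
def VOn (v : V) (f : F) : Prop := ∃ i, C.vtx f i = v

theorem vmod (f : F) (i : ℕ) : C.vtx f (i % C.len f) = C.vtx f i := by
  have h : ∀ k j, C.vtx f (j + C.len f * k) = C.vtx f j := by
    intro k; induction k with
    | zero => simp
    | succ k ih => intro j; rw [Nat.mul_succ, ← add_assoc, C.vper, ih]
  conv_rhs => rw [← Nat.mod_add_div i (C.len f), h]

theorem emod (f : F) (i : ℕ) : C.edge f (i % C.len f) = C.edge f i := by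
  have h : ∀ k j, C.edge f (j + C.len f * k) = C.edge f j := by
    intro k; induction k with
    | zero => simp
    | succ k ih => intro j; rw [Nat.mul_succ, ← add_assoc, C.eper, ih]
  conv_rhs => rw [← Nat.mod_add_div i (C.len f), h]

theorem lpos (f : F) : 0 < C.len f := by have := C.two_le f; omega

theorem On.lt {C : Cx V E F} {e f} (h : C.On e f) : ∃ i, i < C.len f ∧ C.edge f i = e := by
  obtain ⟨i, hi⟩ := h
  exact ⟨i % C.len f, Nat.mod_lt _ (C.lpos f), by rw [C.emod, hi]⟩

theorem VOn.lt {C : Cx V E F} {v f} (h : C.VOn v f) : ∃ i, i < C.len f ∧ C.vtx f i = v := by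
  obtain ⟨i, hi⟩ := h
  exact ⟨i % C.len f, Nat.mod_lt _ (C.lpos f), by rw [C.vmod, hi]⟩

theorem on_edge (f i) : C.On (C.edge f i) f := ⟨i, rfl⟩
theorem von_vtx (f i) : C.VOn (C.vtx f i) f := ⟨i, rfl⟩

theorem vtx_succ_ne (f i) : C.vtx f i ≠ C.vtx f (i + 1) := by
  intro h
  have h2 := C.two_le f
  have := C.vinj f (i % C.len f) ((i+1) % C.len f) (Nat.mod_lt _ (C.lpos f))
    (Nat.mod_lt _ (C.lpos f)) (by rw [C.vmod, C.vmod, h])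
  have h3 : (i + 1) % C.len f = (i % C.len f + 1) % C.len f := by simp [Nat.add_mod]
  have h4 := Nat.mod_lt i (C.lpos f)
  rw [h3] at this
  by_cases h5 : i % C.len f + 1 = C.len f
  · rw [h5, Nat.mod_self] at this; omega
  · rw [Nat.mod_eq_of_lt (show i % C.len f + 1 < C.len f by omega)] at this; omega

/-- an edge position as unordered pair -/
theorem ends_ex (e : E) : ∃ u v, u ≠ v ∧ C.ends e = s(u, v) := by
  obtain ⟨f, f', -, h⟩ := C.two e
  obtain ⟨i, rfl⟩ := (h f).2 (Or.inl rfl)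
  exact ⟨_, _, C.vtx_succ_ne f i, C.compat f i⟩

theorem ends_ne {e : E} {u v : V} (h : C.ends e = s(u, v)) : u ≠ v := by
  obtain ⟨a, b, hab, h'⟩ := C.ends_ex e
  rw [h', Sym2.eq_iff] at h
  rintro rfl
  rcases h with ⟨rfl, rfl⟩ | ⟨rfl, rfl⟩ <;> exact hab rfl

theorem VOn_of_mem {e f v} (h : C.On e f) (hv : v ∈ C.ends e) : C.VOn v f := by
  obtain ⟨i, rfl⟩ := h
  rw [C.compat, Sym2.mem_iff] at hv
  rcases hv with rfl | rfl
  · exact ⟨i, rfl⟩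
  · exact ⟨i+1, rfl⟩

/-- The two faces at an edge -/
theorem two' (e : E) : ∃ f f', f ≠ f' ∧ C.On e f ∧ C.On e f' ∧ ∀ o, C.On e o → o = f ∨ o = f' := by
  obtain ⟨f, f', hne, h⟩ := C.two e
  exact ⟨f, f', hne, (h f).2 (Or.inl rfl), (h f').2 (Or.inr rfl), fun o => (h o).1⟩

theorem other {e f} (h : C.On e f) : ∃ f', f' ≠ f ∧ C.On e f' ∧ ∀ o, C.On e o → o = f ∨ o = f' := by
  obtain ⟨a, b, hne, h1, h2, h3⟩ := C.two' e
  rcases h3 f h with rfl | rfl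
  · exact ⟨b, hne.symm, h2, h3⟩
  · exact ⟨a, hne, h1, fun o ho => (h3 o ho).symm⟩

theorem exists_face (e : E) : ∃ f, C.On e f := by
  obtain ⟨f, _, _, h, _⟩ := C.two' e; exact ⟨f, h⟩

theorem edge_at {f v} (h : C.VOn v f) : ∃ e, C.On e f ∧ v ∈ C.ends e := by
  obtain ⟨i, rfl⟩ := h
  exact ⟨_, C.on_edge f i, by rw [C.compat]; simp⟩

abbrev Z := ZMod 2

theorem Z2 (x : Z) : x = 0 ∨ x = 1 := by revert x; decide
theorem Zadd (x : Z) : x + x = 0 := by revert x; decide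
theorem Zeq {x y : Z} : x + y = 0 → x = y := by revert x y; decide
theorem Zsq (x : Z) : x * x = x := by revert x; decide

def cut (X : V → Z) (e : E) : Z :=
  Sym2.lift ⟨fun u v => X u + X v, fun u v => add_comm _ _⟩ (C.ends e)

theorem cut_eq {X : V → Z} {e u v} (h : C.ends e = s(u, v)) : C.cut X e = X u + X v := by
  simp [cut, h]

theorem cut_zero {X : V → Z} {e} (h : ∀ v ∈ C.ends e, X v = 0) : C.cut X e = 0 := by
  obtain ⟨u, v, -, he⟩ := C.ends_ex e
  rw [C.cut_eq he, h u (by simp [he]), h v (by simp [he]), add_zero]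

theorem cut_add (X Y : V → Z) (e) : C.cut (X + Y) e = C.cut X e + C.cut Y e := by
  obtain ⟨u, v, -, he⟩ := C.ends_ex e
  simp only [C.cut_eq he, Pi.add_apply]; ring

theorem cut_smul (a : Z) (Y : V → Z) (e) : C.cut (a • Y) e = a * C.cut Y e := by
  obtain ⟨u, v, -, he⟩ := C.ends_ex e
  simp only [C.cut_eq he, Pi.smul_apply, smul_eq_mul]; ring

def ie (e : E) (f : F) : Z := if C.On e f then 1 else 0
def bd (D : F → Z) (e : E) : Z := ∑ f, D f * C.ie e f
def pr (z : E → Z) (X : V → Z) : Z := ∑ e, z e * C.cut X e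

theorem bd_eq (D : F → Z) {e f f'} (hne : f ≠ f') (h : C.On e f) (h' : C.On e f') :
    C.bd D e = D f + D f' := by
  have h3 : ∀ o, C.On e o ↔ o = f ∨ o = f' := by
    obtain ⟨g, hg, h1, h2⟩ := C.other h
    have := h2 f' h'
    intro o; constructor
    · intro ho; rcases h2 o ho with h | h
      · exact Or.inl h
      · rcases this with h4 | h4
        · exact absurd h4.symm hne
        · right; rw [h, h4]
    · rintro (rfl | rfl) <;> assumption
  have : ∀ o, D o * C.ie e o = (if o = f then D f else 0) + (if o = f' then D f' else 0) := by
    intro o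
    unfold ie
    rw [h3 o]
    by_cases h1 : o = f
    · subst h1; simp [hne]
    · by_cases h2 : o = f'
      · subst h2; simp [h1]
      · simp [h1, h2]
  simp only [bd, this, Finset.sum_add_distrib, Finset.sum_ite_eq', Finset.mem_univ, if_true]

/-- sum over the edges on a face as a sum over positions -/
theorem sum_on (f : F) (w : E → Z) :
    ∑ e, C.ie e f * w e = ∑ i ∈ range (C.len f), w (C.edge f i) := by
  have : ∑ e, C.ie e f * w e = ∑ e ∈ univ.filter (fun e => C.On e f), w e := by
    rw [Finset.sum_filter]; apply Finset.sum_congr rfl; intro e _; unfold ie; split_ifs <;> simp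
  rw [this]
  have h2 : univ.filter (fun e => C.On e f) = (range (C.len f)).image (C.edge f) := by
    ext e; simp only [mem_filter, mem_univ, true_and, mem_image, mem_range]
    constructor
    · intro h; obtain ⟨i, hi, h⟩ := h.lt; exact ⟨i, hi, h⟩
    · rintro ⟨i, -, h⟩; exact ⟨i, h⟩
  rw [h2, Finset.sum_image]
  intro i hi j hj h
  exact C.einj f i j (by simpa using hi) (by simpa using hj) h

theorem tele (f : F) (X : V → Z) (a k : ℕ) :
    ∑ i ∈ range k, C.cut X (C.edge f (a + i)) = X (C.vtx f a) + X (C.vtx f (a + k)) := by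
  induction k with
  | zero => simp [Zadd]
  | succ k ih =>
    rw [Finset.sum_range_succ, ih, C.cut_eq (C.compat f (a+k)), ← add_assoc a k 1]
    have := Zadd (X (C.vtx f (a+k)))
    linear_combination this

theorem face_cut (f : F) (X : V → Z) : ∑ e, C.ie e f * C.cut X e = 0 := by
  rw [C.sum_on]
  have := C.tele f X 0 (C.len f)
  simp only [zero_add] at this
  rw [this]
  have h := C.vper f 0
  rw [zero_add] at h
  rw [h]; exact Zadd _

theorem pr_bd (D : F → Z) (X : V → Z) : C.pr (C.bd D) X = 0 := by
  unfold pr bd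
  simp only [Finset.sum_mul]
  rw [Finset.sum_comm]
  apply Finset.sum_eq_zero
  intro f _
  have := C.face_cut f X
  calc _ = D f * ∑ e, C.ie e f * C.cut X e := by
        rw [Finset.mul_sum]; exact Finset.sum_congr rfl fun e _ => by ring
    _ = 0 := by rw [this, mul_zero]

theorem pr_add (z w : E → Z) (X) : C.pr (z + w) X = C.pr z X + C.pr w X := by
  simp only [pr, Pi.add_apply, add_mul, Finset.sum_add_distrib]

theorem pr_addX (z : E → Z) (X Y) : C.pr z (X + Y) = C.pr z X + C.pr z Y := by
  simp only [pr, cut_add, mul_add, Finset.sum_add_distrib]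

theorem pr_smulX (z : E → Z) (a : Z) (Y) : C.pr z (a • Y) = a * C.pr z Y := by
  simp only [pr, cut_smul, Finset.mul_sum]
  exact Finset.sum_congr rfl fun e _ => by ring

theorem pr_smul (z : E → Z) (a : Z) (Y) : C.pr (a • z) Y = a * C.pr z Y := by
  simp only [pr, Pi.smul_apply, smul_eq_mul, Finset.mul_sum, mul_assoc]

theorem pr_sum {ι} (s : Finset ι) (z : ι → E → Z) (X) :
    C.pr (∑ i ∈ s, z i) X = ∑ i ∈ s, C.pr (z i) X := by
  induction s using Finset.induction_on with
  | empty => simp [pr]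
  | insert a s ha ih => rw [Finset.sum_insert ha, pr_add, ih, Finset.sum_insert ha]

theorem pr_sumX {ι} (s : Finset ι) (z : E → Z) (X : ι → V → Z) :
    C.pr z (∑ i ∈ s, X i) = ∑ i ∈ s, C.pr z (X i) := by
  induction s using Finset.induction_on with
  | empty =>
    have : C.pr z ((0:Z) • (0 : V → Z)) = 0 := by rw [pr_smulX, zero_mul]
    simpa using this
  | insert a s ha ih => rw [Finset.sum_insert ha, pr_addX, ih, Finset.sum_insert ha]

theorem pr_single (e : E) (X) : C.pr (Pi.single e 1) X = C.cut X e := by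
  unfold pr
  rw [Finset.sum_eq_single e]
  · simp
  · intro b _ hb; simp [hb]
  · simp

/-- Segment chain -/
def Sg (f : F) (a b : ℕ) : E → Z := ∑ m ∈ Ico a b, Pi.single (C.edge f m) 1

theorem pr_Sg (f : F) {a b : ℕ} (h : a ≤ b) (X) :
    C.pr (C.Sg f a b) X = X (C.vtx f a) + X (C.vtx f b) := by
  unfold Sg
  rw [pr_sum]
  simp only [pr_single]
  rw [Finset.sum_Ico_eq_sum_range, C.tele f X a (b - a)]
  congr 3; omega

theorem Sg_off (f : F) (a b : ℕ) {e} (h : ¬ C.On e f) : C.Sg f a b e = 0 := by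
  unfold Sg
  rw [Finset.sum_apply]
  apply Finset.sum_eq_zero
  intro m _
  rw [Pi.single_apply, if_neg]
  rintro rfl; exact h (C.on_edge f m)

theorem Sg_on (f : F) (a b : ℕ) (hb : b ≤ C.len f) {k} (hk : k < C.len f) :
    C.Sg f a b (C.edge f k) = if a ≤ k ∧ k < b then 1 else 0 := by
  unfold Sg
  rw [Finset.sum_apply]
  have : ∀ m ∈ Ico a b, (Pi.single (C.edge f m) 1 : E → Z) (C.edge f k) = if m = k then 1 else 0 := by
    intro m hm
    rw [Finset.mem_Ico] at hm
    rw [Pi.single_apply]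
    by_cases h : m = k
    · simp [h]
    · rw [if_neg h, if_neg]
      intro h'; exact h (C.einj f m k (by omega) hk h'.symm)
  rw [Finset.sum_congr rfl this, Finset.sum_ite_eq']
  simp [Finset.mem_Ico]

/-- adjacency of faces across non-walls -/
def adjB (B : Set E) (o o' : F) : Prop := ∃ e, e ∉ B ∧ C.On e o ∧ C.On e o'
def Comp (B : Set E) (f : F) : Set F := {o | EqvGen (C.adjB B) f o}

theorem Comp_self (B f) : f ∈ C.Comp B f := EqvGen.refl _
theorem Comp_eq {B f f'} (h : f' ∈ C.Comp B f) : C.Comp B f' = C.Comp B f := by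
  ext o; exact ⟨fun ho => EqvGen.trans _ _ _ h ho, fun ho => EqvGen.trans _ _ _ (EqvGen.symm _ _ h) ho⟩
theorem Comp_step {B f e o o'} (h : o ∈ C.Comp B f) (he : e ∉ B) (ho : C.On e o) (ho' : C.On e o') :
    o' ∈ C.Comp B f := EqvGen.trans _ _ _ h (EqvGen.rel _ _ ⟨e, he, ho, ho'⟩)

theorem Comp_ind {B f} {p : F → Prop} (h0 : p f)
    (hs : ∀ e o o', e ∉ B → C.On e o → C.On e o' → p o → p o') : ∀ o ∈ C.Comp B f, p o := by
  intro o ho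
  have : ∀ a b, EqvGen (C.adjB B) a b → (p a ↔ p b) := by
    intro a b h
    induction h with
    | rel a b h => obtain ⟨e, he, h1, h2⟩ := h; exact ⟨hs e a b he h1 h2, hs e b a he h2 h1⟩
    | refl => exact Iff.rfl
    | symm _ _ _ ih => exact ih.symm
    | trans _ _ _ _ _ h1 h2 => exact h1.trans h2
  exact (this _ _ ho).1 h0

theorem Comp_mono {B B' : Set E} (h : B ⊆ B') (f) : C.Comp B' f ⊆ C.Comp B f :=
  C.Comp_ind (C.Comp_self B f) fun e o o' he h1 h2 ho => C.Comp_step ho (fun hb => he (h hb)) h1 h2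

/-- all faces around a vertex, when no wall meets it -/
theorem star_comp {B : Set E} {v f f' g} (hv : ∀ e ∈ B, v ∉ C.ends e) (h : C.VOn v f)
    (h' : C.VOn v f') (hf : f ∈ C.Comp B g) : f' ∈ C.Comp B g := by
  have : ∀ a b, EqvGen (fun o o' => ∃ e, v ∈ C.ends e ∧ (∃ i, C.edge o i = e) ∧ (∃ i, C.edge o' i = e)) a b
      → EqvGen (C.adjB B) a b := by
    intro a b h
    induction h with
    | rel a b h =>
      obtain ⟨e, he, h1, h2⟩ := h
      exact EqvGen.rel _ _ ⟨e, fun hb => hv e hb he, h1, h2⟩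
    | refl => exact EqvGen.refl _
    | symm _ _ _ ih => exact EqvGen.symm _ _ ih
    | trans _ _ _ _ _ h1 h2 => exact EqvGen.trans _ _ _ h1 h2
  exact EqvGen.trans _ _ _ hf (this _ _ (C.star v f f' h h'))

/-- All faces are in one component when there are no walls -/
theorem face_conn (f f' : F) : f' ∈ C.Comp ∅ f := by
  obtain ⟨e, he, -⟩ : ∃ e, C.On e f ∧ True := ⟨_, C.on_edge f 0, trivial⟩
  have key : ∀ w, ReflTransGen (fun a b => ∃ e, C.ends e = s(a, b)) (C.vtx f 0) w →
      ∀ o, C.VOn w o → o ∈ C.Comp ∅ f := by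
    intro w hw
    induction hw with
    | refl => intro o ho; exact C.star_comp (by simp) (C.von_vtx f 0) ho (C.Comp_self _ _)
    | tail _ h ih =>
      intro o ho
      obtain ⟨e, he⟩ := h
      obtain ⟨g, hg⟩ := C.exists_face e
      have h1 := ih g (C.VOn_of_mem hg (by simp [he]))
      exact C.star_comp (by simp) (C.VOn_of_mem hg (by simp [he])) ho h1
  exact key _ (C.conn _ (C.vtx f' 0)) f' (C.von_vtx f' 0)

theorem bd_one (e) : C.bd (fun _ => 1) e = 0 := by
  obtain ⟨f, f', hne, h1, h2, -⟩ := C.two' e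
  rw [C.bd_eq _ hne h1 h2]; rfl

/-- Master identity -/
theorem master {B : Set E} (g : F) (D : F → Z) (w : E → Z) (hw : ∀ f, ∑ e, C.ie e f * w e = 0) :
    ∑ e ∈ univ.filter (fun e => e ∉ B ∧ ∃ o ∈ C.Comp B g, C.On e o), C.bd D e * w e +
    ∑ p ∈ (univ : Finset (E × F)).filter (fun p => p.1 ∈ B ∧ p.2 ∈ C.Comp B g ∧ C.On p.1 p.2),
      D p.2 * w p.1 = 0 := by
  set K := C.Comp B g with hK
  have h0 : ∑ f ∈ univ.filter (· ∈ K), ∑ e, D f * (C.ie e f * w e) = 0 := by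
    apply Finset.sum_eq_zero; intro f _; rw [← Finset.mul_sum, hw, mul_zero]
  rw [Finset.sum_comm] at h0
  rw [← h0, Finset.sum_filter (s := (univ : Finset (E × F))), ← Finset.univ_product_univ, Finset.sum_product,
    Finset.sum_filter, ← Finset.sum_add_distrib]
  apply Finset.sum_congr rfl
  intro e _
  by_cases he : e ∈ B
  · simp only [he, not_true_eq_false, false_and, if_false, true_and, zero_add]
    rw [Finset.sum_filter]
    apply Finset.sum_congr rfl
    intro f _
    unfold ie
    by_cases h1 : f ∈ K <;> by_cases h2 : C.On e f <;> simp [h1, h2]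
  · simp only [he, not_false_eq_true, false_and, if_false, true_and, Finset.sum_const_zero, add_zero]
    by_cases h : ∃ o ∈ K, C.On e o
    · rw [if_pos h]
      obtain ⟨o, ho, heo⟩ := h
      unfold bd
      rw [Finset.sum_mul, Finset.sum_filter]
      apply Finset.sum_congr rfl
      intro f _
      by_cases h1 : f ∈ K
      · rw [if_pos h1]; ring
      · rw [if_neg h1]
        have : ¬ C.On e f := fun h2 => h1 (C.Comp_step ho he heo h2)
        simp [ie, this]
    · rw [if_neg h, Finset.sum_eq_zero]
      intro f hf
      have : ¬ C.On e f := fun h2 => h ⟨f, by simpa using hf, h2⟩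
      simp [ie, this]

/-- homological hypothesis -/
def Hyp (B : Set E) (S : Set V) : Prop :=
  ∀ z : E → Z, (∀ X : V → Z, (∀ v ∈ S, X v = 0) → C.pr z X = 0) → ∃ D, ∀ e, e ∉ B → z e = C.bd D e

theorem Hyp.ext {C : Cx V E F} {B B' : Set E} {S S' : Set V} (h : C.Hyp B S) (hB : B ⊆ B')
    (hq : ∀ y ∈ S', y ∉ S → ∃ q : E → Z, (∀ e, e ∉ B' → q e = 0) ∧
      ∀ X : V → Z, (∀ v ∈ S, X v = 0) → C.pr q X = X y) : C.Hyp B' S' := by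
  intro z hz
  have : ∀ y, ∃ q : E → Z, y ∈ S' → y ∉ S → (∀ e, e ∉ B' → q e = 0) ∧
      ∀ X : V → Z, (∀ v ∈ S, X v = 0) → C.pr q X = X y := by
    intro y
    by_cases h1 : y ∈ S' ∧ y ∉ S
    · obtain ⟨q, hq⟩ := hq y h1.1 h1.2; exact ⟨q, fun _ _ => hq⟩
    · exact ⟨0, fun a b => absurd ⟨a, b⟩ h1⟩
  choose q hq using this
  set Y := univ.filter (fun y => y ∈ S' ∧ y ∉ S) with hY
  have hYm : ∀ y, y ∈ Y ↔ y ∈ S' ∧ y ∉ S := by intro y; simp [hY]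
  set c : V → Z := fun y => C.pr z (Pi.single y 1)
  obtain ⟨D, hD⟩ := h (z + ∑ y ∈ Y, c y • q y) (by
    intro X hX
    rw [C.pr_add, C.pr_sum]
    have e1 : ∑ y ∈ Y, C.pr (c y • q y) X = ∑ y ∈ Y, X y * C.pr z (Pi.single y 1) := by
      apply Finset.sum_congr rfl
      intro y hy
      rw [hYm] at hy
      rw [C.pr_smul, (hq y hy.1 hy.2).2 X hX, mul_comm]
    have e2 : C.pr z (X + ∑ y ∈ Y, X y • Pi.single y 1) = 0 := by
      apply hz
      intro v hv
      rw [Pi.add_apply, Finset.sum_apply]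
      have : ∀ y ∈ Y, (X y • (Pi.single y 1 : V → Z)) v = if y = v then X v else 0 := by
        intro y _
        rw [Pi.smul_apply, Pi.single_apply]
        by_cases h : y = v
        · subst h; simp
        · simp [h, Ne.symm h]
      rw [Finset.sum_congr rfl this, Finset.sum_ite_eq']
      by_cases hvS : v ∈ S
      · simp [hX v hvS]
      · rw [if_pos ((hYm v).2 ⟨hv, hvS⟩), Zadd]
    rw [C.pr_addX, C.pr_sumX] at e2
    simp only [C.pr_smulX] at e2
    rw [e1, e2])
  refine ⟨D, fun e he => ?_⟩
  rw [← hD e (fun h => he (hB h)), Pi.add_apply, Finset.sum_apply, Finset.sum_eq_zero, add_zero]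
  intro y hy
  rw [hYm] at hy
  rw [Pi.smul_apply, (hq y hy.1 hy.2).1 e he, smul_zero]

end Cx
end
end FPS


set_option linter.unusedSectionVars false
set_option linter.unusedVariables false
namespace FPS
noncomputable section
open Finset Relation
open scoped Classical
variable {V E F : Type} [Fintype V] [Fintype E] [Fintype F]

structure BFS (C : Cx V E F) where
  r : V
  depth : V → ℕ
  par : V → V
  pe : V → E
  pe_ends : ∀ v, v ≠ r → C.ends (pe v) = s(v, par v)
  dep : ∀ v, v ≠ r → depth v = depth (par v) + 1
  lip : ∀ e u v, C.ends e = s(u, v) → depth u ≤ depth v + 1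

theorem BFS.exist [Nonempty E] (C : Cx V E F) (r : V) : ∃ T : BFS C, T.r = r := by
  -- distance by number of steps
  have hex : ∀ v, ∃ n, ∃ w : ℕ → V, w 0 = r ∧ w n = v ∧ ∀ i < n, ∃ e, C.ends e = s(w i, w (i+1)) := by
    intro v
    have := C.conn r v
    induction this with
    | refl => exact ⟨0, fun _ => r, rfl, rfl, by simp⟩
    | tail _ h ih =>
      rename_i b c _
      obtain ⟨n, w, h0, hn, hs⟩ := ih
      refine ⟨n+1, fun i => if i ≤ n then w i else c, by simp [h0], by simp, ?_⟩
      intro i hi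
      by_cases h1 : i = n
      · subst h1; simpa [hn] using h
      · simpa [show i ≤ n by omega, show i + 1 ≤ n by omega] using hs i (by omega)
  set dp : V → ℕ := fun v => Nat.find (hex v) with hdp
  have lip : ∀ e u v, C.ends e = s(u, v) → dp u ≤ dp v + 1 := by
    intro e u v he
    apply Nat.find_min'
    obtain ⟨w, h0, hn, hs⟩ := Nat.find_spec (hex v)
    refine ⟨fun i => if i ≤ dp v then w i else u, by simp [h0], by simp, ?_⟩
    intro i hi
    by_cases h1 : i = dp v
    · subst h1; refine ⟨e, ?_⟩; simp only [le_refl, if_true]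
      rw [if_neg (by omega), he, Sym2.eq_swap]
      congr 2; exact hn.symm
    · simpa [show i ≤ dp v by omega, show i + 1 ≤ dp v by omega] using hs i (show i < dp v by omega)
  have hpar : ∀ v, ∃ (u : V) (e : E), v ≠ r → C.ends e = s(v, u) ∧ dp v = dp u + 1 := by
    intro v
    by_cases hv : v = r
    · exact ⟨v, Classical.arbitrary E, fun h => absurd hv h⟩
    · obtain ⟨w, h0, hn, hs⟩ := Nat.find_spec (hex v)
      have hpos : Nat.find (hex v) ≠ 0 := by
        intro h; rw [h, h0] at hn; exact hv hn.symm
      obtain ⟨m, hm⟩ := Nat.exists_eq_succ_of_ne_zero hpos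
      rw [hm] at hn hs
      obtain ⟨e, he⟩ := hs m (by omega)
      rw [hn] at he
      refine ⟨w m, e, fun _ => ⟨by rw [he, Sym2.eq_swap], ?_⟩⟩
      have h1 := lip e v (w m) (by rw [he, Sym2.eq_swap])
      have h2 : dp (w m) ≤ m := Nat.find_min' _ ⟨w, h0, rfl, fun i hi => hs i (by omega)⟩
      have h3 : dp v = m + 1 := hm
      omega
  choose par pe h using hpar
  exact ⟨⟨r, dp, par, pe, fun v hv => (h v hv).1, fun v hv => (h v hv).2, lip⟩, rfl⟩

namespace BFS
variable {C : Cx V E F} (T : BFS C)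

theorem ind {p : V → Prop} (hr : p T.r) (hs : ∀ v, v ≠ T.r → p (T.par v) → p v) : ∀ v, p v := by
  have : ∀ n v, T.depth v = n → p v := by
    intro n; induction n with
    | zero =>
      intro v h
      by_cases hv : v = T.r
      · rw [hv]; exact hr
      · have := T.dep v hv; omega
    | succ n ih =>
      intro v h
      by_cases hv : v = T.r
      · rw [hv]; exact hr
      · exact hs v hv (ih _ (by have := T.dep v hv; omega))
  exact fun v => this _ v rfl

theorem pe_inj {v w} (hv : v ≠ T.r) (hw : w ≠ T.r) (h : T.pe v = T.pe w) : v = w := by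
  have h1 := T.pe_ends v hv
  rw [h, T.pe_ends w hw, Sym2.eq_iff] at h1
  rcases h1 with ⟨h, -⟩ | ⟨h2, h3⟩
  · exact h.symm
  · have a := T.dep v hv; have b := T.dep w hw; rw [h3] at b; rw [← h2] at a; omega

/-- `v` is an ancestor of `w` -/
def Anc (v w : V) : Prop := ReflTransGen (fun a b => a ≠ T.r ∧ T.par a = b) w v

theorem Anc_iff (v w) : T.Anc v w ↔ w = v ∨ (w ≠ T.r ∧ T.Anc v (T.par w)) := by
  constructor
  · intro h
    rcases ReflTransGen.cases_head h with h | ⟨c, ⟨h1, h2⟩, h3⟩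
    · exact Or.inl h
    · exact Or.inr ⟨h1, h2 ▸ h3⟩
  · rintro (rfl | ⟨h1, h2⟩)
    · exact ReflTransGen.refl
    · exact ReflTransGen.head ⟨h1, rfl⟩ h2

theorem Anc_depth {v w} (h : T.Anc v w) : T.depth v ≤ T.depth w := by
  unfold Anc at h
  induction h with
  | refl => exact le_rfl
  | tail _ h ih => have := T.dep _ h.1; rw [h.2] at this; omega

theorem Anc_inj {v v' w} (h : T.Anc v w) (h' : T.Anc v' w) (hd : T.depth v = T.depth v') : v = v' := by
  revert h h'
  refine T.ind (p := fun w => T.Anc v w → T.Anc v' w → v = v') ?_ ?_ w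
  · intro h h'
    rw [Anc_iff] at h h'
    simp only [ne_eq, not_true_eq_false, false_and, or_false] at h h'
    rw [← h, ← h']
  · intro w hw ih h h'
    rw [Anc_iff] at h h'
    rcases h with rfl | ⟨-, h⟩ <;> rcases h' with rfl | ⟨-, h'⟩
    · rfl
    · have := T.Anc_depth h'; have := T.dep _ hw; omega
    · have := T.Anc_depth h; have := T.dep _ hw; omega
    · exact ih h h'

def X (v : V) : V → Cx.Z := fun w => if T.Anc v w then 1 else 0

theorem cut_X {v w} (hv : v ≠ T.r) (hw : w ≠ T.r) : C.cut (T.X v) (T.pe w) = if w = v then 1 else 0 := by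
  rw [C.cut_eq (T.pe_ends w hw)]
  unfold X
  by_cases h : w = v
  · subst h
    rw [if_pos ((T.Anc_iff _ _).2 (Or.inl rfl)), if_neg, if_pos rfl, add_zero]
    intro h; have := T.Anc_depth h; have := T.dep w hw; omega
  · rw [if_neg h, T.Anc_iff v w]
    simp only [h, false_or, ne_eq, hw, not_false_eq_true, true_and]
    exact Cx.Zadd _

/-- tree edges -/
def TE : Set E := {e | ∃ v, v ≠ T.r ∧ T.pe v = e}

/-- if `y` is supported on tree edges plus `A` and is orthogonal to `X v`, and `X v` does not cut `A`, -/
theorem pe_zero {y : E → Cx.Z} {A : Set E} (hy : ∀ e, e ∉ T.TE → e ∉ A → y e = 0) {v} (hv : v ≠ T.r)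
    (hA : ∀ e ∈ A, C.cut (T.X v) e = 0) (h0 : C.pr y (T.X v) = 0) : y (T.pe v) = 0 := by
  unfold Cx.pr at h0
  rw [Finset.sum_eq_single (T.pe v)] at h0
  · rwa [T.cut_X hv hv, if_pos rfl, mul_one] at h0
  · intro e _ he
    by_cases h1 : e ∈ A
    · rw [hA e h1, mul_zero]
    · by_cases h2 : e ∈ T.TE
      · obtain ⟨w, hw, rfl⟩ := h2
        rw [T.cut_X hv hw, if_neg, mul_zero]
        rintro rfl; exact he rfl
      · rw [hy e h2 h1, zero_mul]
  · simp

abbrev N := {e : E // e ∉ T.TE}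

def Phi : (F → Cx.Z) →ₗ[Cx.Z] (T.N → Cx.Z) where
  toFun D := fun e => C.bd D e.1
  map_add' D D' := by ext e; simp only [Cx.bd, Pi.add_apply, add_mul, Finset.sum_add_distrib]
  map_smul' a D := by
    ext e; simp only [Cx.bd, Pi.smul_apply, smul_eq_mul, mul_assoc, Finset.mul_sum, RingHom.id_apply]

theorem ker_Phi {D : F → Cx.Z} (h : T.Phi D = 0) (f f' : F) : D f = D f' := by
  have h1 : ∀ e, C.bd D e = 0 := by
    intro e
    by_cases he : e ∈ T.TE
    · obtain ⟨v, hv, rfl⟩ := he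
      exact T.pe_zero (A := ∅) (fun e he _ => congrFun h ⟨e, he⟩) hv (by simp) (C.pr_bd D _)
    · exact congrFun h ⟨e, he⟩
  have := C.Comp_ind (B := ∅) (f := f) (p := fun o => D f = D o) rfl (by
    intro e o o' _ ho ho' h
    by_cases hne : o = o'
    · rw [← hne]; exact h
    · have h2 := h1 e
      rw [C.bd_eq D hne ho ho'] at h2
      rw [h]; exact Cx.Zeq h2)
  exact this f' (C.face_conn f f')

theorem card_N : Fintype.card T.N + Fintype.card V = Fintype.card E + 1 := by
  have h1 : Fintype.card {v : V // v ≠ T.r} = Fintype.card {e : E // e ∈ T.TE} := by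
    apply Fintype.card_of_bijective (f := fun v => ⟨T.pe v.1, v.1, v.2, rfl⟩)
    constructor
    · rintro ⟨v, hv⟩ ⟨w, hw⟩ h
      exact Subtype.ext (T.pe_inj hv hw (congrArg Subtype.val h))
    · rintro ⟨e, v, hv, rfl⟩; exact ⟨⟨v, hv⟩, rfl⟩
  have h2 := Fintype.card_subtype_compl (fun e : E => e ∈ T.TE)
  have h3 := Fintype.card_subtype_le (fun e : E => e ∈ T.TE)
  have h4 : Fintype.card {v : V // v ≠ T.r} = Fintype.card V - 1 := by
    rw [Fintype.card_subtype_compl, Fintype.card_subtype_eq]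
  have h5 : 0 < Fintype.card V := Fintype.card_pos_iff.2 ⟨T.r⟩
  have h6 : Fintype.card T.N = Fintype.card E - Fintype.card {e : E // e ∈ T.TE} := h2
  omega

theorem H1 (g : ℕ) (hg : Fintype.card E + 2 ≤ Fintype.card V + Fintype.card F + g) :
    ∃ X : Finset E, X.card ≤ g ∧ ∀ z : E → Cx.Z, ∃ D, ∀ e, e ∉ T.TE → e ∉ X → z e = C.bd D e := by
  set W := LinearMap.range T.Phi with hW
  have hr : Module.finrank Cx.Z W + Module.finrank Cx.Z (LinearMap.ker T.Phi) = Module.finrank Cx.Z (F → Cx.Z) :=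
    LinearMap.finrank_range_add_finrank_ker T.Phi
  have hk : Module.finrank Cx.Z (LinearMap.ker T.Phi) ≤ 1 := by
    apply finrank_le_one (⟨fun _ => 1, by
      rw [LinearMap.mem_ker]; ext e; exact C.bd_one e.1⟩ : LinearMap.ker T.Phi)
    rintro ⟨D, hD⟩
    rw [LinearMap.mem_ker] at hD
    rcases isEmpty_or_nonempty F with hF | ⟨⟨f⟩⟩
    · exact ⟨0, by ext f; exact hF.elim f⟩
    · refine ⟨D f, ?_⟩
      ext f'
      simp [T.ker_Phi hD f f']
  set Q := (T.N → Cx.Z) ⧸ W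
  have hQ : Module.finrank Cx.Z Q + Module.finrank Cx.Z W = Module.finrank Cx.Z (T.N → Cx.Z) :=
    Submodule.finrank_quotient_add_finrank W
  have e1 : Module.finrank Cx.Z (T.N → Cx.Z) = Fintype.card T.N := Module.finrank_fintype_fun_eq_card _
  have e2 : Module.finrank Cx.Z (F → Cx.Z) = Fintype.card F := Module.finrank_fintype_fun_eq_card _
  have hc := T.card_N
  set b : T.N → Q := fun e => W.mkQ (Pi.single e 1) with hb
  obtain ⟨κ, a, ha, hspan, hli⟩ := exists_linearIndependent' Cx.Z b
  have : Fintype κ := Fintype.ofInjective a ha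
  have hcard : Fintype.card κ ≤ Module.finrank Cx.Z Q := hli.fintype_card_le_finrank
  refine ⟨univ.image (fun k => (a k).1), ?_, ?_⟩
  · refine Finset.card_image_le.trans ?_
    rw [Finset.card_univ]; omega
  · intro z
    have htop : ∀ q : T.N → Cx.Z, W.mkQ q ∈ Submodule.span Cx.Z (Set.range (b ∘ a)) := by
      intro q
      rw [hspan]
      have : q = ∑ e, q e • (Pi.single e (1 : Cx.Z) : T.N → Cx.Z) := by
        ext x; simp [Finset.sum_apply, Pi.single_apply]
      rw [this, map_sum]
      apply Submodule.sum_mem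
      intro e _
      rw [map_smul]
      exact Submodule.smul_mem _ _ (Submodule.subset_span ⟨e, rfl⟩)
    have h := htop (fun e => z e.1)
    rw [Submodule.mem_span_range_iff_exists_fun] at h
    obtain ⟨c, hc⟩ := h
    have : W.mkQ ((fun e : T.N => z e.1) - ∑ k, c k • Pi.single (a k) 1) = 0 := by
      rw [map_sub, ← hc, map_sum]
      simp only [map_smul]
      exact sub_self _
    rw [Submodule.mkQ_apply, Submodule.Quotient.mk_eq_zero] at this
    obtain ⟨D, hD⟩ := this
    refine ⟨D, fun e he heX => ?_⟩
    have h2 := congrFun hD ⟨e, he⟩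
    change C.bd D e = _ at h2
    rw [h2, Pi.sub_apply, Finset.sum_apply, Finset.sum_eq_zero, sub_zero]
    intro k _
    rw [Pi.smul_apply, Pi.single_apply, if_neg, smul_zero]
    intro h3
    exact heX (by simp only [mem_image, mem_univ, true_and]; exact ⟨k, by rw [← h3]⟩)

/-- initial walls -/
theorem init (g : ℕ) (hg : Fintype.card E + 2 ≤ Fintype.card V + Fintype.card F + g) :
    ∃ (A : Finset V) (S : Set V) (B : Set E), A.card ≤ 2 * g ∧ T.r ∈ S ∧
      (∀ v ∈ S, v = T.r ∨ ∃ a ∈ A, T.Anc v a) ∧ 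
      (∀ e ∈ B, ∀ v ∈ C.ends e, v ∈ S) ∧ C.Hyp B S := by
  obtain ⟨X, hX, h⟩ := T.H1 g hg
  set A : Finset V := X.biUnion (fun e => univ.filter (· ∈ C.ends e)) with hA
  set S : Set V := {v | v = T.r ∨ ∃ a ∈ A, T.Anc v a} with hS
  have hXS : ∀ e ∈ X, ∀ v ∈ C.ends e, v ∈ S := fun e he v hv =>
    Or.inr ⟨v, by simp only [hA, mem_biUnion, mem_filter, mem_univ, true_and]; exact ⟨e, he, hv⟩,
      ReflTransGen.refl⟩
  have hup : ∀ v w, w ∈ S → T.Anc v w → v ∈ S := by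
    rintro v w (rfl | ⟨a, ha, h⟩) h'
    · rw [Anc_iff] at h'; simp at h'; exact Or.inl h'.symm
    · exact Or.inr ⟨a, ha, ReflTransGen.trans h h'⟩
  have hpar : ∀ v, v ≠ T.r → T.Anc (T.par v) v := fun v hv => ReflTransGen.single ⟨hv, rfl⟩
  refine ⟨A, S, {e | e ∈ X ∨ ∃ v ∈ S, v ≠ T.r ∧ T.pe v = e}, ?_, Or.inl rfl, fun v hv => hv, ?_, ?_⟩
  · refine (Finset.card_biUnion_le_card_mul X _ 2 ?_).trans (by omega)
    intro e _
    obtain ⟨u, v, -, he⟩ := C.ends_ex e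
    refine (Finset.card_le_card (t := {u, v}) ?_).trans Finset.card_le_two
    intro x; simp [he]
  · rintro e (he | ⟨v, hv, hvr, rfl⟩) w hw
    · exact hXS e he w hw
    · rw [T.pe_ends v hvr, Sym2.mem_iff] at hw
      rcases hw with rfl | rfl
      · exact hv
      · exact hup _ _ hv (hpar v hvr)
  · intro z hz
    obtain ⟨D, hD⟩ := h z
    refine ⟨D, fun e he => ?_⟩
    simp only [Set.mem_ofPred_eq, not_or] at he
    by_cases hT : e ∈ T.TE
    · obtain ⟨v, hv, rfl⟩ := hT
      have hvS : v ∉ S := fun hvS => he.2 ⟨v, hvS, hv, rfl⟩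
      have hXv : ∀ w ∈ S, T.X v w = 0 := by
        intro w hw; unfold BFS.X; rw [if_neg]; exact fun h => hvS (hup _ _ hw h)
      have := T.pe_zero (y := z + C.bd D) (A := X) (by
        intro e h1 h2; rw [Pi.add_apply, hD e h1 h2, Cx.Zadd]) hv
        (fun e he => C.cut_zero fun w hw => hXv w (hXS e he w hw))
        (by rw [C.pr_add, hz _ hXv, C.pr_bd, add_zero])
      exact Cx.Zeq this
    · exact hD e hT he.1

end BFS
end
end FPS


set_option linter.unusedSectionVars false
set_option linter.unusedVariables false
namespace FPS
noncomputable section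
open Finset Relation
open scoped Classical
variable {V E F : Type} [Fintype V] [Fintype E] [Fintype F]

namespace BFS
variable {C : Cx V E F} (T : BFS C) (S : Set V)

def hitA : ℕ → V → V
  | 0, v => v
  | n+1, v => if v ∈ S then v else hitA n (T.par v)

def pathA : ℕ → V → Finset V
  | 0, _ => ∅
  | n+1, v => if v ∈ S then ∅ else insert v (pathA n (T.par v))

def hit (v : V) : V := T.hitA S (T.depth v) v
def pathV (v : V) : Finset V := T.pathA S (T.depth v) v

variable {S}

theorem hit_mem {v} (h : v ∈ S) : T.hit S v = v := by
  unfold hit; cases T.depth v <;> simp [hitA, h]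

theorem path_mem {v} (h : v ∈ S) : T.pathV S v = ∅ := by
  unfold pathV; cases T.depth v <;> simp [pathA, h]

variable (hr : T.r ∈ S)
include hr

theorem ne_r {v} (h : v ∉ S) : v ≠ T.r := fun e => h (e ▸ hr)

theorem hit_not {v} (h : v ∉ S) : T.hit S v = T.hit S (T.par v) := by
  unfold hit; rw [T.dep v (T.ne_r hr h)]; simp [hitA, h]

theorem path_not {v} (h : v ∉ S) : T.pathV S v = insert v (T.pathV S (T.par v)) := by
  unfold pathV; rw [T.dep v (T.ne_r hr h)]; simp [pathA, h]

theorem ind' {p : V → Prop} (hs : ∀ v ∈ S, p v) (hn : ∀ v, v ∉ S → p (T.par v) → p v) : ∀ v, p v := by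
  refine T.ind (hs _ hr) ?_
  · intro v hv ih
    by_cases h : v ∈ S
    · exact hs v h
    · exact hn v h ih

theorem hit_S (v) : T.hit S v ∈ S := by
  refine T.ind' hr (p := fun v => T.hit S v ∈ S) ?_ ?_ v
  · intro v hv; rwa [T.hit_mem hv]
  · intro v hv ih; rwa [T.hit_not hr hv]

theorem path_prop {v} : ∀ w ∈ T.pathV S v, w ∉ S ∧ T.Anc w v ∧ T.hit S w = T.hit S v ∧
    T.pathV S w ⊆ T.pathV S v ∧ (T.par w ∈ S ∨ T.par w ∈ T.pathV S v) := by
  refine T.ind' hr (p := fun v => ∀ w ∈ T.pathV S v, w ∉ S ∧ T.Anc w v ∧ T.hit S w = T.hit S v ∧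
    T.pathV S w ⊆ T.pathV S v ∧ (T.par w ∈ S ∨ T.par w ∈ T.pathV S v)) ?_ ?_ v
  · intro v hv; rw [T.path_mem hv]; simp
  · intro v hv ih w hw
    rw [T.path_not hr hv, mem_insert] at hw
    rcases hw with rfl | hw
    · refine ⟨hv, ReflTransGen.refl, rfl, Finset.Subset.refl _, ?_⟩
      by_cases h : T.par w ∈ S
      · exact Or.inl h
      · right; rw [T.path_not hr hv, T.path_not hr h]; simp
    · obtain ⟨h1, h2, h3, h4, h5⟩ := ih w hw
      refine ⟨h1, ReflTransGen.head ⟨T.ne_r hr hv, rfl⟩ h2, by rw [h3, T.hit_not hr hv], ?_, ?_⟩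
      · rw [T.path_not hr hv]; exact h4.trans (Finset.subset_insert _ _)
      · rw [T.path_not hr hv]; exact h5.imp id (Finset.mem_insert_of_mem)

theorem self_path {v} (h : v ∉ S) : v ∈ T.pathV S v := by rw [T.path_not hr h]; simp

theorem not_path_par {v} (h : v ∉ S) : v ∉ T.pathV S (T.par v) := by
  intro h1
  have := T.Anc_depth (T.path_prop hr v h1).2.1
  have := T.dep v (T.ne_r hr h); omega

theorem card_par {v} (h : v ∉ S) : (T.pathV S (T.par v)).card < (T.pathV S v).card := by
  rw [T.path_not hr h, Finset.card_insert_of_notMem (T.not_path_par hr h)]; omega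

theorem card_path {v w} (h : w ∈ T.pathV S v) (hne : w ≠ v) : (T.pathV S w).card < (T.pathV S v).card := by
  obtain ⟨h1, h2, h3, h4, h5⟩ := T.path_prop hr w h
  refine Finset.card_lt_card ⟨h4, fun h6 => ?_⟩
  have hv : v ∉ S := by intro hv; rw [T.path_mem hv] at h; simp at h
  have h7 := T.path_prop hr v (h6 (T.self_path hr hv))
  have := T.Anc_depth h7.2.1
  have := T.Anc_depth h2
  exact hne (T.Anc_inj h2 ReflTransGen.refl (by omega))

theorem path_depth {v w w'} (h : w ∈ T.pathV S v) (h' : w' ∈ T.pathV S v) (hd : T.depth w = T.depth w') :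
    w = w' := T.Anc_inj (T.path_prop hr w h).2.1 (T.path_prop hr w' h').2.1 hd

theorem last_unique {v w w'} (h : w ∈ T.pathV S v) (h' : w' ∈ T.pathV S v) (hp : T.par w ∈ S)
    (hp' : T.par w' ∈ S) : w = w' := by
  obtain ⟨a1, -, a3, -⟩ := T.path_prop hr w h
  obtain ⟨b1, -, b3, -⟩ := T.path_prop hr w' h'
  rw [T.hit_not hr a1, T.hit_mem hp] at a3
  rw [T.hit_not hr b1, T.hit_mem hp'] at b3
  apply T.path_depth hr h h'
  rw [T.dep w (T.ne_r hr a1), T.dep w' (T.ne_r hr b1), a3, b3]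

omit hr in
variable (S) in
/-- path chain -/
def P (v : V) : E → Cx.Z := ∑ w ∈ T.pathV S v, Pi.single (T.pe w) 1

theorem P_off {v e} (h : ∀ w ∈ T.pathV S v, T.pe w ≠ e) : T.P S v e = 0 := by
  unfold P; rw [Finset.sum_apply]; apply Finset.sum_eq_zero
  intro w hw; rw [Pi.single_apply, if_neg]; exact fun h' => h w hw h'.symm

theorem P_on {v w} (h : w ∈ T.pathV S v) : T.P S v (T.pe w) = 1 := by
  unfold P; rw [Finset.sum_apply, Finset.sum_eq_single w]
  · simp
  · intro b hb hne
    rw [Pi.single_apply, if_neg]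
    intro h'
    exact hne (T.pe_inj (T.ne_r hr (T.path_prop hr b hb).1) (T.ne_r hr (T.path_prop hr w h).1) h'.symm)
  · exact fun h' => absurd h h'

theorem pr_P (v) (X) : C.pr (T.P S v) X = X v + X (T.hit S v) := by
  refine T.ind' hr (p := fun v => C.pr (T.P S v) X = X v + X (T.hit S v)) ?_ ?_ v
  · intro v hv
    have : T.P S v = 0 := by unfold P; rw [T.path_mem hv]; simp
    rw [this, T.hit_mem hv, Cx.Zadd]; simp [Cx.pr]
  · intro v hv ih
    have : T.P S v = Pi.single (T.pe v) 1 + T.P S (T.par v) := by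
      unfold P; rw [T.path_not hr hv, Finset.sum_insert (T.not_path_par hr hv)]
    rw [this, C.pr_add, ih, C.pr_single, C.cut_eq (T.pe_ends v (T.ne_r hr hv)), T.hit_not hr hv]
    have := Cx.Zadd (X (T.par v))
    linear_combination this

/-- within one merged layer a path has at most `q` vertices -/
theorem path_layer {q : ℕ} (hq : 0 < q) (v : V) (m : ℕ) :
    ((T.pathV S v).filter (fun w => T.depth w / q = m)).card ≤ q := by
  have : ((T.pathV S v).filter (fun w => T.depth w / q = m)).card ≤ (Ico (m*q) (m*q+q)).card := by
    apply Finset.card_le_card_of_injOn T.depth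
    · intro w hw
      simp only [coe_filter, Set.mem_ofPred_eq] at hw
      obtain ⟨h, rfl⟩ := hw
      simp only [coe_Ico, Set.mem_Ico]
      have h1 := Nat.div_add_mod (T.depth w) q
      have h2 := Nat.mod_lt (T.depth w) hq
      rw [mul_comm] at h1
      omega
    · intro a ha b hb hd
      simp only [coe_filter, Set.mem_ofPred_eq] at ha hb
      exact T.path_depth hr ha.1 hb.1 hd
  simpa using this

end BFS

/-- basic wall invariants -/
structure Base {C : Cx V E F} (T : BFS C) (S : Set V) (B : Set E) : Prop where
  root : T.r ∈ S
  walls : ∀ e ∈ B, ∀ v ∈ C.ends e, v ∈ S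
  hyp : C.Hyp B S

section
variable {C : Cx V E F} {T : BFS C} {S : Set V} {B : Set E} (hb : Base T S B)
include hb

theorem Base.pe_nw {w} (h : w ∉ S) : T.pe w ∉ B := fun hB =>
  h (hb.walls _ hB w (by rw [T.pe_ends w (T.ne_r hb.root h)]; simp))

theorem Base.star {v f f' g} (hv : v ∉ S) (h : C.VOn v f) (h' : C.VOn v f') (hf : f ∈ C.Comp B g) :
    f' ∈ C.Comp B g := C.star_comp (fun e he h => hv (hb.walls e he v h)) h h' hf

/-- a path from a vertex on a face of K stays in K -/
theorem Base.path {v f g} (h : C.VOn v f) (hf : f ∈ C.Comp B g) :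
    (∀ w ∈ T.pathV S v, (∀ o, C.VOn w o → o ∈ C.Comp B g) ∧ (∀ o, C.On (T.pe w) o → o ∈ C.Comp B g)) ∧
    ∃ o ∈ C.Comp B g, C.VOn (T.hit S v) o := by
  have hr := hb.root
  refine T.ind' hr (p := fun v => ∀ f, C.VOn v f → f ∈ C.Comp B g →
    (∀ w ∈ T.pathV S v, (∀ o, C.VOn w o → o ∈ C.Comp B g) ∧ (∀ o, C.On (T.pe w) o → o ∈ C.Comp B g)) ∧
    ∃ o ∈ C.Comp B g, C.VOn (T.hit S v) o) ?_ ?_ v f h hf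
  · intro v hv f h hf
    rw [T.path_mem hv, T.hit_mem hv]
    exact ⟨by simp, f, hf, h⟩
  · intro v hv ih f h hf
    have hall : ∀ o, C.VOn v o → o ∈ C.Comp B g := fun o ho => hb.star hv h ho hf
    have hpe := T.pe_ends v (T.ne_r hr hv)
    have hpo : ∀ o, C.On (T.pe v) o → o ∈ C.Comp B g := fun o ho =>
      hall o (C.VOn_of_mem ho (by rw [hpe]; simp))
    obtain ⟨o, ho⟩ := C.exists_face (T.pe v)
    obtain ⟨h1, h2⟩ := ih o (C.VOn_of_mem ho (by rw [hpe]; simp)) (hpo o ho)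
    rw [T.path_not hr hv, T.hit_not hr hv]
    refine ⟨?_, h2⟩
    intro w hw
    rw [mem_insert] at hw
    rcases hw with rfl | hw
    · exact ⟨hall, hpo⟩
    · exact h1 w hw
end

end
end FPS


set_option linter.unusedSectionVars false
set_option linter.unusedVariables false
namespace FPS
noncomputable section
open Finset Relation
open scoped Classical
variable {V E F : Type} [Fintype V] [Fintype E] [Fintype F]

section comb
variable {α : Type} {Γ : Finset α} {l : α → Finset ℕ} (hc : Γ.card ≤ 3) (h2 : ∀ g ∈ Γ, (l g).card = 2)
  (hev : ∀ A, Even (Γ.filter (fun g => A ∈ l g)).card)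
include hc h2 hev

theorem cls_inj3 (h3 : Γ.card = 3) : ∀ g ∈ Γ, ∀ h ∈ Γ, l g = l h → g = h := by
  intro g hg h hh hl
  by_contra hne
  obtain ⟨x, hx, hxg, hxh⟩ : ∃ x ∈ Γ, x ≠ g ∧ x ≠ h := by
    by_contra hcon
    push Not at hcon
    have : Γ ⊆ {g, h} := by
      intro x hx
      by_cases hxg : x = g
      · simp [hxg]
      · simp [hcon x hx hxg]
    have := (Finset.card_le_card this).trans Finset.card_le_two
    omega
  have hΓ : ({g, h, x} : Finset α) = Γ := by
    apply Finset.eq_of_subset_of_card_le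
    · intro y; simp only [mem_insert, mem_singleton]; rintro (rfl | rfl | rfl) <;> assumption
    · rw [h3, Finset.card_eq_three.2 ⟨g, h, x, hne, hxg.symm, hxh.symm, rfl⟩]
  obtain ⟨i, hi⟩ : (l x).Nonempty := by rw [← Finset.card_pos, h2 x hx]; omega
  have e1 := hev i
  by_cases hig : i ∈ l g
  · have : Γ.filter (fun g => i ∈ l g) = {g, h, x} := by
      rw [hΓ, Finset.filter_eq_self, ← hΓ]
      intro y; simp only [mem_insert, mem_singleton]
      rintro (rfl | rfl | rfl)
      · exact hig
      · rw [← hl]; exact hig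
      · exact hi
    rw [this, Finset.card_eq_three.2 ⟨g, h, x, hne, hxg.symm, hxh.symm, rfl⟩] at e1
    exact absurd e1 (by decide)
  · have : Γ.filter (fun g => i ∈ l g) = {x} := by
      rw [← hΓ]; ext y; simp only [mem_filter, mem_insert, mem_singleton]
      constructor
      · rintro ⟨rfl | rfl | rfl, h5⟩
        · exact absurd h5 hig
        · rw [← hl] at h5; exact absurd h5 hig
        · rfl
      · rintro rfl; exact ⟨Or.inr (Or.inr rfl), hi⟩
    rw [this, Finset.card_singleton] at e1
    exact absurd e1 (by decide)

theorem cls_pair {g h} (hg : g ∈ Γ) (hh : h ∈ Γ) (hne : g ≠ h) :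
    ∃ i, Γ.filter (fun x => i ∈ l x) = {g, h} := by
  by_cases hx : ∃ x ∈ Γ, x ≠ g ∧ x ≠ h
  · obtain ⟨x, hx, hxg, hxh⟩ := hx
    have h3 : ({g, h, x} : Finset α).card = 3 := Finset.card_eq_three.2 ⟨g, h, x, hne, hxg.symm, hxh.symm, rfl⟩
    have hΓ : ({g, h, x} : Finset α) = Γ := by
      apply Finset.eq_of_subset_of_card_le
      · intro y; simp only [mem_insert, mem_singleton]; rintro (rfl | rfl | rfl) <;> assumption
      · omega
    have hne2 : l g ≠ l x := fun h4 => hxg (cls_inj3 hc h2 hev (hΓ ▸ h3) g hg x hx h4).symm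
    obtain ⟨i, hi, hix⟩ : ∃ i ∈ l g, i ∉ l x := by
      by_contra hcon
      push Not at hcon
      exact hne2 (Finset.eq_of_subset_of_card_le hcon (by rw [h2 g hg, h2 x hx]))
    refine ⟨i, ?_⟩
    have hih : i ∈ l h := by
      by_contra hih
      have e1 := hev i
      have : Γ.filter (fun g => i ∈ l g) = {g} := by
        rw [← hΓ]; ext y; simp only [mem_filter, mem_insert, mem_singleton]
        constructor
        · rintro ⟨rfl | rfl | rfl, h5⟩
          · rfl
          · exact absurd h5 hih
          · exact absurd h5 hix
        · rintro rfl; exact ⟨Or.inl rfl, hi⟩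
      rw [this, Finset.card_singleton] at e1
      exact absurd e1 (by decide)
    rw [← hΓ]; ext y; simp only [mem_filter, mem_insert, mem_singleton]
    constructor
    · rintro ⟨rfl | rfl | rfl, h5⟩
      · exact Or.inl rfl
      · exact Or.inr rfl
      · exact absurd h5 hix
    · rintro (rfl | rfl)
      · exact ⟨Or.inl rfl, hi⟩
      · exact ⟨Or.inr (Or.inl rfl), hih⟩
  · push Not at hx
    have hΓ : Γ = {g, h} := by
      ext y; simp only [mem_insert, mem_singleton]
      constructor
      · intro hy; by_cases h1 : y = g
        · exact Or.inl h1
        · exact Or.inr (hx y hy h1)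
      · rintro (rfl | rfl) <;> assumption
    obtain ⟨i, hi⟩ : (l g).Nonempty := by rw [← Finset.card_pos, h2 g hg]; omega
    refine ⟨i, ?_⟩
    have hih : i ∈ l h := by
      by_contra hih
      have e1 := hev i
      have : Γ.filter (fun g => i ∈ l g) = {g} := by
        rw [hΓ]; ext y; simp only [mem_filter, mem_insert, mem_singleton]
        constructor
        · rintro ⟨rfl | rfl, h5⟩
          · rfl
          · exact absurd h5 hih
        · rintro rfl; exact ⟨Or.inl rfl, hi⟩
      rw [this, Finset.card_singleton] at e1
      exact absurd e1 (by decide)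
    rw [Finset.filter_eq_self.2, hΓ]
    rw [hΓ]; intro y; simp only [mem_insert, mem_singleton]
    rintro (rfl | rfl) <;> assumption

theorem cls_card : (Γ.biUnion l).card ≤ Γ.card := by
  have h1 : ∑ A ∈ Γ.biUnion l, (Γ.filter (fun g => A ∈ l g)).card = ∑ g ∈ Γ, (l g).card := by
    simp only [Finset.card_filter]
    rw [Finset.sum_comm]
    apply Finset.sum_congr rfl
    intro g hg
    rw [← Finset.card_filter]
    congr 1
    ext A; simp only [mem_filter, mem_biUnion]
    exact ⟨fun h => h.2, fun h => ⟨⟨g, hg, h⟩, h⟩⟩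
  rw [Finset.sum_congr rfl h2, Finset.sum_const, smul_eq_mul] at h1
  have h4 : ∑ A ∈ Γ.biUnion l, 2 ≤ ∑ A ∈ Γ.biUnion l, (Γ.filter (fun g => A ∈ l g)).card := by
    apply Finset.sum_le_sum
    intro A hA
    obtain ⟨g, hg, hA⟩ := mem_biUnion.1 hA
    have : 0 < (Γ.filter (fun g => A ∈ l g)).card := Finset.card_pos.2 ⟨g, by simp [hg, hA]⟩
    obtain ⟨k, hk⟩ := hev A
    omega
  rw [h1, Finset.sum_const, smul_eq_mul] at h4
  omega
end comb

variable (C : Cx V E F)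

def lab (part : V → ℕ) (e : E) : Finset ℕ := (univ.filter (· ∈ C.ends e)).image part

theorem lab_eq {part : V → ℕ} {e u v} (h : C.ends e = s(u, v)) : lab C part e = {part u, part v} := by
  ext a; simp [lab, h]; constructor
  · rintro (h | h) <;> simp [h]
  · rintro (h | h) <;> simp [h]

def Gam (B : Set E) (part : V → ℕ) (g : F) : Finset (E × F) :=
  univ.filter (fun p => p.1 ∈ B ∧ p.2 ∈ C.Comp B g ∧ C.On p.1 p.2 ∧ (lab C part p.1).card = 2)

def Lb (S : Set V) (B : Set E) (part : V → ℕ) (g : F) : Finset ℕ :=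
  (univ.filter (fun v => v ∈ S ∧ ∃ o ∈ C.Comp B g, C.VOn v o)).image part

theorem mem_Gam {B : Set E} {part g p} : p ∈ Gam C B part g ↔
    p.1 ∈ B ∧ p.2 ∈ C.Comp B g ∧ C.On p.1 p.2 ∧ (lab C part p.1).card = 2 := by simp [Gam]

theorem mem_Lb {S : Set V} {B : Set E} {part : V → ℕ} {g A} : A ∈ Lb C S B part g ↔
    ∃ v, v ∈ S ∧ (∃ o ∈ C.Comp B g, C.VOn v o) ∧ part v = A := by simp [Lb, and_assoc]

def chi (S : Set V) (part : V → ℕ) (A : ℕ) : V → Cx.Z := fun v => if v ∈ S ∧ part v = A then 1 else 0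

section
variable {C} {T : BFS C} {S : Set V} {B : Set E} (hb : Base T S B) (part : V → ℕ)
include hb

theorem cut_chi {e} (he : e ∈ B) (A) :
    C.cut (chi S part A) e = if A ∈ lab C part e ∧ (lab C part e).card = 2 then 1 else 0 := by
  obtain ⟨u, v, -, h⟩ := C.ends_ex e
  have hu := hb.walls e he u (by simp [h])
  have hv := hb.walls e he v (by simp [h])
  rw [C.cut_eq h, lab_eq C h]
  unfold chi
  by_cases hp : part u = part v
  · rw [hp]; simp [hu, hv, Cx.Zadd]
  · rw [Finset.card_pair hp]
    by_cases h1 : part u = A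
    · have : part v ≠ A := fun h2 => hp (h1.trans h2.symm)
      simp [hu, h1, this]
    · by_cases h2 : part v = A
      · simp [hu, hv, h1, h2]
      · simp [h1, h2, Ne.symm h1, Ne.symm h2]

theorem gate_sum (D : F → Cx.Z) (A : ℕ) (g : F) :
    ∑ p ∈ (univ : Finset (E × F)).filter (fun p => p.1 ∈ B ∧ p.2 ∈ C.Comp B g ∧ C.On p.1 p.2),
      D p.2 * C.cut (chi S part A) p.1 = ∑ p ∈ (Gam C B part g).filter (fun p => A ∈ lab C part p.1), D p.2 := by
  rw [Finset.sum_filter, Finset.sum_filter, Gam, Finset.sum_filter]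
  apply Finset.sum_congr rfl
  rintro ⟨e, o⟩ _
  by_cases h : e ∈ B
  · rw [cut_chi hb part h]
    by_cases h1 : o ∈ C.Comp B g <;> by_cases h2 : C.On e o <;> by_cases h3 : (lab C part e).card = 2 <;>
      by_cases h4 : A ∈ lab C part e <;> simp [h, h1, h2, h3, h4]
  · simp [h]

theorem gate_even (A : ℕ) (g : F) : Even ((Gam C B part g).filter (fun p => A ∈ lab C part p.1)).card := by
  have := C.master (B := B) g (fun _ => 1) (C.cut (chi S part A)) (fun f => C.face_cut f _)
  simp only [C.bd_one, zero_mul, Finset.sum_const_zero, zero_add] at this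
  rw [gate_sum hb part (fun _ => 1) A g] at this
  simp only [Finset.sum_const, nsmul_eq_mul, mul_one] at this
  exact (ZMod.natCast_eq_zero_iff_even).1 this

theorem key {z : E → Cx.Z} {D : F → Cx.Z} {A : ℕ} {g : F} (hD : ∀ e, e ∉ B → z e = C.bd D e)
    (hz : ∀ e, e ∉ B → z e ≠ 0 → ∃ o ∈ C.Comp B g, C.On e o)
    (hw : ∀ e ∈ B, z e ≠ 0 → C.cut (chi S part A) e = 0) :
    C.pr z (chi S part A) + ∑ p ∈ (Gam C B part g).filter (fun p => A ∈ lab C part p.1), D p.2 = 0 := by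
  have := C.master (B := B) g D (C.cut (chi S part A)) (fun f => C.face_cut f _)
  rw [gate_sum hb part D A g] at this
  rw [← this]
  congr 1
  unfold Cx.pr
  rw [Finset.sum_filter]
  apply Finset.sum_congr rfl
  intro e _
  by_cases he : e ∈ B
  · simp only [he, not_true_eq_false, false_and, if_false]
    by_cases h0 : z e = 0
    · rw [h0, zero_mul]
    · rw [hw e he h0, mul_zero]
  · rw [← hD e he]
    by_cases h0 : z e = 0
    · simp [h0]
    · simp [he, hz e he h0]

theorem lab_sub {p g} (hp : p ∈ Gam C B part g) : lab C part p.1 ⊆ Lb C S B part g := by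
  rw [mem_Gam] at hp
  intro a ha
  simp only [lab, mem_image, mem_filter, mem_univ, true_and] at ha
  obtain ⟨v, hv, rfl⟩ := ha
  exact (mem_Lb C).2 ⟨v, hb.walls _ hp.1 v hv, ⟨p.2, hp.2.1, C.VOn_of_mem hp.2.2.1 hv⟩, rfl⟩

theorem col_Lb {v o g} (ho : o ∈ C.Comp B g) (hv : C.VOn v o) : part (T.hit S v) ∈ Lb C S B part g := by
  obtain ⟨-, o', h1, h2⟩ := hb.path hv ho
  exact (mem_Lb C).2 ⟨_, T.hit_S hb.root v, ⟨o', h1, h2⟩, rfl⟩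

theorem P_in {v o g e} (ho : o ∈ C.Comp B g) (hv : C.VOn v o) (h : T.P S v e ≠ 0) :
    e ∉ B ∧ ∀ o, C.On e o → o ∈ C.Comp B g := by
  have : ∃ w ∈ T.pathV S v, T.pe w = e := by
    by_contra hcon; push Not at hcon; exact h (T.P_off hb.root hcon)
  obtain ⟨w, hw, rfl⟩ := this
  exact ⟨hb.pe_nw (T.path_prop hb.root w hw).1, ((hb.path hv ho).1 w hw).2⟩

theorem twoLabels {A A' : ℕ} {g : F} (hA : A ∈ Lb C S B part g) (hA' : A' ∈ Lb C S B part g) (hne : A ≠ A') :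
    ∃ p ∈ Gam C B part g, A ∈ lab C part p.1 := by
  by_contra hcon
  push Not at hcon
  have hr := hb.root
  have hedge : ∀ e o u v, o ∈ C.Comp B g → C.On e o → C.ends e = s(u, v) →
      part (T.hit S u) = A → part (T.hit S v) = A := by
    intro e o u v ho he huv hu
    by_contra hv
    have hou : C.VOn u o := C.VOn_of_mem he (by simp [huv])
    have hov : C.VOn v o := C.VOn_of_mem he (by simp [huv])
    by_cases heB : e ∈ B
    · rw [T.hit_mem (hb.walls e heB u (by simp [huv]))] at hu
      rw [T.hit_mem (hb.walls e heB v (by simp [huv]))] at hv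
      refine hcon (e, o) ((mem_Gam C).2 ⟨heB, ho, he, ?_⟩) ?_
      · rw [lab_eq C huv, Finset.card_pair]; rw [hu]; exact Ne.symm hv
      · rw [lab_eq C huv, hu]; simp
    · have hpr : ∀ X, C.pr (T.P S u + Pi.single e 1 + T.P S v) X = X (T.hit S u) + X (T.hit S v) := by
        intro X
        rw [C.pr_add, C.pr_add, T.pr_P hr, T.pr_P hr, C.pr_single, C.cut_eq huv]
        have h1 := Cx.Zadd (X u); have h2 := Cx.Zadd (X v)
        linear_combination h1 + h2
      obtain ⟨D, hD⟩ := hb.hyp _ (fun X hX => by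
        rw [hpr X, hX _ (T.hit_S hr u), hX _ (T.hit_S hr v), add_zero])
      have hin : ∀ e', (T.P S u + Pi.single e 1 + T.P S v : E → Cx.Z) e' ≠ 0 → e' ∉ B ∧ ∃ o ∈ C.Comp B g, C.On e' o := by
        intro e' h'
        by_cases h1 : T.P S u e' = 0
        · by_cases h2 : T.P S v e' = 0
          · by_cases h3 : e' = e
            · subst h3; exact ⟨heB, o, ho, he⟩
            · simp [h1, h2, h3] at h'
          · obtain ⟨a, b⟩ := P_in hb ho hov h2
            obtain ⟨o', ho'⟩ := C.exists_face e'
            exact ⟨a, o', b o' ho', ho'⟩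
        · obtain ⟨a, b⟩ := P_in hb ho hou h1
          obtain ⟨o', ho'⟩ := C.exists_face e'
          exact ⟨a, o', b o' ho', ho'⟩
      have := key hb part (A := A) (g := g) hD (fun e' _ h => (hin e' h).2) (fun e' h1 h => absurd h1 (hin e' h).1)
      rw [hpr, Finset.sum_eq_zero, add_zero] at this
      · simp [chi, T.hit_S hr, hu, hv] at this
      · intro p hp; rw [mem_filter] at hp; exact absurd hp.2 (hcon p hp.1)
  have hface : ∀ o ∈ C.Comp B g, ∀ u v, C.VOn u o → C.VOn v o → part (T.hit S u) = A → part (T.hit S v) = A := by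
    intro o ho
    have h1 : ∀ i, part (T.hit S (C.vtx o i)) = A → part (T.hit S (C.vtx o (i+1))) = A := fun i =>
      hedge _ o _ _ ho (C.on_edge o i) (C.compat o i)
    have h2 : ∀ k i, part (T.hit S (C.vtx o i)) = A → part (T.hit S (C.vtx o (i+k))) = A := by
      intro k; induction k with
      | zero => exact fun i h => h
      | succ k ih => exact fun i h => h1 _ (ih i h)
    rintro u v hu ⟨j, rfl⟩ h
    obtain ⟨i, hi, rfl⟩ := hu.lt
    have := h2 (C.len o - i + j) i h
    rw [← C.vmod o j, ← Nat.add_mod_right, C.vmod]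
    rwa [show i + (C.len o - i + j) = j + C.len o by omega] at this
  obtain ⟨s, hs, ⟨o, ho, hso⟩, hsA⟩ := (mem_Lb C).1 hA
  obtain ⟨s', hs', ⟨o', ho', hso'⟩, hsA'⟩ := (mem_Lb C).1 hA'
  have hall := C.Comp_ind (B := B) (f := o) (p := fun o2 => o2 ∈ C.Comp B o ∧ ∀ v, C.VOn v o2 → part (T.hit S v) = A)
    ⟨C.Comp_self _ _, fun v hv => hface o ho s v hso hv (by rw [T.hit_mem hs, hsA])⟩ (by
    rintro e o1 o2 he h1 h2 ⟨h3, h4⟩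
    have h5 := C.Comp_step h3 he h1 h2
    refine ⟨h5, fun v hv => ?_⟩
    obtain ⟨u, w, -, huw⟩ := C.ends_ex e
    rw [C.Comp_eq ho] at h5
    exact hface o2 h5 u v (C.VOn_of_mem h2 (by simp [huw])) hv (h4 u (C.VOn_of_mem h1 (by simp [huw]))))
  rw [← C.Comp_eq ho] at ho'
  have := (hall o' ho').2 s' hso'
  rw [T.hit_mem hs', hsA'] at this
  exact hne this.symm

variable {g : F} (hc : (Gam C B part g).card ≤ 3)

theorem gam2 : ∀ p ∈ Gam C B part g, (lab C part p.1).card = 2 := fun p hp => ((mem_Gam C).1 hp).2.2.2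

include hc

theorem Lb_card_le : (Lb C S B part g).card ≤ 1 ∨ (Lb C S B part g).card ≤ (Gam C B part g).card := by
  by_cases h : (Lb C S B part g).card ≤ 1
  · exact Or.inl h
  · right
    refine le_trans (Finset.card_le_card ?_) (cls_card hc (gam2 hb part) (fun A => gate_even hb part A g))
    intro A hA
    push Not at h
    obtain ⟨A', hA', hne⟩ := Finset.exists_mem_ne h A
    obtain ⟨p, hp, hp2⟩ := twoLabels hb part hA hA' hne.symm
    exact mem_biUnion.2 ⟨p, hp, hp2⟩

theorem gam3_inj (h3 : (Gam C B part g).card = 3) : ∀ p ∈ Gam C B part g, ∀ p' ∈ Gam C B part g,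
    lab C part p.1 = lab C part p'.1 → p = p' :=
  cls_inj3 hc (gam2 hb part) (fun A => gate_even hb part A g) h3

theorem Lb_gam3 (h3 : (Gam C B part g).card = 3) : (Lb C S B part g).card = 3 := by
  have h1 := Lb_card_le hb part hc
  have h2 : (Gam C B part g).card ≤ (powersetCard 2 (Lb C S B part g)).card := by
    apply Finset.card_le_card_of_injOn (fun p => lab C part p.1)
    · intro p hp; rw [mem_coe, mem_powersetCard]; exact ⟨lab_sub hb part hp, gam2 hb part p hp⟩
    · intro p hp p' hp' h; exact gam3_inj hb part hc h3 p hp p' hp' h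
  rw [Finset.card_powersetCard, h3] at h2
  have h4 : (Lb C S B part g).card ≤ 3 := by omega
  interval_cases hh : (Lb C S B part g).card
  · simp at h2
  · simp at h2
  · simp at h2
  · rfl

theorem gam3_surj (h3 : (Gam C B part g).card = 3) {i j} (hi : i ∈ Lb C S B part g) (hj : j ∈ Lb C S B part g)
    (hij : i ≠ j) : ∃ p ∈ Gam C B part g, lab C part p.1 = {i, j} := by
  have := Finset.surjOn_of_injOn_of_card_le (s := Gam C B part g) (t := powersetCard 2 (Lb C S B part g))
    (fun p => lab C part p.1) (by
      intro p hp; rw [mem_coe, mem_powersetCard]; exact ⟨lab_sub hb part hp, gam2 hb part p hp⟩)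
    (by intro p hp p' hp' h; exact gam3_inj hb part hc h3 p hp p' hp' h)
    (by rw [Finset.card_powersetCard, Lb_gam3 hb part hc h3, h3]; decide)
  have h5 : ({i, j} : Finset ℕ) ∈ (powersetCard 2 (Lb C S B part g) : Finset (Finset ℕ)) := by
    rw [mem_powersetCard]
    refine ⟨?_, Finset.card_pair hij⟩
    intro x; simp only [mem_insert, mem_singleton]; rintro (rfl | rfl) <;> assumption
  obtain ⟨p, hp, hp2⟩ := this (mem_coe.2 h5)
  exact ⟨p, hp, hp2⟩

/-- Sperner-type face choice -/
theorem face_choice : ∃ f ∈ C.Comp B g, (∀ A ∈ Lb C S B part g, ∃ v, C.VOn v f ∧ part (T.hit S v) = A) ∧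
    ((Lb C S B part g).card = 2 → ∃ p ∈ Gam C B part g, p.2 = f) := by
  set L := Lb C S B part g with hL
  rcases le_or_gt L.card 1 with h1 | h1
  · refine ⟨g, C.Comp_self _ _, fun A hA => ⟨_, C.von_vtx g 0, ?_⟩, fun h => by omega⟩
    exact Finset.card_le_one.1 h1 _ (col_Lb hb part (C.Comp_self _ _) (C.von_vtx g 0)) _ hA
  have hle : L.card ≤ (Gam C B part g).card := by
    rcases Lb_card_le hb part hc with h | h
    · rw [← hL] at h; omega
    · exact h
  rcases Nat.lt_or_ge L.card 3 with h3 | h3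
  · obtain ⟨p, hp⟩ : (Gam C B part g).Nonempty := by rw [← Finset.card_pos]; omega
    have hp' := (mem_Gam C).1 hp
    refine ⟨p.2, hp'.2.1, fun A hA => ?_, fun _ => ⟨p, hp, rfl⟩⟩
    have : lab C part p.1 = L := Finset.eq_of_subset_of_card_le (lab_sub hb part hp) (by rw [gam2 hb part p hp]; omega)
    rw [← this] at hA
    simp only [lab, mem_image, mem_filter, mem_univ, true_and] at hA
    obtain ⟨v, hv, rfl⟩ := hA
    exact ⟨v, C.VOn_of_mem hp'.2.2.1 hv, by rw [T.hit_mem (hb.walls _ hp'.1 v hv)]⟩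
  · have hG3 : (Gam C B part g).card = 3 := by omega
    have hL3 : L.card = 3 := by omega
    obtain ⟨i, j, k, hij, hik, hjk, hLe⟩ := Finset.card_eq_three.1 hL3
    set Xc : ℕ → V → Cx.Z := fun a v => if part (T.hit S v) = a then 1 else 0 with hXc
    by_contra hcon
    have hface : ∀ f ∈ C.Comp B g, ∑ e, C.ie e f * (C.cut (Xc i) e * C.cut (Xc j) e) = 0 := by
      intro f hf
      by_cases hk : ∃ v, C.VOn v f ∧ part (T.hit S v) = k
      · by_contra h0
        apply hcon
        refine ⟨f, hf, ?_, fun h => by omega⟩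
        obtain ⟨e, -, he⟩ := Finset.exists_ne_zero_of_sum_ne_zero h0
        have hon : C.On e f := by by_contra h; simp [Cx.ie, h] at he
        obtain ⟨u, v, -, huv⟩ := C.ends_ex e
        have hu := C.VOn_of_mem hon (v := u) (by simp [huv])
        have hv := C.VOn_of_mem hon (v := v) (by simp [huv])
        have hval : ∀ a, C.cut (Xc a) e ≠ 0 → ∃ v, C.VOn v f ∧ part (T.hit S v) = a := by
          intro a ha
          rw [C.cut_eq huv] at ha
          by_contra hno
          push Not at hno
          simp [hXc, hno u hu, hno v hv] at ha
        intro A hA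
        rw [hLe] at hA
        simp only [mem_insert, mem_singleton] at hA
        rcases hA with rfl | rfl | rfl
        · exact hval _ (fun h => he (by rw [h]; ring))
        · exact hval _ (fun h => he (by rw [h]; ring))
        · exact hk
      · push Not at hk
        rw [← C.face_cut f (Xc i)]
        apply Finset.sum_congr rfl
        intro e _
        by_cases hon : C.On e f
        · obtain ⟨u, v, -, huv⟩ := C.ends_ex e
          have hone : ∀ w, C.VOn w f → Xc i w = Xc j w + 1 := by
            intro w hw
            have h4 := col_Lb hb part hf hw
            rw [← hL, hLe] at h4
            simp only [mem_insert, mem_singleton] at h4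
            rcases h4 with h4 | h4 | h4
            · simp [hXc, h4, hij]
            · simp only [hXc, h4, if_true, if_neg (Ne.symm hij)]; decide
            · exact absurd h4 (hk w hw)
          have : C.cut (Xc i) e = C.cut (Xc j) e := by
            rw [C.cut_eq huv, C.cut_eq huv, hone u (C.VOn_of_mem hon (by simp [huv])),
              hone v (C.VOn_of_mem hon (by simp [huv]))]
            have : (1 : Cx.Z) + 1 = 0 := by decide
            linear_combination this
          rw [← this, Cx.Zsq]
        · simp [Cx.ie, hon]
    -- sum over K
    have hsum : ∑ p ∈ (univ : Finset (E × F)).filter (fun p => p.1 ∈ B ∧ p.2 ∈ C.Comp B g ∧ C.On p.1 p.2),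
        C.cut (Xc i) p.1 * C.cut (Xc j) p.1 = 0 := by
      have h0 : ∑ f ∈ univ.filter (· ∈ C.Comp B g), ∑ e, (C.ie e f * (C.cut (Xc i) e * C.cut (Xc j) e)) = 0 :=
        Finset.sum_eq_zero fun f hf => hface f (by simpa using hf)
      rw [Finset.sum_comm] at h0
      rw [← h0, Finset.sum_filter, ← Finset.univ_product_univ, Finset.sum_product]
      apply Finset.sum_congr rfl
      intro e _
      rw [← Finset.sum_mul]
      by_cases he : e ∈ B
      · rw [Finset.sum_filter, Finset.sum_mul]
        apply Finset.sum_congr rfl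
        intro f _
        by_cases h1 : f ∈ C.Comp B g <;> by_cases h2 : C.On e f <;> simp [Cx.ie, he, h1, h2]
      · rw [Finset.sum_eq_zero (by simp [he])]
        have : ∑ f ∈ univ.filter (· ∈ C.Comp B g), C.ie e f = 0 := by
          by_cases h : ∃ o ∈ C.Comp B g, C.On e o
          · obtain ⟨o, ho, heo⟩ := h
            have h6 := C.bd_one e
            unfold Cx.bd at h6
            rw [← h6, Finset.sum_filter]
            apply Finset.sum_congr rfl
            intro f _
            by_cases h1 : f ∈ C.Comp B g
            · simp [h1]
            · have : ¬ C.On e f := fun h2 => h1 (C.Comp_step ho he heo h2)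
              simp [Cx.ie, this]
          · apply Finset.sum_eq_zero
            intro f hf
            have : ¬ C.On e f := fun h2 => h ⟨f, by simpa using hf, h2⟩
            simp [Cx.ie, this]
        rw [this, zero_mul]
    obtain ⟨p, hp, hpl⟩ := gam3_surj hb part hc hG3 (i := i) (j := j) (by rw [← hL, hLe]; simp) (by rw [← hL, hLe]; simp) hij
    have hp' := (mem_Gam C).1 hp
    have hwall : ∀ e ∈ B, ∀ a, C.cut (Xc a) e = C.cut (chi S part a) e := by
      intro e he a
      obtain ⟨u, v, -, huv⟩ := C.ends_ex e
      have hu := hb.walls e he u (by simp [huv])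
      have hv := hb.walls e he v (by simp [huv])
      rw [C.cut_eq huv, C.cut_eq huv]
      simp [hXc, chi, hu, hv, T.hit_mem hu, T.hit_mem hv]
    rw [Finset.sum_eq_single p] at hsum
    · rw [hwall _ hp'.1, hwall _ hp'.1, cut_chi hb part hp'.1, cut_chi hb part hp'.1, hpl] at hsum
      simp [hij] at hsum
    · intro p2 hp2 hne
      simp only [mem_filter, mem_univ, true_and] at hp2
      rw [hwall _ hp2.1, hwall _ hp2.1, cut_chi hb part hp2.1, cut_chi hb part hp2.1]
      by_contra h0
      have h7 : i ∈ lab C part p2.1 ∧ j ∈ lab C part p2.1 ∧ (lab C part p2.1).card = 2 := by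
        by_contra h8
        apply h0
        by_cases ha : i ∈ lab C part p2.1 <;> by_cases hbb : j ∈ lab C part p2.1 <;>
          by_cases hcc : (lab C part p2.1).card = 2 <;> simp_all
      have h8 : lab C part p2.1 = {i, j} := by
        symm; apply Finset.eq_of_subset_of_card_le
        · intro x; simp only [mem_insert, mem_singleton]; rintro (rfl | rfl)
          · exact h7.1
          · exact h7.2.1
        · rw [h7.2.2, Finset.card_pair hij]
      exact hne (gam3_inj hb part hc hG3 p2 ((mem_Gam C).2 ⟨hp2.1, hp2.2.1, hp2.2.2, h7.2.2⟩) p hp (h8.trans hpl.symm))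
    · intro h; exfalso; apply h; simp only [mem_filter, mem_univ, true_and]; exact ⟨hp'.1, hp'.2.1, hp'.2.2.1⟩

end
end
end FPS


set_option linter.unusedSectionVars false
set_option linter.unusedVariables false
namespace FPS
noncomputable section
open Finset Relation
open scoped Classical
variable {V E F : Type} [Fintype V] [Fintype E] [Fintype F]

structure SD {C : Cx V E F} (T : BFS C) (S S' : Set V) (B B' : Set E) (part part' : V → ℕ) (n : ℕ)
    (g f : F) (a : ℕ → V) : Prop where
  base : Base T S B
  lt : ∀ v ∈ S, part v < n
  hc : (Gam C B part g).card ≤ 3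
  hf : f ∈ C.Comp B g
  ha : ∀ j ∈ Lb C S B part g, C.VOn (a j) f ∧ part (T.hit S (a j)) = j
  hmin : ∀ j ∈ Lb C S B part g, ∀ v, C.VOn v f → part (T.hit S v) = j →
    (T.pathV S (a j)).card ≤ (T.pathV S v).card
  h2 : (Lb C S B part g).card = 2 → ∃ p ∈ Gam C B part g, p.2 = f
  nw : ∃ e, e ∉ B ∧ C.On e f
  hS' : ∀ v, v ∈ S' ↔ v ∈ S ∨ C.VOn v f ∨ ∃ j ∈ Lb C S B part g, v ∈ T.pathV S (a j)
  hB' : ∀ e, e ∈ B' ↔ e ∈ B ∨ C.On e f ∨ ∃ j ∈ Lb C S B part g, ∃ w ∈ T.pathV S (a j), T.pe w = e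
  hp : ∀ v ∈ S, part' v = part v
  hp' : ∀ v, v ∉ S → part' v = n

namespace SD
variable {C : Cx V E F} {T : BFS C} {S S' : Set V} {B B' : Set E} {part part' : V → ℕ} {n : ℕ}
  {g f : F} {a : ℕ → V} (h : SD T S S' B B' part part' n g f a)

/-- anchored vertices of `f` -/
def An (C : Cx V E F) (T : BFS C) (S : Set V) (B : Set E) (part : V → ℕ) (g f : F) (a : ℕ → V) (x : V) : Prop :=
  C.VOn x f ∧ (x ∈ S ∨ ∃ j ∈ Lb C S B part g, x = a j)

include h

theorem hr : T.r ∈ S := h.base.root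
theorem BB : B ⊆ B' := fun e he => (h.hB' e).2 (Or.inl he)
theorem SS : S ⊆ S' := fun e he => (h.hS' e).2 (Or.inl he)

theorem An_path {x} (hx : An C T S B part g f a x) {w} (hw : w ∈ T.pathV S x) :
    x ∉ S ∧ ∃ j ∈ Lb C S B part g, x = a j := by
  have hxS : x ∉ S := by intro hxS; rw [T.path_mem hxS] at hw; simp at hw
  exact ⟨hxS, hx.2.resolve_left hxS⟩

theorem A1 {x} (hx : An C T S B part g f a x) {w} (hw : w ∈ T.pathV S x) (hwf : C.VOn w f) : w = x := by
  obtain ⟨-, j, hj, rfl⟩ := h.An_path hx hw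
  by_contra hne
  have h1 := T.card_path h.hr hw hne
  have h2 := h.hmin j hj w hwf (by rw [(T.path_prop h.hr w hw).2.2.1]; exact (h.ha j hj).2)
  omega

theorem A2 {x} (hx : An C T S B part g f a x) {w} (hw : w ∈ T.pathV S x) : ¬ C.On (T.pe w) f := by
  intro hon
  obtain ⟨hxS, j, hj, hxj⟩ := h.An_path hx hw
  have hwS := (T.path_prop h.hr w hw).1
  have he := T.pe_ends w (T.ne_r h.hr hwS)
  have := h.A1 hx hw (C.VOn_of_mem hon (by simp [he]))
  subst this
  have h1 := T.card_par h.hr hxS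
  have h2 := h.hmin j hj (T.par w) (C.VOn_of_mem hon (by simp [he])) (by
    rw [← T.hit_not h.hr hxS, hxj]; exact (h.ha j hj).2)
  rw [← hxj] at h2
  omega

theorem A3 {x} (hx : An C T S B part g f a x) {e} (he : T.P S x e ≠ 0) :
    e ∈ B' ∧ e ∉ B ∧ ¬ C.On e f ∧ ∃ w ∈ T.pathV S x, T.pe w = e := by
  have : ∃ w ∈ T.pathV S x, T.pe w = e := by
    by_contra hcon; push Not at hcon; exact he (T.P_off h.hr hcon)
  obtain ⟨w, hw, rfl⟩ := this
  obtain ⟨hxS, j, hj, hxj⟩ := h.An_path hx hw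
  refine ⟨(h.hB' _).2 (Or.inr (Or.inr ⟨j, hj, w, hxj ▸ hw, rfl⟩)), h.base.pe_nw (T.path_prop h.hr w hw).1,
    h.A2 hx hw, w, hw, rfl⟩

theorem P_f {x} (hx : An C T S B part g f a x) {e} (he : C.On e f) : T.P S x e = 0 := by
  by_contra h0; exact (h.A3 hx h0).2.2.1 he

theorem const_comp {D : F → Cx.Z} (hD : ∀ e, e ∉ B' → C.bd D e = 0) {g' o o'} (ho : o ∈ C.Comp B' g')
    (ho' : o' ∈ C.Comp B' g') : D o = D o' := by
  have key := C.Comp_ind (B := B') (f := g') (p := fun o => D g' = D o) rfl (by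
    intro e o1 o2 he h1 h2 h3
    by_cases hne : o1 = o2
    · rw [← hne, h3]
    · have := hD e he
      rw [C.bd_eq D hne h1 h2] at this
      rw [h3, Cx.Zeq this])
  rw [← key o ho, ← key o' ho']

theorem chain {i j : ℕ} (hij : i ≤ j) (hi : An C T S B part g f a (C.vtx f i))
    (hj : An C T S B part g f a (C.vtx f j)) :
    ∃ D : F → Cx.Z, (∀ e, e ∉ B → (T.P S (C.vtx f i) + C.Sg f i j + T.P S (C.vtx f j)) e = C.bd D e) ∧
      (∀ X, C.pr (T.P S (C.vtx f i) + C.Sg f i j + T.P S (C.vtx f j)) X =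
        X (T.hit S (C.vtx f i)) + X (T.hit S (C.vtx f j))) ∧
      ∀ g' o o', o ∈ C.Comp B' g' → o' ∈ C.Comp B' g' → D o = D o' := by
  have hpr : ∀ X, C.pr (T.P S (C.vtx f i) + C.Sg f i j + T.P S (C.vtx f j)) X =
        X (T.hit S (C.vtx f i)) + X (T.hit S (C.vtx f j)) := by
    intro X
    rw [C.pr_add, C.pr_add, T.pr_P h.hr, T.pr_P h.hr, C.pr_Sg f hij]
    have h1 := Cx.Zadd (X (C.vtx f i)); have h2 := Cx.Zadd (X (C.vtx f j))
    linear_combination h1 + h2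
  obtain ⟨D, hD⟩ := h.base.hyp _ (fun X hX => by
    rw [hpr X, hX _ (T.hit_S h.hr _), hX _ (T.hit_S h.hr _), add_zero])
  refine ⟨D, hD, hpr, fun g' o o' ho ho' => h.const_comp (fun e he => ?_) ho ho'⟩
  rw [← hD e (fun hB => he (h.BB hB))]
  have h1 : T.P S (C.vtx f i) e = 0 := by by_contra h0; exact he (h.A3 hi h0).1
  have h2 : T.P S (C.vtx f j) e = 0 := by by_contra h0; exact he (h.A3 hj h0).1
  have h3 : C.Sg f i j e = 0 := C.Sg_off f i j (fun ho => he ((h.hB' e).2 (Or.inr (Or.inl ho))))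
  simp only [Pi.add_apply, h1, h2, h3, add_zero]

/-- symmetric version -/
theorem chain2 {x y : V} (hx : An C T S B part g f a x) (hy : An C T S B part g f a y) :
    ∃ (z : E → Cx.Z) (D : F → Cx.Z), (∀ e, e ∉ B → z e = C.bd D e) ∧
      (∀ X, C.pr z X = X (T.hit S x) + X (T.hit S y)) ∧
      (∀ e, ¬ C.On e f → z e = T.P S x e + T.P S y e) ∧
      ∀ g' o o', o ∈ C.Comp B' g' → o' ∈ C.Comp B' g' → D o = D o' := by
  obtain ⟨i, rfl⟩ := hx.1
  obtain ⟨j, rfl⟩ := hy.1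
  rcases le_total i j with hij | hij
  · obtain ⟨D, h1, h2, h3⟩ := h.chain hij hx hy
    refine ⟨_, D, h1, h2, fun e he => ?_, h3⟩
    simp only [Pi.add_apply, C.Sg_off f i j he, add_zero]
  · obtain ⟨D, h1, h2, h3⟩ := h.chain hij hy hx
    refine ⟨_, D, h1, fun X => by rw [h2, add_comm], fun e he => ?_, h3⟩
    simp only [Pi.add_apply, C.Sg_off f j i he, add_zero]; rw [add_comm]

theorem f_alone {o} (ho : o ∈ C.Comp B' f) : o = f := by
  refine C.Comp_ind (B := B') (f := f) (p := fun o => o = f) rfl ?_ o ho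
  rintro e o1 o2 he h1 h2 rfl
  exact absurd ((h.hB' e).2 (Or.inr (Or.inl h1))) he

theorem f_not {f1} (hne : f1 ≠ f) : f ∉ C.Comp B' f1 := by
  intro hf
  have := C.Comp_self B' f1
  rw [← C.Comp_eq hf] at this
  exact hne (h.f_alone this)

/-- `k` is a non-wall position of `f` facing the component of `f1` -/
def Ok (C : Cx V E F) (B B' : Set E) (f f1 : F) (k : ℕ) : Prop :=
  k < C.len f ∧ C.edge f k ∉ B ∧ ∃ o ∈ C.Comp B' f1, C.On (C.edge f k) o

theorem RL_lt {f1} (hne : f1 ≠ f) {k l} (hk : Ok C B B' f f1 k) (hl : Ok C B B' f f1 l) (hkl : k < l) :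
    ¬ (An C T S B part g f a (C.vtx f (k+1)) ∧ An C T S B part g f a (C.vtx f (l+1))) ∧
    ¬ (An C T S B part g f a (C.vtx f k) ∧ An C T S B part g f a (C.vtx f l)) := by
  obtain ⟨k1, k2, ok, k3, k4⟩ := hk
  obtain ⟨l1, l2, ol, l3, l4⟩ := hl
  have nk : f ≠ ok := fun e => h.f_not hne (e ▸ k3)
  have nl : f ≠ ol := fun e => h.f_not hne (e ▸ l3)
  constructor
  · rintro ⟨hx, hy⟩
    obtain ⟨D, h1, -, h3⟩ := h.chain (show k + 1 ≤ l + 1 by omega) hx hy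
    have e1 := h1 _ k2
    have e2 := h1 _ l2
    simp only [Pi.add_apply, h.P_f hx (C.on_edge f _), h.P_f hy (C.on_edge f _),
      C.Sg_on f (k+1) (l+1) (by omega) k1, C.Sg_on f (k+1) (l+1) (by omega) l1,
      C.bd_eq D nk (C.on_edge f k) k4, C.bd_eq D nl (C.on_edge f l) l4, h3 f1 ok ol k3 l3] at e1 e2
    rw [← e1] at e2
    simp [show k + 1 ≤ l by omega] at e2
  · rintro ⟨hx, hy⟩
    obtain ⟨D, h1, -, h3⟩ := h.chain hkl.le hx hy
    have e1 := h1 _ k2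
    have e2 := h1 _ l2
    simp only [Pi.add_apply, h.P_f hx (C.on_edge f _), h.P_f hy (C.on_edge f _),
      C.Sg_on f k l (by omega) k1, C.Sg_on f k l (by omega) l1,
      C.bd_eq D nk (C.on_edge f k) k4, C.bd_eq D nl (C.on_edge f l) l4, h3 f1 ok ol k3 l3] at e1 e2
    rw [← e1] at e2
    simp [hkl] at e2

theorem R_uniq {f1} (hne : f1 ≠ f) {k l} (hk : Ok C B B' f f1 k) (hl : Ok C B B' f f1 l)
    (hx : An C T S B part g f a (C.vtx f (k+1))) (hy : An C T S B part g f a (C.vtx f (l+1))) : k = l := by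
  rcases lt_trichotomy k l with h1 | h1 | h1
  · exact absurd ⟨hx, hy⟩ (h.RL_lt hne hk hl h1).1
  · exact h1
  · exact absurd ⟨hy, hx⟩ (h.RL_lt hne hl hk h1).1

theorem L_uniq {f1} (hne : f1 ≠ f) {k l} (hk : Ok C B B' f f1 k) (hl : Ok C B B' f f1 l)
    (hx : An C T S B part g f a (C.vtx f k)) (hy : An C T S B part g f a (C.vtx f l)) : k = l := by
  rcases lt_trichotomy k l with h1 | h1 | h1
  · exact absurd ⟨hx, hy⟩ (h.RL_lt hne hk hl h1).2
  · exact h1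
  · exact absurd ⟨hy, hx⟩ (h.RL_lt hne hl hk h1).2

theorem comp_sub {f1} (hf1 : f1 ∈ C.Comp B g) : C.Comp B' f1 ⊆ C.Comp B g := by
  rw [← C.Comp_eq hf1]; exact C.Comp_mono h.BB f1

theorem lab_old {e} (he : e ∈ B) : lab C part' e = lab C part e := by
  obtain ⟨u, v, -, huv⟩ := C.ends_ex e
  rw [lab_eq C huv, lab_eq C huv, h.hp u (h.base.walls e he u (by simp [huv])),
    h.hp v (h.base.walls e he v (by simp [huv]))]

theorem old_gate {f1} (hf1 : f1 ∈ C.Comp B g) {p} (hp : p ∈ Gam C B' part' f1) (hB : p.1 ∈ B) :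
    p ∈ Gam C B part g := by
  rw [mem_Gam] at hp ⊢
  exact ⟨hB, h.comp_sub hf1 hp.2.1, hp.2.2.1, by rw [← h.lab_old hB]; exact hp.2.2.2⟩

/-- at most one old gate -/
theorem L1 {f1} (hf1 : f1 ∈ C.Comp B g) (hne : f1 ≠ f) {p p'} (hp : p ∈ Gam C B' part' f1) (hB : p.1 ∈ B)
    (hp' : p' ∈ Gam C B' part' f1) (hB' : p'.1 ∈ B) : p = p' := by
  by_contra hpp
  have q := h.old_gate hf1 hp hB
  have q' := h.old_gate hf1 hp' hB'
  obtain ⟨i, hi⟩ := cls_pair h.hc (gam2 h.base part) (fun A => gate_even h.base part A g) q q' hpp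
  have hip : i ∈ lab C part p.1 := by
    have : p ∈ (Gam C B part g).filter (fun x => i ∈ lab C part x.1) := by rw [hi]; simp
    exact (mem_filter.1 this).2
  obtain ⟨j, hj, hji⟩ := Finset.exists_mem_ne (by rw [gam2 h.base part p q]; omega) i
  have hiL := lab_sub h.base part q hip
  have hjL := lab_sub h.base part q hj
  have hx : An C T S B part g f a (a i) := ⟨(h.ha i hiL).1, Or.inr ⟨i, hiL, rfl⟩⟩
  have hy : An C T S B part g f a (a j) := ⟨(h.ha j hjL).1, Or.inr ⟨j, hjL, rfl⟩⟩
  obtain ⟨z, D, h1, h2, h3, h4⟩ := h.chain2 hx hy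
  have hoff : ∀ e, z e ≠ 0 → ¬ C.On e f → e ∉ B ∧ ∃ o ∈ C.Comp B g, C.On e o := by
    intro e hz hon
    rw [h3 e hon] at hz
    obtain ⟨o, ho⟩ := C.exists_face e
    by_cases h5 : T.P S (a i) e = 0
    · have h6 : T.P S (a j) e ≠ 0 := by intro h6; rw [h5, h6] at hz; simp at hz
      obtain ⟨a1, a2⟩ := P_in h.base h.hf hy.1 h6
      exact ⟨a1, o, a2 o ho, ho⟩
    · obtain ⟨a1, a2⟩ := P_in h.base h.hf hx.1 h5
      exact ⟨a1, o, a2 o ho, ho⟩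
  have := key h.base part (A := i) (g := g) h1 (by
    intro e he hz
    by_cases hon : C.On e f
    · exact ⟨f, h.hf, hon⟩
    · exact (hoff e hz hon).2) (by
    intro e he hz
    by_cases hon : C.On e f
    · rw [cut_chi h.base part he, if_neg]
      rintro ⟨a1, a2⟩
      have : (e, f) ∈ (Gam C B part g).filter (fun x => i ∈ lab C part x.1) :=
        mem_filter.2 ⟨(mem_Gam C).2 ⟨he, h.hf, hon, a2⟩, a1⟩
      rw [hi] at this
      simp only [mem_insert, mem_singleton] at this
      rcases this with rfl | rfl
      · exact h.f_not hne ((mem_Gam C).1 hp).2.1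
      · exact h.f_not hne ((mem_Gam C).1 hp').2.1
    · exact absurd he (hoff e hz hon).1)
  have hsum : ∑ p ∈ (Gam C B part g).filter (fun x => i ∈ lab C part x.1), D p.2 = D p.2 + D p'.2 := by
    rw [hi]; convert Finset.sum_pair hpp
  rw [h2, hsum, h4 f1 p.2 p'.2 ((mem_Gam C).1 hp).2.1 ((mem_Gam C).1 hp').2.1, Cx.Zadd] at this
  unfold chi at this
  rw [(h.ha i hiL).2, (h.ha j hjL).2] at this
  simp [T.hit_S h.hr, hji] at this

/-- both sides of a path edge cannot be in the same component if there is another anchor -/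
theorem PP {f1 x y w o o'} (hx : An C T S B part g f a x) (hy : An C T S B part g f a y) (hxy : x ≠ y)
    (hw : w ∈ T.pathV S x) (ho : o ∈ C.Comp B' f1) (ho' : o' ∈ C.Comp B' f1) (hoo : o ≠ o')
    (hon : C.On (T.pe w) o) (hon' : C.On (T.pe w) o') : False := by
  obtain ⟨z, D, h1, -, h3, h4⟩ := h.chain2 hx hy
  obtain ⟨hxS, j, hj, hxj⟩ := h.An_path hx hw
  have hwS := (T.path_prop h.hr w hw).1
  have e1 := h1 _ (h.base.pe_nw hwS)
  have hyw : T.P S y (T.pe w) = 0 := by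
    by_contra h0
    obtain ⟨-, -, -, w', hw', he⟩ := h.A3 hy h0
    obtain ⟨hyS, j', hj', hyj⟩ := h.An_path hy hw'
    have := T.pe_inj (T.ne_r h.hr (T.path_prop h.hr w' hw').1) (T.ne_r h.hr hwS) he
    subst this
    have e2 := (T.path_prop h.hr w' hw).2.2.1
    rw [(T.path_prop h.hr w' hw').2.2.1] at e2
    have e3 := (h.ha j hj).2
    rw [← hxj, ← e2, hyj, (h.ha j' hj').2] at e3
    subst e3
    exact hxy (hxj.trans hyj.symm)
  rw [h3 _ (h.A2 hx hw), T.P_on h.hr hw, hyw, C.bd_eq D hoo hon hon', h4 f1 o o' ho ho', Cx.Zadd] at e1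
  simp at e1

/-- parity at a path end -/
theorem PL {f1 x w o} (hne : f1 ≠ f) (hx : An C T S B part g f a x) (hw : w ∈ T.pathV S x) (hlast : T.par w ∈ S)
    (ho : o ∈ C.Comp B' f1) (hon : C.On (T.pe w) o)
    (hother : ∀ o', o' ∈ C.Comp B' f1 → C.On (T.pe w) o' → o' = o) :
    ∃ k, Ok C B B' f f1 k ∧ (C.vtx f (k+1) = x ∨ C.vtx f k = x) := by
  by_contra hcon
  push Not at hcon
  obtain ⟨hxS, j, hj, hxj⟩ := h.An_path hx hw
  have hwS := (T.path_prop h.hr w hw).1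
  set D : F → Cx.Z := fun o => if o ∈ C.Comp B' f1 then 1 else 0 with hD
  set X : V → Cx.Z := fun v => if v ∈ T.pathV S x then 1 else 0 with hX
  have h0 := C.pr_bd D X
  have hXS : ∀ v ∈ S, X v = 0 := fun v hv => if_neg fun h1 => (T.path_prop h.hr v h1).1 hv
  unfold Cx.pr at h0
  rw [Finset.sum_eq_single (T.pe w)] at h0
  · obtain ⟨o2, hne2, hon2, -⟩ := C.other hon
    rw [C.bd_eq D hne2.symm hon hon2, C.cut_eq (T.pe_ends w (T.ne_r h.hr hwS)), hXS _ hlast] at h0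
    have h2 : o2 ∉ C.Comp B' f1 := fun h2 => hne2 (hother o2 h2 hon2)
    simp [hD, hX, ho, h2, hw] at h0
  · intro e _ hew
    by_cases he : e ∈ B'
    · rcases (h.hB' e).1 he with heB | hef | ⟨j', hj', w', hw', rfl⟩
      · rw [C.cut_zero fun v hv => hXS v (h.base.walls e heB v hv), mul_zero]
      · obtain ⟨k, hk, rfl⟩ := hef.lt
        by_cases hc : C.cut X (C.edge f k) = 0
        · rw [hc, mul_zero]
        · have hor : C.vtx f (k+1) = x ∨ C.vtx f k = x := by
            by_contra hno
            push Not at hno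
            apply hc
            rw [C.cut_eq (C.compat f k)]
            have a1 : X (C.vtx f k) = 0 := if_neg fun h1 => hno.2 (h.A1 hx h1 (C.von_vtx f k))
            have a2 : X (C.vtx f (k+1)) = 0 := if_neg fun h1 => hno.1 (h.A1 hx h1 (C.von_vtx f (k+1)))
            rw [a1, a2, add_zero]
          have hkB : C.edge f k ∉ B := by
            intro hkB
            have := h.base.walls _ hkB x (by rw [C.compat]; rcases hor with h1 | h1 <;> simp [← h1])
            exact hxS this
          have hno : ∀ o', C.On (C.edge f k) o' → o' ∉ C.Comp B' f1 := by
            intro o' h1 h2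
            have := hcon k ⟨hk, hkB, o', h2, h1⟩
            rcases hor with h3 | h3
            · exact this.1 h3
            · exact this.2 h3
          obtain ⟨c, c', hcc, h1, h2, -⟩ := C.two' (C.edge f k)
          rw [C.bd_eq D hcc h1 h2]
          simp [hD, hno c h1, hno c' h2]
      · have hw'S := (T.path_prop h.hr w' hw').1
        rw [C.cut_eq (T.pe_ends w' (T.ne_r h.hr hw'S))]
        by_cases hjj : a j' = x
        · rw [hjj] at hw'
          rcases (T.path_prop h.hr w' hw').2.2.2.2 with h1 | h1
          · exact absurd (by rw [T.last_unique h.hr hw hw' hlast h1]) hew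
          · simp [hX, hw', h1, Cx.Zadd]
        · have hno : ∀ v ∈ T.pathV S (a j'), v ∉ T.pathV S x := by
            intro v hv hv'
            have e2 := (T.path_prop h.hr v hv).2.2.1
            rw [(T.path_prop h.hr v hv').2.2.1] at e2
            have e3 := (h.ha j hj).2
            rw [← hxj, e2, (h.ha j' hj').2] at e3
            subst e3; exact hjj hxj.symm
          have a1 : X w' = 0 := if_neg (hno w' hw')
          have a2 : X (T.par w') = 0 := by
            rcases (T.path_prop h.hr w' hw').2.2.2.2 with h1 | h1
            · exact hXS _ h1
            · exact if_neg (hno _ h1)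
          rw [a1, a2, add_zero, mul_zero]
    · obtain ⟨c, c', hcc, h1, h2, -⟩ := C.two' e
      rw [C.bd_eq D hcc h1 h2]
      have : c ∈ C.Comp B' f1 ↔ c' ∈ C.Comp B' f1 :=
        ⟨fun h3 => C.Comp_step h3 he h1 h2, fun h3 => C.Comp_step h3 he h2 h1⟩
      simp only [hD, this, Cx.Zadd, zero_mul]
  · simp

/-- description of new gates -/
theorem new_gate {f1} (hne : f1 ≠ f) {p} (hp : p ∈ Gam C B' part' f1) (hB : p.1 ∉ B) :
    (∃ k, Ok C B B' f f1 k ∧ p.1 = C.edge f k ∧ (C.vtx f (k+1) ∈ S ∨ C.vtx f k ∈ S)) ∨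
    (∃ x, An C T S B part g f a x ∧ x ∉ S ∧ ∃ w ∈ T.pathV S x, T.par w ∈ S ∧ T.pe w = p.1) := by
  obtain ⟨p1, p2, p3, p4⟩ := (mem_Gam C).1 hp
  rcases (h.hB' _).1 p1 with h1 | h1 | ⟨j, hj, w, hw, h1⟩
  · exact absurd h1 hB
  · left
    obtain ⟨k, hk, he⟩ := h1.lt
    refine ⟨k, ⟨hk, by rwa [he], p.2, p2, by rwa [he]⟩, he.symm, ?_⟩
    by_contra hno
    push Not at hno
    rw [← he, lab_eq C (C.compat f k), h.hp' _ hno.1, h.hp' _ hno.2] at p4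
    simp at p4
  · right
    have hx : An C T S B part g f a (a j) := ⟨(h.ha j hj).1, Or.inr ⟨j, hj, rfl⟩⟩
    refine ⟨a j, hx, (h.An_path hx hw).1, w, hw, ?_, h1⟩
    have hwS := (T.path_prop h.hr w hw).1
    by_contra hno
    rw [← h1, lab_eq C (T.pe_ends w (T.ne_r h.hr hwS)), h.hp' _ hno, h.hp' _ hwS] at p4
    simp at p4

theorem same_face {f1} (hne : f1 ≠ f) {p p'} (hp : p ∈ Gam C B' part' f1) (hp' : p' ∈ Gam C B' part' f1)
    (he : p.1 = p'.1) (hf : C.On p.1 f) : p = p' := by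
  obtain ⟨p1, p2, p3, p4⟩ := (mem_Gam C).1 hp
  obtain ⟨q1, q2, q3, q4⟩ := (mem_Gam C).1 hp'
  obtain ⟨o, -, -, ho⟩ := C.other hf
  refine Prod.ext he ?_
  rw [(ho p.2 p3).resolve_left (fun e => h.f_not hne (e ▸ p2)),
    (ho p'.2 (he ▸ q3)).resolve_left (fun e => h.f_not hne (e ▸ q2))]

theorem new_card {f1} (hne : f1 ≠ f) : ((Gam C B' part' f1).filter (fun p => p.1 ∉ B)).card ≤ 2 := by
  by_cases hcase : ∃ x, An C T S B part g f a x ∧ x ∉ S ∧ ∀ y, An C T S B part g f a y → y = x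
  · obtain ⟨x, hx, hxS, hu⟩ := hcase
    by_cases hex : ∃ w ∈ T.pathV S x, T.par w ∈ S
    · obtain ⟨w, hw, hwp⟩ := hex
      obtain ⟨o, o', -, -, -, hoo⟩ := C.two' (T.pe w)
      refine (Finset.card_le_card (t := {(T.pe w, o), (T.pe w, o')}) ?_).trans Finset.card_le_two
      intro p hp
      rw [mem_filter] at hp
      rcases h.new_gate hne hp.1 hp.2 with ⟨k, -, -, h1⟩ | ⟨y, hy, hyS, w', hw', hwp', he⟩
      · exfalso
        rcases h1 with h1 | h1
        · exact hxS (hu _ ⟨C.von_vtx f _, Or.inl h1⟩ ▸ h1)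
        · exact hxS (hu _ ⟨C.von_vtx f _, Or.inl h1⟩ ▸ h1)
      · have := hu y hy; subst this
        have := T.last_unique h.hr hw hw' hwp hwp'; subst this
        have hp3 := ((mem_Gam C).1 hp.1).2.2.1
        rw [← he] at hp3
        simp only [mem_insert, mem_singleton, Prod.ext_iff]
        rcases hoo _ hp3 with h5 | h5
        · exact Or.inl ⟨he.symm, h5⟩
        · exact Or.inr ⟨he.symm, h5⟩
    · rw [Finset.card_eq_zero.2]; · omega
      rw [Finset.filter_eq_empty_iff]
      intro p hp hB
      rcases h.new_gate hne hp hB with ⟨k, -, -, h1⟩ | ⟨y, hy, hyS, w', hw', hwp', he⟩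
      · rcases h1 with h1 | h1
        · exact hxS (hu _ ⟨C.von_vtx f _, Or.inl h1⟩ ▸ h1)
        · exact hxS (hu _ ⟨C.von_vtx f _, Or.inl h1⟩ ▸ h1)
      · have := hu y hy; subst this
        exact hex ⟨w', hw', hwp'⟩
  · push Not at hcase
    -- the assignments
    set asg : (ℕ → V) → (E × F) → Prop := fun v p => ∃ k, Ok C B B' f f1 k ∧ An C T S B part g f a (v k) ∧
      ((p.1 = C.edge f k ∧ v k ∈ S) ∨ (v k ∉ S ∧ ∃ w ∈ T.pathV S (v k), T.par w ∈ S ∧ T.pe w = p.1)) with hasg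
    have huniq : ∀ v : ℕ → V, (∀ k l, Ok C B B' f f1 k → Ok C B B' f f1 l → An C T S B part g f a (v k) →
        An C T S B part g f a (v l) → k = l) → 
        (((Gam C B' part' f1).filter (fun p => p.1 ∉ B)).filter (asg v)).card ≤ 1 := by
      intro v hv
      rw [Finset.card_le_one]
      intro p hp p' hp'
      simp only [mem_filter] at hp hp'
      obtain ⟨⟨hpG, hpB⟩, k, hk, hak, hkk⟩ := hp
      obtain ⟨⟨hpG', hpB'⟩, l, hl, hal, hll⟩ := hp'
      have := hv k l hk hl hak hal
      subst this
      rcases hkk with ⟨e1, s1⟩ | ⟨s1, w, hw, hwp, e1⟩ <;> rcases hll with ⟨e2, s2⟩ | ⟨s2, w', hw', hwp', e2⟩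
      · exact h.same_face hne hpG hpG' (e1.trans e2.symm) (e1 ▸ C.on_edge f k)
      · exact absurd s1 s2
      · exact absurd s2 s1
      · have := T.last_unique h.hr hw hw' hwp hwp'; subst this
        obtain ⟨y, hy, hyx⟩ := hcase _ hak s1
        have g1 := (mem_Gam C).1 hpG
        have g2 := (mem_Gam C).1 hpG'
        refine Prod.ext (e1.symm.trans e2) ?_
        by_contra hoo
        exact h.PP hak hy (Ne.symm hyx) hw g1.2.1 g2.2.1 hoo (e1 ▸ g1.2.2.1) (e2 ▸ g2.2.2.1)
    have hR := huniq (fun k => C.vtx f (k+1)) (fun k l hk hl hx hy => h.R_uniq hne hk hl hx hy)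
    have hL := huniq (fun k => C.vtx f k) (fun k l hk hl hx hy => h.L_uniq hne hk hl hx hy)
    have hsub : (Gam C B' part' f1).filter (fun p => p.1 ∉ B) ⊆
        ((Gam C B' part' f1).filter (fun p => p.1 ∉ B)).filter (asg (fun k => C.vtx f (k+1))) ∪
        ((Gam C B' part' f1).filter (fun p => p.1 ∉ B)).filter (asg (fun k => C.vtx f k)) := by
      intro p hp
      have hp' := mem_filter.1 hp
      rw [mem_union]
      rcases h.new_gate hne hp'.1 hp'.2 with ⟨k, hk, he, h1 | h1⟩ | ⟨x, hx, hxS, w, hw, hwp, he⟩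
      · exact Or.inl (mem_filter.2 ⟨hp, k, hk, ⟨C.von_vtx f _, Or.inl h1⟩, Or.inl ⟨he, h1⟩⟩)
      · exact Or.inr (mem_filter.2 ⟨hp, k, hk, ⟨C.von_vtx f _, Or.inl h1⟩, Or.inl ⟨he, h1⟩⟩)
      · have g1 := (mem_Gam C).1 hp'.1
        obtain ⟨y, hy, hyx⟩ := hcase x hx hxS
        obtain ⟨k, hk, h5⟩ := h.PL hne hx hw hwp g1.2.1 (by rw [he]; exact g1.2.2.1) (by
          intro o' ho' hon'
          by_contra hoo
          exact h.PP hx hy (Ne.symm hyx) hw ho' g1.2.1 hoo hon' (by rw [he]; exact g1.2.2.1))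
        rcases h5 with h5 | h5
        · subst h5; exact Or.inl (mem_filter.2 ⟨hp, k, hk, hx, Or.inr ⟨hxS, w, hw, hwp, he⟩⟩)
        · subst h5; exact Or.inr (mem_filter.2 ⟨hp, k, hk, hx, Or.inr ⟨hxS, w, hw, hwp, he⟩⟩)
    have := (Finset.card_le_card hsub).trans (Finset.card_union_le _ _)
    omega

theorem gam_split (f1) : (Gam C B' part' f1).card = ((Gam C B' part' f1).filter (fun p => p.1 ∈ B)).card +
    ((Gam C B' part' f1).filter (fun p => p.1 ∉ B)).card :=
  (Finset.card_filter_add_card_filter_not _).symm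

theorem old_card {f1} (hf1 : f1 ∈ C.Comp B g) (hne : f1 ≠ f) :
    ((Gam C B' part' f1).filter (fun p => p.1 ∈ B)).card ≤ 1 := by
  rw [Finset.card_le_one]
  intro p hp p' hp'
  rw [mem_filter] at hp hp'
  exact h.L1 hf1 hne hp.1 hp.2 hp'.1 hp'.2

theorem gam_le {f1} (hf1 : f1 ∈ C.Comp B g) (hne : f1 ≠ f) : (Gam C B' part' f1).card ≤ 3 := by
  have := h.gam_split f1; have := h.old_card hf1 hne; have := h.new_card hne; omega

theorem gam_three {f1} (hf1 : f1 ∈ C.Comp B g) (hne : f1 ≠ f) (h3 : (Gam C B' part' f1).card = 3) :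
    n ∈ Lb C S' B' part' f1 ∧ ∃ p ∈ Gam C B' part' f1, p.1 ∈ B := by
  have e1 := h.gam_split f1
  have e2 := h.old_card hf1 hne
  have e3 := h.new_card hne
  constructor
  · obtain ⟨p, hp, p', hp', hpp⟩ := Finset.one_lt_card.1
      (show 1 < ((Gam C B' part' f1).filter (fun p => p.1 ∉ B)).card by omega)
    rw [mem_filter] at hp hp'
    by_contra hn
    have hall : ∀ p ∈ Gam C B' part' f1, p.1 ∉ B → ∃ k, Ok C B B' f f1 k ∧ p.1 = C.edge f k ∧ C.vtx f (k+1) ∈ S := by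
      intro p hp hB
      have g1 := (mem_Gam C).1 hp
      rcases h.new_gate hne hp hB with ⟨k, hk, he, -⟩ | ⟨x, hx, hxS, w, hw, hwp, he⟩
      · refine ⟨k, hk, he, ?_⟩
        by_contra hS
        refine hn ((mem_Lb C).2 ⟨C.vtx f (k+1), (h.hS' _).2 (Or.inr (Or.inl (C.von_vtx f _))), ⟨p.2, g1.2.1, ?_⟩, h.hp' _ hS⟩)
        exact C.VOn_of_mem g1.2.2.1 (by rw [he, C.compat]; simp)
      · exfalso
        obtain ⟨-, j, hj, hxj⟩ := h.An_path hx hw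
        have hwS := (T.path_prop h.hr w hw).1
        refine hn ((mem_Lb C).2 ⟨w, (h.hS' _).2 (Or.inr (Or.inr ⟨j, hj, hxj ▸ hw⟩)), ⟨p.2, g1.2.1, ?_⟩, h.hp' _ hwS⟩)
        exact C.VOn_of_mem g1.2.2.1 (by rw [← he, T.pe_ends w (T.ne_r h.hr hwS)]; simp)
    obtain ⟨k, hk, he, hS⟩ := hall p hp.1 hp.2
    obtain ⟨l, hl, he', hS'⟩ := hall p' hp'.1 hp'.2
    have := h.R_uniq hne hk hl ⟨C.von_vtx f _, Or.inl hS⟩ ⟨C.von_vtx f _, Or.inl hS'⟩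
    subst this
    exact hpp (h.same_face hne hp.1 hp'.1 (he.trans he'.symm) (he ▸ C.on_edge f k))
  · obtain ⟨p, hp⟩ : ((Gam C B' part' f1).filter (fun p => p.1 ∈ B)).Nonempty := by
      rw [← Finset.card_pos]; omega
    rw [mem_filter] at hp
    exact ⟨p, hp.1, hp.2⟩

end SD
end
end FPS


set_option linter.unusedSectionVars false
set_option linter.unusedVariables false
namespace FPS
noncomputable section
open Finset Relation
open scoped Classical
variable {V E F : Type} [Fintype V] [Fintype E] [Fintype F]

/-- the component of `g` still has a non-wall edge -/
def Pend (C : Cx V E F) (B : Set E) (g : F) : Prop := ∃ e, e ∉ B ∧ ∃ o ∈ C.Comp B g, C.On e o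

namespace SD
variable {C : Cx V E F} {T : BFS C} {S S' : Set V} {B B' : Set E} {part part' : V → ℕ} {n : ℕ}
  {g f : F} {a : ℕ → V} (h : SD T S S' B B' part part' n g f a)

include h

theorem base' : Base T S' B' := by
  refine ⟨h.SS h.hr, ?_, ?_⟩
  · intro e he v hv
    rw [h.hS']
    rcases (h.hB' e).1 he with h1 | h1 | ⟨j, hj, w, hw, rfl⟩
    · exact Or.inl (h.base.walls e h1 v hv)
    · exact Or.inr (Or.inl (C.VOn_of_mem h1 hv))
    · have hp := T.path_prop h.hr w hw
      rw [T.pe_ends w (T.ne_r h.hr hp.1), Sym2.mem_iff] at hv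
      rcases hv with rfl | rfl
      · exact Or.inr (Or.inr ⟨j, hj, hw⟩)
      · rcases hp.2.2.2.2 with h2 | h2
        · exact Or.inl h2
        · exact Or.inr (Or.inr ⟨j, hj, h2⟩)
  · refine h.base.hyp.ext h.BB ?_
    intro y hy hyS
    have hP : ∀ j ∈ Lb C S B part g, ∀ y, T.pathV S y ⊆ T.pathV S (a j) → ∀ e, e ∉ B' → T.P S y e = 0 := by
      intro j hj y hsub e he
      refine T.P_off h.hr fun w hw hwe => he ((h.hB' e).2 (Or.inr (Or.inr ⟨j, hj, w, hsub hw, hwe⟩)))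
    rcases (h.hS' y).1 hy with h1 | h1 | ⟨j, hj, hw⟩
    · exact absurd h1 hyS
    · have hj := col_Lb h.base part h.hf h1
      set j := part (T.hit S y)
      obtain ⟨k, rfl⟩ := h1
      obtain ⟨i, hi⟩ := (h.ha j hj).1
      have hSg : ∀ k l e, e ∉ B' → C.Sg f k l e = 0 := fun k l e he =>
        C.Sg_off f k l (fun ho => he ((h.hB' e).2 (Or.inr (Or.inl ho))))
      rcases le_total i k with hik | hik
      · refine ⟨C.Sg f i k + T.P S (a j), fun e he => ?_, fun X hX => ?_⟩
        · simp [hSg _ _ e he, hP j hj (a j) (Finset.Subset.refl _) e he]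
        · rw [C.pr_add, C.pr_Sg f hik, T.pr_P h.hr, hi, hX _ (T.hit_S h.hr _)]
          have h1 := Cx.Zadd (X (a j))
          linear_combination h1
      · refine ⟨C.Sg f k i + T.P S (a j), fun e he => ?_, fun X hX => ?_⟩
        · simp [hSg _ _ e he, hP j hj (a j) (Finset.Subset.refl _) e he]
        · rw [C.pr_add, C.pr_Sg f hik, T.pr_P h.hr, hi, hX _ (T.hit_S h.hr _)]
          have h1 := Cx.Zadd (X (a j))
          linear_combination h1
    · refine ⟨T.P S y, hP j hj y (T.path_prop h.hr y hw).2.2.2.1, fun X hX => ?_⟩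
      rw [T.pr_P h.hr, hX _ (T.hit_S h.hr _), add_zero]

theorem newedge {e o} (he : e ∈ B') (he' : e ∉ B) (ho : C.On e o) : o ∈ C.Comp B g := by
  rcases (h.hB' e).1 he with h1 | h1 | ⟨j, hj, w, hw, rfl⟩
  · exact absurd h1 he'
  · exact C.Comp_step h.hf he' h1 ho
  · exact ((h.base.path (h.ha j hj).1 h.hf).1 w hw).2 o ho

theorem newvtx {v o} (hv : v ∈ S') (hv' : v ∉ S) (ho : C.VOn v o) : o ∈ C.Comp B g := by
  rcases (h.hS' v).1 hv with h1 | h1 | ⟨j, hj, hw⟩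
  · exact absurd h1 hv'
  · exact h.base.star hv' h1 ho h.hf
  · exact ((h.base.path (h.ha j hj).1 h.hf).1 v hw).1 o ho

theorem out_mem {f1} (hf1 : f1 ∉ C.Comp B g) {o} (ho : o ∈ C.Comp B f1) : o ∉ C.Comp B g := by
  intro h1
  apply hf1
  rw [← C.Comp_eq h1, C.Comp_eq ho]
  exact C.Comp_self _ _

theorem out_comp {f1} (hf1 : f1 ∉ C.Comp B g) : C.Comp B' f1 = C.Comp B f1 := by
  refine Set.Subset.antisymm (C.Comp_mono h.BB f1) ?_
  intro o ho
  refine (C.Comp_ind (B := B) (f := f1) (p := fun o => o ∈ C.Comp B' f1 ∧ o ∈ C.Comp B f1)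
    ⟨C.Comp_self _ _, C.Comp_self _ _⟩ ?_ o ho).1
  rintro e o1 o2 he h1 h2 ⟨h3, h4⟩
  refine ⟨C.Comp_step h3 (fun he' => h.out_mem hf1 h4 (h.newedge he' he h1)) h1 h2, C.Comp_step h4 he h1 h2⟩

theorem out_gam {f1} (hf1 : f1 ∉ C.Comp B g) : Gam C B' part' f1 = Gam C B part f1 := by
  ext p
  rw [mem_Gam, mem_Gam, h.out_comp hf1]
  constructor
  · rintro ⟨h1, h2, h3, h4⟩
    have hB : p.1 ∈ B := by
      by_contra hB
      exact h.out_mem hf1 h2 (h.newedge h1 hB h3)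
    exact ⟨hB, h2, h3, by rwa [← h.lab_old hB]⟩
  · rintro ⟨h1, h2, h3, h4⟩
    exact ⟨h.BB h1, h2, h3, by rwa [h.lab_old h1]⟩

theorem out_Lb {f1} (hf1 : f1 ∉ C.Comp B g) : Lb C S' B' part' f1 = Lb C S B part f1 := by
  ext A
  rw [mem_Lb, mem_Lb, h.out_comp hf1]
  constructor
  · rintro ⟨v, h1, ⟨o, h2, h3⟩, h4⟩
    have hS : v ∈ S := by
      by_contra hS
      exact h.out_mem hf1 h2 (h.newvtx h1 hS h3)
    exact ⟨v, hS, ⟨o, h2, h3⟩, by rwa [← h.hp v hS]⟩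
  · rintro ⟨v, h1, ⟨o, h2, h3⟩, h4⟩
    exact ⟨v, h.SS h1, ⟨o, h2, h3⟩, by rwa [h.hp v h1]⟩

theorem out_pend {f1} (hf1 : f1 ∉ C.Comp B g) (hp : Pend C B' f1) : Pend C B f1 := by
  obtain ⟨e, he, o, ho, hon⟩ := hp
  exact ⟨e, fun h1 => he (h.BB h1), o, by rwa [← h.out_comp hf1], hon⟩

theorem in_pend {f1} (hp : Pend C B' f1) : f1 ≠ f := by
  rintro rfl
  obtain ⟨e, he, o, ho, hon⟩ := hp
  rw [h.f_alone ho] at hon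
  exact he ((h.hB' e).2 (Or.inr (Or.inl hon)))

theorem in_Lb {f1} (hf1 : f1 ∈ C.Comp B g) : Lb C S' B' part' f1 ⊆ insert n (Lb C S B part g) := by
  intro A hA
  obtain ⟨v, h1, ⟨o, h2, h3⟩, rfl⟩ := (mem_Lb C).1 hA
  rw [mem_insert]
  by_cases hS : v ∈ S
  · right
    rw [h.hp v hS]
    exact (mem_Lb C).2 ⟨v, hS, ⟨o, h.comp_sub hf1 h2, h3⟩, rfl⟩
  · exact Or.inl (h.hp' v hS)

theorem lab_lt {e} (he : e ∈ B) : n ∉ lab C part e := by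
  obtain ⟨u, v, -, huv⟩ := C.ends_ex e
  rw [lab_eq C huv]
  have h1 := h.lt u (h.base.walls e he u (by simp [huv]))
  have h2 := h.lt v (h.base.walls e he v (by simp [huv]))
  simp only [mem_insert, mem_singleton]
  omega

theorem three {f1} (hf1 : f1 ∈ C.Comp B g) (hne : f1 ≠ f) (h3 : (Gam C B' part' f1).card = 3) :
    ∃ p ∈ Gam C B part g, p.2 ∈ C.Comp B' f1 ∧ Lb C S' B' part' f1 = insert n (lab C part p.1) := by
  obtain ⟨hn, p, hp, hB⟩ := h.gam_three hf1 hne h3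
  have q := h.old_gate hf1 hp hB
  refine ⟨p, q, ((mem_Gam C).1 hp).2.1, ?_⟩
  have h4 := Lb_gam3 h.base' part' (h.gam_le hf1 hne) h3
  symm
  apply Finset.eq_of_subset_of_card_le
  · rw [Finset.insert_subset_iff]
    refine ⟨hn, ?_⟩
    rw [← h.lab_old hB]
    exact lab_sub h.base' part' hp
  · rw [h4, Finset.card_insert_of_notMem (h.lab_lt hB), gam2 h.base part p q]

theorem uniq {f1 f2} (hf1 : f1 ∈ C.Comp B g) (hne : f1 ≠ f) (h3 : (Gam C B' part' f1).card = 3)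
    (hf2 : f2 ∈ C.Comp B g) (hne2 : f2 ≠ f) (h32 : (Gam C B' part' f2).card = 3)
    (hL : Lb C S' B' part' f1 = Lb C S' B' part' f2) : f2 ∈ C.Comp B' f1 := by
  obtain ⟨p, hp, hp2, hpL⟩ := h.three hf1 hne h3
  obtain ⟨p', hp', hp2', hpL'⟩ := h.three hf2 hne2 h32
  have hB := ((mem_Gam C).1 hp).1
  have hB' := ((mem_Gam C).1 hp').1
  have hlab : lab C part p.1 = lab C part p'.1 := by
    rw [← Finset.erase_insert (h.lab_lt hB), ← Finset.erase_insert (h.lab_lt hB'), ← hpL, ← hpL', hL]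
  have hpp : p = p' := by
    by_contra hpp
    have hc := h.hc
    have h2 : 2 ≤ (Gam C B part g).card := Finset.one_lt_card.2 ⟨p, hp, p', hp', hpp⟩
    have h3' : (Gam C B part g).card ≠ 3 := fun e => hpp (gam3_inj h.base part hc e p hp p' hp' hlab)
    have hlb := Finset.card_le_card (lab_sub h.base part hp)
    rw [gam2 h.base part p hp] at hlb
    have := Lb_card_le h.base part hc
    obtain ⟨p0, hp0, hf0⟩ := h.h2 (by omega)
    have hn1 : p0 ≠ p := by rintro rfl; rw [hf0] at hp2; exact h.f_not hne hp2
    have hn2 : p0 ≠ p' := by rintro rfl; rw [hf0] at hp2'; exact h.f_not hne2 hp2'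
    have : 2 < (Gam C B part g).card := Finset.two_lt_card.2 ⟨p0, hp0, p, hp, p', hp', hn1, hn2, hpp⟩
    omega
  subst hpp
  have e1 := C.Comp_eq hp2
  have e2 := C.Comp_eq hp2'
  rw [← e1, e2]
  exact C.Comp_self _ _

theorem Lb_pos : 1 ≤ (Lb C S B part g).card :=
  Finset.card_pos.2 ⟨_, col_Lb h.base part h.hf (C.von_vtx f 0)⟩

theorem Lb_le : (Lb C S B part g).card ≤ 3 := by
  have := h.hc
  have := Lb_card_le h.base part this
  omega

theorem size {d q : ℕ} (hq : 0 < q) (hlen : C.len f ≤ d) (m : ℕ) :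
    (univ.filter (fun v => v ∈ S' ∧ v ∉ S ∧ T.depth v / q = m)).card ≤ d + 3 * q - 3 := by
  set L := Lb C S B part g with hL
  have hinj : Set.InjOn a (L : Set ℕ) := by
    intro i hi j hj hij
    rw [← (h.ha i hi).2, ← (h.ha j hj).2, hij]
  have hca : (L.image a).card = L.card := Finset.card_image_of_injOn hinj
  set Fv := (range (C.len f)).image (C.vtx f) with hFv
  have hFc : Fv.card ≤ C.len f := by simpa using Finset.card_image_le (s := range (C.len f)) (f := C.vtx f)
  have haF : L.image a ⊆ Fv := by
    intro v hv
    obtain ⟨j, hj, rfl⟩ := mem_image.1 hv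
    obtain ⟨i, hi, he⟩ := (h.ha j hj).1.lt
    exact mem_image.2 ⟨i, mem_range.2 hi, he⟩
  have hsub : univ.filter (fun v => v ∈ S' ∧ v ∉ S ∧ T.depth v / q = m) ⊆
      (Fv \ L.image a) ∪ L.biUnion (fun j => (T.pathV S (a j)).filter (fun w => T.depth w / q = m)) := by
    intro v hv
    obtain ⟨-, h1, h2, h3⟩ := mem_filter.1 hv
    rw [mem_union, mem_sdiff, mem_biUnion]
    rcases (h.hS' v).1 h1 with h4 | h4 | ⟨j, hj, hw⟩
    · exact absurd h4 h2
    · by_cases hva : v ∈ L.image a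
      · right
        obtain ⟨j, hj, rfl⟩ := mem_image.1 hva
        exact ⟨j, hj, mem_filter.2 ⟨T.self_path h.hr h2, h3⟩⟩
      · left
        obtain ⟨i, hi, he⟩ := h4.lt
        exact ⟨mem_image.2 ⟨i, mem_range.2 hi, he⟩, hva⟩
    · right; exact ⟨j, hj, mem_filter.2 ⟨hw, h3⟩⟩
  have h1 := (Finset.card_le_card hsub).trans (Finset.card_union_le _ _)
  have h2 := Finset.card_sdiff_of_subset haF
  have h3 : (L.biUnion (fun j => (T.pathV S (a j)).filter (fun w => T.depth w / q = m))).card ≤ L.card * q :=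
    Finset.card_biUnion_le_card_mul _ _ _ (fun j _ => T.path_layer h.hr hq (a j) m)
  have h4 := Finset.card_le_card haF
  have h5 := h.Lb_pos
  have h6 := h.Lb_le
  rw [← hL] at h5 h6
  rw [h2, hca] at h1
  rw [hca] at h4
  generalize L.card = l at *
  interval_cases l <;> omega

theorem strict : B ⊂ B' := by
  refine ⟨h.BB, fun hs => ?_⟩
  obtain ⟨e, he, hon⟩ := h.nw
  exact he (hs ((h.hB' e).2 (Or.inr (Or.inl hon))))

omit h

theorem exist {part : V → ℕ} (hb : Base T S B) (hlt : ∀ v ∈ S, part v < n) {g : F} (hc : (Gam C B part g).card ≤ 3)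
    (hp : Pend C B g) : ∃ S' B' part' f a, SD T S S' B B' part part' n g f a := by
  obtain ⟨f, hf, hA, h2⟩ := face_choice hb part hc
  have hmin : ∀ j ∈ Lb C S B part g, ∃ x, (C.VOn x f ∧ part (T.hit S x) = j) ∧ ∀ v, C.VOn v f →
      part (T.hit S v) = j → (T.pathV S x).card ≤ (T.pathV S v).card := by
    intro j hj
    obtain ⟨v, hv⟩ := hA j hj
    obtain ⟨x, hx, hx'⟩ := Finset.exists_min_image (univ.filter fun v => C.VOn v f ∧ part (T.hit S v) = j)
      (fun v => (T.pathV S v).card) ⟨v, mem_filter.2 ⟨mem_univ _, hv⟩⟩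
    exact ⟨x, (mem_filter.1 hx).2, fun v h1 h2 => hx' v (mem_filter.2 ⟨mem_univ _, h1, h2⟩)⟩
  have : Nonempty V := ⟨T.r⟩
  choose! a ha using hmin
  refine ⟨{v | v ∈ S ∨ C.VOn v f ∨ ∃ j ∈ Lb C S B part g, v ∈ T.pathV S (a j)},
    {e | e ∈ B ∨ C.On e f ∨ ∃ j ∈ Lb C S B part g, ∃ w ∈ T.pathV S (a j), T.pe w = e},
    fun v => if v ∈ S then part v else n, f, a, hb, hlt, hc, hf, fun j hj => (ha j hj).1,
    fun j hj => (ha j hj).2, h2, ?_, fun v => Iff.rfl, fun v => Iff.rfl, fun v hv => if_pos hv,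
    fun v hv => if_neg hv⟩
  by_contra hno
  push Not at hno
  obtain ⟨e, he, o, ho, hon⟩ := hp
  rw [← C.Comp_eq hf] at ho
  have : o = f := by
    refine C.Comp_ind (B := B) (f := f) (p := fun o => o = f) rfl ?_ o ho
    rintro e o1 o2 he h1 h2 rfl
    exact absurd h1 (hno e he)
  subst this
  exact hno e he hon

end SD
end
end FPS


set_option linter.unusedSectionVars false
set_option linter.unusedVariables false
namespace FPS
noncomputable section
open Finset Relation
open scoped Classical

inductive Apo : ℕ → Set (Finset ℕ) → Set (Finset ℕ) → Prop
  | base : Apo 3 {{0, 1, 2}} {{0, 1, 2}}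
  | step {n 𝓕 𝓑 t} : Apo n 𝓕 𝓑 → t ∈ 𝓕 →
      Apo (n + 1) (𝓕 \ {t} ∪ {s | ∃ x ∈ t, s = insert n (t.erase x)}) (insert (insert n t) 𝓑)

namespace Apo
variable {n : ℕ} {𝓕 𝓑 : Set (Finset ℕ)}

theorem lt (h : Apo n 𝓕 𝓑) : (∀ t ∈ 𝓕, t.card = 3 ∧ ∀ x ∈ t, x < n) ∧ (∀ b ∈ 𝓑, b.card ≤ 4 ∧ ∀ x ∈ b, x < n) := by
  induction h with
  | base => simp
  | @step n 𝓕 𝓑 t h ht ih =>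
    obtain ⟨ih1, ih2⟩ := ih
    obtain ⟨h3, hl⟩ := ih1 t ht
    have hn : n ∉ t := fun hn => absurd (hl n hn) (lt_irrefl _)
    constructor
    · rintro s (⟨hs, -⟩ | ⟨x, hx, rfl⟩)
      · exact ⟨(ih1 s hs).1, fun x hx => ((ih1 s hs).2 x hx).trans (Nat.lt_succ_self n)⟩
      · constructor
        · rw [card_insert_of_notMem (fun h1 => hn (mem_of_mem_erase h1)), card_erase_of_mem hx, h3]
        · intro y hy
          rcases mem_insert.1 hy with rfl | hy
          · omega
          · have := hl y (mem_of_mem_erase hy); omega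
    · rintro b (rfl | hb)
      · refine ⟨(card_insert_le _ _).trans (by omega), fun y hy => ?_⟩
        rcases mem_insert.1 hy with rfl | hy
        · omega
        · have := hl y hy; omega
      · exact ⟨(ih2 b hb).1, fun x hx => ((ih2 b hb).2 x hx).trans (Nat.lt_succ_self n)⟩

theorem pair (h : Apo n 𝓕 𝓑) : ∀ b ∈ 𝓑, ∀ u ∈ b, ∀ v ∈ b, ∃ t ∈ 𝓕, u ∈ t ∧ v ∈ t := by
  induction h with
  | base => rintro b rfl u hu v hv; exact ⟨_, rfl, hu, hv⟩
  | @step n 𝓕 𝓑 t h ht ih =>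
    obtain ⟨h3, hl⟩ := h.lt.1 t ht
    have key : ∀ u ∈ insert n t, ∀ v ∈ insert n t, ∃ x ∈ t, u ∈ insert n (t.erase x) ∧ v ∈ insert n (t.erase x) := by
      intro u hu v hv
      have : ∃ x ∈ t, x ≠ u ∧ x ≠ v := by
        by_contra hcon
        push Not at hcon
        have : t ⊆ {u, v} := by
          intro x hx
          rw [mem_insert, mem_singleton]
          by_cases h1 : x = u
          · exact Or.inl h1
          · exact Or.inr (hcon x hx h1)
        have := (card_le_card this).trans card_le_two
        omega
      obtain ⟨x, hx, h1, h2⟩ := this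
      refine ⟨x, hx, ?_, ?_⟩
      · rw [mem_insert] at hu ⊢
        exact hu.imp id (fun h => mem_erase.2 ⟨Ne.symm h1, h⟩)
      · rw [mem_insert] at hv ⊢
        exact hv.imp id (fun h => mem_erase.2 ⟨Ne.symm h2, h⟩)
    have key2 : ∀ u ∈ insert n t, ∀ v ∈ insert n t,
        ∃ s ∈ 𝓕 \ {t} ∪ {s | ∃ x ∈ t, s = insert n (t.erase x)}, u ∈ s ∧ v ∈ s := by
      intro u hu v hv
      obtain ⟨x, hx, h1, h2⟩ := key u hu v hv
      exact ⟨_, Or.inr ⟨x, hx, rfl⟩, h1, h2⟩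
    rintro b (rfl | hb) u hu v hv
    · exact key2 u hu v hv
    · obtain ⟨s, hs, h1, h2⟩ := ih b hb u hu v hv
      by_cases hst : s = t
      · subst hst
        exact key2 u (mem_insert_of_mem h1) v (mem_insert_of_mem h2)
      · exact ⟨s, Or.inl ⟨hs, hst⟩, h1, h2⟩

theorem bag (h : Apo n 𝓕 𝓑) : (∀ t ∈ 𝓕, ∃ b ∈ 𝓑, t ⊆ b) ∧ (∀ u, u < n → ∃ b ∈ 𝓑, u ∈ b) := by
  induction h with
  | base =>
    refine ⟨fun t ht => ⟨t, ht, Finset.Subset.refl _⟩, fun u hu => ⟨_, rfl, ?_⟩⟩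
    simp only [mem_insert, mem_singleton]; omega
  | @step n 𝓕 𝓑 t h ht ih =>
    obtain ⟨ih1, ih2⟩ := ih
    constructor
    · rintro s (⟨hs, -⟩ | ⟨x, hx, rfl⟩)
      · obtain ⟨b, hb, hsb⟩ := ih1 s hs
        exact ⟨b, Or.inr hb, hsb⟩
      · exact ⟨_, Or.inl rfl, insert_subset_insert _ (erase_subset _ _)⟩
    · intro u hu
      by_cases hun : u = n
      · exact ⟨_, Or.inl rfl, by simp [hun]⟩
      · obtain ⟨b, hb, hsb⟩ := ih2 u (by omega)
        exact ⟨b, Or.inr hb, hsb⟩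

theorem three_le (h : Apo n 𝓕 𝓑) : 3 ≤ n := by
  induction h with
  | base => rfl
  | step h ht ih => omega

/-- The graph. -/
def gr (n : ℕ) (𝓑 : Set (Finset ℕ)) : SimpleGraph (Fin n) where
  Adj u v := u ≠ v ∧ ∃ b ∈ 𝓑, (u : ℕ) ∈ b ∧ (v : ℕ) ∈ b
  symm := by
    constructor
    rintro u v ⟨h, b, hb, h1, h2⟩
    exact ⟨h.symm, b, hb, h2, h1⟩
  loopless := by constructor; rintro u ⟨h, -⟩; exact h rfl

end Apo

variable {V E F : Type} [Fintype V] [Fintype E] [Fintype F]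

structure St {C : Cx V E F} (T : BFS C) (q l : ℕ) (S : Set V) (B : Set E) (part : V → ℕ) (n : ℕ)
    (𝓕 𝓑 : Set (Finset ℕ)) : Prop where
  base : Base T S B
  lt : ∀ v ∈ S, part v < n
  apo : Apo n 𝓕 𝓑
  g3 : ∀ g, Pend C B g → (Gam C B part g).card ≤ 3
  adj : ∀ g, ∀ x ∈ Lb C S B part g, ∀ y ∈ Lb C S B part g, ∃ b ∈ 𝓑, x ∈ b ∧ y ∈ b
  mem : ∀ g, Pend C B g → (Gam C B part g).card = 3 → Lb C S B part g ∈ 𝓕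
  uq : ∀ f1 f2, Pend C B f1 → Pend C B f2 → (Gam C B part f1).card = 3 → (Gam C B part f2).card = 3 →
    Lb C S B part f1 = Lb C S B part f2 → f2 ∈ C.Comp B f1
  size : ∀ x m, (univ.filter (fun v => v ∈ S ∧ part v = x ∧ T.depth v / q = m)).card ≤ l

theorem St.step1 {C : Cx V E F} {T : BFS C} {q l d n : ℕ} {S B part} {𝓕 𝓑 : Set (Finset ℕ)} (hq : 0 < q)
    (hlen : ∀ f, C.len f ≤ d) (hl : d + 3 * q - 3 ≤ l) (h : St T q l S B part n 𝓕 𝓑) {g : F} (hg : Pend C B g)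
    {t} (ht : t ∈ 𝓕) (hLt : Lb C S B part g ⊆ t)
    (hoth : ∀ f1, f1 ∉ C.Comp B g → Pend C B f1 → (Gam C B part f1).card = 3 → Lb C S B part f1 ≠ t) :
    ∃ S' B' part' n' 𝓕' 𝓑', B ⊂ B' ∧ St T q l S' B' part' n' 𝓕' 𝓑' := by
  obtain ⟨S', B', part', f, a, sd⟩ := SD.exist h.base h.lt (h.g3 g hg) hg
  have hin3 : ∀ f1, f1 ∈ C.Comp B g → Pend C B' f1 → (Gam C B' part' f1).card = 3 →
      ∃ x ∈ t, Lb C S' B' part' f1 = insert n (t.erase x) := by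
    intro f1 hf1 hp h3
    obtain ⟨p, hp, -, hL⟩ := sd.three hf1 (sd.in_pend hp) h3
    have h1 : lab C part p.1 ⊆ t := (lab_sub h.base part hp).trans hLt
    have h2 := gam2 h.base part p hp
    have h3 := (h.apo.lt.1 t ht).1
    have hex : ∃ x ∈ t, x ∉ lab C part p.1 := by
      by_contra hcon
      push Not at hcon
      have := card_le_card (show t ⊆ lab C part p.1 from hcon)
      omega
    obtain ⟨x, hx, hx'⟩ := hex
    refine ⟨x, hx, ?_⟩
    rw [hL]
    congr 1
    apply Finset.eq_of_subset_of_card_le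
    · intro y hy
      exact mem_erase.2 ⟨fun e => hx' (e ▸ hy), h1 hy⟩
    · rw [card_erase_of_mem hx]; omega
  have hout : ∀ f1, f1 ∉ C.Comp B g → Pend C B' f1 → (Gam C B' part' f1).card = 3 → n ∉ Lb C S' B' part' f1 := by
    intro f1 hf1 hp h3 hn
    rw [sd.out_gam hf1] at h3
    rw [sd.out_Lb hf1] at hn
    have := (h.apo.lt.1 _ (h.mem f1 (sd.out_pend hf1 hp) h3)).2 n hn
    omega
  refine ⟨S', B', part', n + 1, _, _, sd.strict, sd.base', ?_, Apo.step h.apo ht, ?_, ?_, ?_, ?_, ?_⟩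
  · intro v hv
    by_cases hS : v ∈ S
    · rw [sd.hp v hS]; have := h.lt v hS; omega
    · rw [sd.hp' v hS]; omega
  · intro f1 hp
    by_cases hf1 : f1 ∈ C.Comp B g
    · exact sd.gam_le hf1 (sd.in_pend hp)
    · rw [sd.out_gam hf1]; exact h.g3 f1 (sd.out_pend hf1 hp)
  · intro f1 x hx y hy
    by_cases hf1 : f1 ∈ C.Comp B g
    · refine ⟨insert n t, Or.inl rfl, ?_, ?_⟩
      · exact insert_subset_insert _ hLt (sd.in_Lb hf1 hx)
      · exact insert_subset_insert _ hLt (sd.in_Lb hf1 hy)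
    · rw [sd.out_Lb hf1] at hx hy
      obtain ⟨b, hb, h1⟩ := h.adj f1 x hx y hy
      exact ⟨b, Or.inr hb, h1⟩
  · intro f1 hp h3
    by_cases hf1 : f1 ∈ C.Comp B g
    · exact Or.inr (hin3 f1 hf1 hp h3)
    · left
      rw [sd.out_gam hf1] at h3
      rw [sd.out_Lb hf1]
      have hp' := sd.out_pend hf1 hp
      exact ⟨h.mem f1 hp' h3, hoth f1 hf1 hp' h3⟩
  · intro f1 f2 hp1 hp2 h1 h2 hL
    by_cases hf1 : f1 ∈ C.Comp B g <;> by_cases hf2 : f2 ∈ C.Comp B g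
    · exact sd.uniq hf1 (sd.in_pend hp1) h1 hf2 (sd.in_pend hp2) h2 hL
    · obtain ⟨x, -, hx⟩ := hin3 f1 hf1 hp1 h1
      exact absurd (by rw [← hL, hx]; simp) (hout f2 hf2 hp2 h2)
    · obtain ⟨x, -, hx⟩ := hin3 f2 hf2 hp2 h2
      exact absurd (by rw [hL, hx]; simp) (hout f1 hf1 hp1 h1)
    · rw [sd.out_comp hf1]
      rw [sd.out_gam hf1] at h1
      rw [sd.out_gam hf2] at h2
      rw [sd.out_Lb hf1, sd.out_Lb hf2] at hL
      exact h.uq f1 f2 (sd.out_pend hf1 hp1) (sd.out_pend hf2 hp2) h1 h2 hL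
  · intro x m
    by_cases hx : x = n
    · refine (card_le_card ?_).trans ((sd.size hq (hlen f) m).trans hl)
      intro v hv
      simp only [mem_filter, mem_univ, true_and] at hv ⊢
      refine ⟨hv.1, fun hS => ?_, hv.2.2⟩
      have := h.lt v hS
      rw [← sd.hp v hS] at this
      omega
    · refine (card_le_card ?_).trans (h.size x m)
      intro v hv
      simp only [mem_filter, mem_univ, true_and] at hv ⊢
      have hS : v ∈ S := by
        by_contra hS
        exact hx (hv.2.1.symm.trans (sd.hp' v hS))
      exact ⟨hS, by rw [← sd.hp v hS]; exact hv.2.1, hv.2.2⟩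

theorem St.step {C : Cx V E F} {T : BFS C} {q l d n : ℕ} {S B part} {𝓕 𝓑 : Set (Finset ℕ)} (hq : 0 < q)
    (hlen : ∀ f, C.len f ≤ d) (hl : d + 3 * q - 3 ≤ l) (h : St T q l S B part n 𝓕 𝓑) {g : F} (hg : Pend C B g) :
    ∃ S' B' part' n' 𝓕' 𝓑', B ⊂ B' ∧ St T q l S' B' part' n' 𝓕' 𝓑' := by
  by_cases hex : ∃ g0, Pend C B g0 ∧ (Gam C B part g0).card = 3
  · obtain ⟨g0, hp, h3⟩ := hex
    refine h.step1 hq hlen hl hp (h.mem g0 hp h3) (Finset.Subset.refl _) ?_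
    intro f1 hf1 hp1 h31 hL
    exact hf1 (h.uq g0 f1 hp hp1 h3 h31 hL.symm)
  · push Not at hex
    have h1 := h.g3 g hg
    have h2 := hex g hg
    have h3 := Lb_card_le h.base part h1
    have h0 : 0 < (Lb C S B part g).card := by
      obtain ⟨S', B', part', f, a, sd⟩ := SD.exist h.base h.lt (h.g3 g hg) hg
      exact sd.Lb_pos
    have : ∃ t ∈ 𝓕, Lb C S B part g ⊆ t := by
      have h4 : (Lb C S B part g).card = 1 ∨ (Lb C S B part g).card = 2 := by omega
      have hxy : ∃ x ∈ Lb C S B part g, ∃ y ∈ Lb C S B part g, ∀ z ∈ Lb C S B part g, z = x ∨ z = y := by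
        rcases h4 with h4 | h4
        · obtain ⟨x, hx⟩ := card_eq_one.1 h4
          exact ⟨x, by simp [hx], x, by simp [hx], by simp [hx]⟩
        · obtain ⟨x, y, -, hx⟩ := card_eq_two.1 h4
          exact ⟨x, by simp [hx], y, by simp [hx], by simp [hx]⟩
      obtain ⟨x, hx, y, hy, hz⟩ := hxy
      obtain ⟨b, hb, h5, h6⟩ := h.adj g x hx y hy
      obtain ⟨t, ht, h7, h8⟩ := h.apo.pair b hb x h5 y h6
      refine ⟨t, ht, fun z hz' => ?_⟩
      rcases hz z hz' with rfl | rfl <;> assumption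
    obtain ⟨t, ht, hLt⟩ := this
    exact h.step1 hq hlen hl hg ht hLt (fun f1 _ hp h3 => absurd h3 (hex f1 hp))

theorem St.run {C : Cx V E F} {T : BFS C} {q l d : ℕ} (hq : 0 < q)
    (hlen : ∀ f, C.len f ≤ d) (hl : d + 3 * q - 3 ≤ l) : ∀ (B : Set E) (S : Set V) (part : V → ℕ) (n : ℕ) 
    (𝓕 𝓑 : Set (Finset ℕ)), St T q l S B part n 𝓕 𝓑 → ∃ part' n' 𝓕' 𝓑', St T q l Set.univ Set.univ part' n' 𝓕' 𝓑' := by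
  intro B
  induction B using WellFoundedGT.induction with
  | ind B ih =>
    intro S part n 𝓕 𝓑 h
    by_cases hp : ∃ g, Pend C B g
    · obtain ⟨g, hg⟩ := hp
      obtain ⟨S', B', part', n', 𝓕', 𝓑', hlt, h'⟩ := h.step hq hlen hl hg
      exact ih B' hlt S' part' n' 𝓕' 𝓑' h'
    · have hB : B = Set.univ := by
        rw [Set.eq_univ_iff_forall]
        intro e
        by_contra he
        obtain ⟨o, ho⟩ := C.exists_face e
        exact hp ⟨o, e, he, o, C.Comp_self _ _, ho⟩
      have hS : S = Set.univ := by
        rw [Set.eq_univ_iff_forall]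
        intro v
        by_contra hv
        exact h.base.pe_nw hv (by rw [hB]; trivial)
      subst hB; subst hS
      exact ⟨part, n, 𝓕, 𝓑, h⟩

theorem layer_anc {C : Cx V E F} (T : BFS C) {q : ℕ} (hq : 0 < q) (v : V) (m : ℕ) :
    (univ.filter (fun w => T.Anc w v ∧ T.depth w / q = m)).card ≤ q := by
  have : (univ.filter (fun w => T.Anc w v ∧ T.depth w / q = m)).card ≤ (Finset.range q).card := by
    refine Finset.card_le_card_of_injOn (fun w => T.depth w % q) ?_ ?_
    · intro w hw
      simpa using Nat.mod_lt _ hq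
    · intro w hw w' hw' he
      simp only [coe_filter, mem_univ, true_and, Set.mem_ofPred_eq] at hw hw'
      refine T.Anc_inj hw.1 hw'.1 ?_
      rw [← Nat.div_add_mod (T.depth w) q, ← Nat.div_add_mod (T.depth w') q, hw.2, hw'.2]
      simp only at he
      rw [he]
  simpa using this

theorem Anc_root {C : Cx V E F} (T : BFS C) (v : V) : T.Anc T.r v := by
  refine T.ind (p := fun v => T.Anc T.r v) ?_ ?_ v
  · exact (T.Anc_iff _ _).2 (Or.inl rfl)
  · intro v hv h; exact (T.Anc_iff _ _).2 (Or.inr ⟨hv, h⟩)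

/-- main theorem for cell complexes -/
theorem Cx.main (C : Cx V E F) [Nonempty E] (r : V) (g d : ℕ) (hd : 3 ≤ d) (hlen : ∀ f, C.len f ≤ d)
    (hg : Fintype.card E + 2 ≤ Fintype.card V + Fintype.card F + g) :
    ∃ (T : BFS C) (part : V → ℕ) (n : ℕ) (𝓕 𝓑 : Set (Finset ℕ)),
      St T (d / 2) (max (2 * g * (d / 2)) (d + 3 * (d / 2) - 3)) Set.univ Set.univ part n 𝓕 𝓑 := by
  obtain ⟨T, -⟩ := BFS.exist C r
  have hq : 0 < d / 2 := by omega
  obtain ⟨A, S, B, hA, hr, hSA, hw, hyp⟩ := T.init g hg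
  have hG : ∀ g, Gam C B (fun _ => 0) g = ∅ := by
    intro g
    rw [eq_empty_iff_forall_notMem]
    intro p hp
    have h2 := ((mem_Gam C).1 hp).2.2.2
    obtain ⟨u, v, -, huv⟩ := C.ends_ex p.1
    rw [lab_eq C huv] at h2
    simp at h2
  have hL : ∀ g, ∀ x ∈ Lb C S B (fun _ => 0) g, x = 0 := by
    intro g x hx
    obtain ⟨v, -, -, h⟩ := (mem_Lb C).1 hx
    exact h.symm
  have st : St T (d / 2) (max (2 * g * (d / 2)) (d + 3 * (d / 2) - 3)) S B (fun _ => 0) 3 {{0,1,2}} {{0,1,2}} := by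
    refine ⟨⟨hr, hw, hyp⟩, by simp, Apo.base, ?_, ?_, ?_, ?_, ?_⟩
    · intro g _; simp [hG]
    · intro g x hx y hy
      exact ⟨_, rfl, by simp [hL g x hx], by simp [hL g y hy]⟩
    · intro g _ h; simp [hG] at h
    · intro f1 f2 _ _ h; simp [hG] at h
    · intro x m
      rcases A.eq_empty_or_nonempty with hA0 | ⟨a0, ha0⟩
      · refine le_trans ?_ (le_max_right _ _)
        have : (univ.filter (fun v => v ∈ S ∧ 0 = x ∧ T.depth v / (d/2) = m)).card ≤ ({T.r} : Finset V).card := by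
          refine card_le_card ?_
          intro v hv
          simp only [mem_filter, mem_univ, true_and, mem_singleton] at hv ⊢
          rcases hSA v hv.1 with h | ⟨a, ha, -⟩
          · exact h
          · simp [hA0] at ha
        rw [card_singleton] at this
        omega
      · refine le_trans ?_ (le_max_left _ _)
        have hsub : (univ.filter (fun v => v ∈ S ∧ 0 = x ∧ T.depth v / (d/2) = m)) ⊆
            A.biUnion (fun a => univ.filter (fun w => T.Anc w a ∧ T.depth w / (d/2) = m)) := by
          intro v hv
          simp only [mem_filter, mem_univ, true_and, mem_biUnion] at hv ⊢
          rcases hSA v hv.1 with rfl | ⟨a, ha, h⟩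
          · exact ⟨a0, ha0, Anc_root T a0, hv.2.2⟩
          · exact ⟨a, ha, h, hv.2.2⟩
        refine (card_le_card hsub).trans ((card_biUnion_le_card_mul _ _ _ (fun a _ => layer_anc T hq a m)).trans ?_)
        exact Nat.mul_le_mul_right _ hA
  obtain ⟨part', n', 𝓕', 𝓑', h⟩ := St.run hq hlen (le_max_right _ _) B S _ _ _ _ st
  exact ⟨T, part', n', 𝓕', 𝓑', h⟩

end
end FPS


set_option linter.unusedSectionVars false
set_option linter.unusedVariables false
namespace FPS
noncomputable section
open Finset Relation
open scoped Classical
variable {V E F : Type} [Fintype V] [Fintype E] [Fintype F]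

theorem BFS.walk {C : Cx V E F} (T : BFS C) (f : F) (i k : ℕ) :
    T.depth (C.vtx f (i + k)) ≤ T.depth (C.vtx f i) + k ∧ T.depth (C.vtx f i) ≤ T.depth (C.vtx f (i + k)) + k := by
  induction k with
  | zero => simp
  | succ k ih =>
    have h1 := T.lip _ _ _ (C.compat f (i + k))
    have h2 := T.lip _ _ _ ((C.compat f (i + k)).trans Sym2.eq_swap)
    rw [← add_assoc]
    omega

theorem BFS.cof {C : Cx V E F} (T : BFS C) {d : ℕ} {f : F} (hl : C.len f ≤ d) {u v : V} (hu : C.VOn u f) (hv : C.VOn v f) :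
    T.depth u ≤ T.depth v + d / 2 := by
  obtain ⟨i, hi, rfl⟩ := hu.lt
  obtain ⟨j, hj, rfl⟩ := hv.lt
  rcases le_total i j with hij | hij
  · have h1 := T.walk f i (j - i)
    have h2 := T.walk f j (i + C.len f - j)
    rw [show i + (j - i) = j by omega] at h1
    rw [show j + (i + C.len f - j) = i + C.len f by omega, C.vper] at h2
    omega
  · have h1 := T.walk f j (i - j)
    have h2 := T.walk f i (j + C.len f - i)
    rw [show j + (i - j) = i by omega] at h1
    rw [show i + (j + C.len f - i) = j + C.len f by omega, C.vper] at h2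
    omega

theorem Cx.fin (C : Cx V E F) [Nonempty E] (r : V) (g d : ℕ) (hd : 3 ≤ d) (hlen : ∀ f, C.len f ≤ d)
    (hg : Fintype.card E + 2 ≤ Fintype.card V + Fintype.card F + g) :
    ∃ (n : ℕ) (𝓕 𝓑 : Set (Finset ℕ)) (N : ℕ), Apo n 𝓕 𝓑 ∧ ∀ Gr : SimpleGraph V,
      (∀ u v, Gr.Adj u v → ∃ f, C.VOn u f ∧ C.VOn v f) →
      Gr.IsContainedIn (((Apo.gr n 𝓑).strongProd (SimpleGraph.pathGraph N)).strongProd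
          (SimpleGraph.completeGraph (Fin (max (2 * g * (d / 2)) (d + 3 * (d / 2) - 3))))) := by
  obtain ⟨T, part, n, 𝓕, 𝓑, st⟩ := C.main r g d hd hlen hg
  generalize hl : max (2 * g * (d / 2)) (d + 3 * (d / 2) - 3) = l at *
  have hl0 : 0 < l := by
    have := le_max_right (2 * g * (d / 2)) (d + 3 * (d / 2) - 3)
    omega
  have hq : 0 < d / 2 := by omega
  generalize hqq : d / 2 = q at *
  obtain ⟨N, hN⟩ : ∃ N, ∀ v, T.depth v / q < N := by
    refine ⟨(univ.sup fun v => T.depth v / q) + 1, fun v => Nat.lt_succ_of_le ?_⟩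
    exact Finset.le_sup (f := fun v => T.depth v / q) (mem_univ v)
  refine ⟨n, 𝓕, 𝓑, N, st.apo, ?_⟩
  intro Gr hGr
  have : Nonempty (Fin l) := ⟨⟨0, hl0⟩⟩
  have hidx : ∀ x m, ∃ ix : V → Fin l, ∀ u v, (part u = x ∧ T.depth u / q = m) → (part v = x ∧ T.depth v / q = m) →
      ix u = ix v → u = v := by
    intro x m
    set cl := univ.filter (fun v => v ∈ Set.univ ∧ part v = x ∧ T.depth v / q = m) with hcl
    have hc : Fintype.card {v // v ∈ cl} ≤ Fintype.card (Fin l) := by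
      rw [Fintype.card_coe, Fintype.card_fin]; rw [hcl]; convert st.size x m
    obtain ⟨em⟩ := Function.Embedding.nonempty_of_card_le hc
    refine ⟨fun v => if h : v ∈ cl then em ⟨v, h⟩ else Classical.arbitrary _, ?_⟩
    intro u v hu hv he
    have hu' : u ∈ cl := by simp [hcl, hu]
    have hv' : v ∈ cl := by simp [hcl, hv]
    simp only [hu', hv', dif_pos] at he
    simpa using em.injective he
  choose ix hix using hidx
  have hinj : Function.Injective (fun v : V => (((⟨part v, st.lt v trivial⟩, ⟨T.depth v / q, hN v⟩),
      ix (part v) (T.depth v / q) v) : (Fin n × Fin N) × Fin l)) := by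
    intro u v huv
    simp only [Prod.mk.injEq, Fin.mk.injEq] at huv
    obtain ⟨⟨h1, h2⟩, h3⟩ := huv
    rw [h1, h2] at h3
    exact hix _ _ u v ⟨h1, h2⟩ ⟨rfl, rfl⟩ h3
  refine ⟨⟨_, ?_⟩, hinj⟩
  intro u v huv
  obtain ⟨f, hu, hv⟩ := hGr u v huv
  have hne := huv.ne
  have hLu : part u ∈ Lb C Set.univ Set.univ part f := (mem_Lb C).2 ⟨u, trivial, ⟨f, C.Comp_self _ _, hu⟩, rfl⟩
  have hLv : part v ∈ Lb C Set.univ Set.univ part f := (mem_Lb C).2 ⟨v, trivial, ⟨f, C.Comp_self _ _, hv⟩, rfl⟩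
  refine ⟨fun h => hne (hinj h), ?_, ?_⟩
  · by_cases hp : (((⟨part u, st.lt u trivial⟩, ⟨T.depth u / q, hN u⟩) : Fin n × Fin N)) =
      (⟨part v, st.lt v trivial⟩, ⟨T.depth v / q, hN v⟩)
    · exact Or.inl hp
    · right
      refine ⟨hp, ?_, ?_⟩
      · by_cases h : part u = part v
        · left; exact Fin.ext h
        · right
          obtain ⟨b, hb, h1, h2⟩ := st.adj f _ hLu _ hLv
          exact ⟨fun e => h (Fin.mk.inj_iff.1 e), b, hb, h1, h2⟩
      · have h1 := T.cof (hlen f) hu hv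
        have h2 := T.cof (hlen f) hv hu
        rw [hqq] at h1 h2
        have h3 := Nat.div_le_div_right (c := q) h1
        have h4 := Nat.div_le_div_right (c := q) h2
        rw [Nat.add_div_right _ hq] at h3 h4
        by_cases h : T.depth u / q = T.depth v / q
        · left; exact Fin.ext h
        · right
          rw [SimpleGraph.pathGraph_adj]
          simp only
          omega
  · by_cases h : ix (part u) (T.depth u / q) u = ix (part v) (T.depth v / q) v
    · exact Or.inl h
    · exact Or.inr h

end
end FPS


set_option linter.unusedSectionVars false
set_option linter.unusedVariables false
namespace FPS
noncomputable section
open Finset Relation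
open scoped Classical

section raw
variable {V' E' F' : Type}

/-- raw face data -/
structure Raw (V' E' F' : Type) where
  ends : E' → Sym2 V'
  len : F' → ℕ
  a : F' → ℕ → V'
  b : F' → ℕ → E'
  two_le : ∀ f, 2 ≤ len f
  compat : ∀ f i, i + 1 < len f → ends (b f i) = s(a f i, a f (i + 1))
  compat' : ∀ f i, i + 1 = len f → ends (b f i) = s(a f i, a f 0)
  ainj : ∀ f i j, i < len f → j < len f → a f i = a f j → i = j
  binj : ∀ f i j, i < len f → j < len f → b f i = b f j → i = j

namespace Raw
variable (R : Raw V' E' F')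
def N (e : E') (o : F') : Prop := ∃ i, i < R.len o ∧ R.b o i = e
def VN (v : V') (o : F') : Prop := ∃ i, i < R.len o ∧ R.a o i = v
def vtx (f : F') (i : ℕ) : V' := R.a f (i % R.len f)
def edge (f : F') (i : ℕ) : E' := R.b f (i % R.len f)
theorem pos (f) : 0 < R.len f := by have := R.two_le f; omega
theorem N_iff (e f) : (∃ i, R.edge f i = e) ↔ R.N e f :=
  ⟨fun ⟨i, h⟩ => ⟨_, Nat.mod_lt _ (R.pos f), h⟩, fun ⟨i, h, h'⟩ => ⟨i, by rw [edge, Nat.mod_eq_of_lt h, h']⟩⟩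
theorem VN_iff (e f) : (∃ i, R.vtx f i = e) ↔ R.VN e f :=
  ⟨fun ⟨i, h⟩ => ⟨_, Nat.mod_lt _ (R.pos f), h⟩, fun ⟨i, h, h'⟩ => ⟨i, by rw [vtx, Nat.mod_eq_of_lt h, h']⟩⟩
theorem comp (f i) : R.ends (R.edge f i) = s(R.vtx f i, R.vtx f (i + 1)) := by
  unfold edge vtx
  have h1 := Nat.mod_lt i (R.pos f)
  by_cases h : i % R.len f + 1 < R.len f
  · rw [R.compat f _ h, Nat.add_mod, Nat.mod_eq_of_lt (show 1 < R.len f from R.two_le f), Nat.mod_eq_of_lt h]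
  · have h2 : i % R.len f + 1 = R.len f := by omega
    rw [R.compat' f _ h2, Nat.add_mod, Nat.mod_eq_of_lt (show 1 < R.len f from R.two_le f), h2, Nat.mod_self]
theorem VN_of {v e f} (h : R.N e f) (hv : v ∈ R.ends e) : R.VN v f := by
  obtain ⟨i, rfl⟩ := (R.N_iff e f).2 h
  rw [R.comp, Sym2.mem_iff] at hv
  rw [← R.VN_iff]
  rcases hv with rfl | rfl
  · exact ⟨_, rfl⟩
  · exact ⟨_, rfl⟩
def rel (v : V') (o o' : F') : Prop := ∃ e, v ∈ R.ends e ∧ R.N e o ∧ R.N e o'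

def toCx (h2 : ∀ e, ∃ f f', f ≠ f' ∧ ∀ o, R.N e o ↔ o = f ∨ o = f')
    (hs : ∀ v f f', R.VN v f → R.VN v f' → EqvGen (R.rel v) f f')
    (hc : ∀ u v, ReflTransGen (fun a b => ∃ e, R.ends e = s(a, b)) u v) : Cx V' E' F' where
  ends := R.ends
  len := R.len
  vtx := R.vtx
  edge := R.edge
  two_le := R.two_le
  vper f i := by simp [vtx]
  eper f i := by simp [edge]
  compat := R.comp
  vinj f i j hi hj h := by
    unfold vtx at h
    rw [Nat.mod_eq_of_lt hi, Nat.mod_eq_of_lt hj] at h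
    exact R.ainj f i j hi hj h
  einj f i j hi hj h := by
    unfold edge at h
    rw [Nat.mod_eq_of_lt hi, Nat.mod_eq_of_lt hj] at h
    exact R.binj f i j hi hj h
  two e := by
    obtain ⟨f, f', h1, h3⟩ := h2 e
    exact ⟨f, f', h1, fun o => by rw [R.N_iff]; exact h3 o⟩
  star v f f' h h' := by
    rw [R.VN_iff] at h h'
    have := hs v f f' h h'
    unfold rel at this
    simpa only [R.N_iff] using this
  conn := hc
end Raw

variable {V E F : Type} [Fintype V] [Fintype E] [Fintype F]

theorem Raw.lift (C : Cx V E F) (R : Raw V' E' F') (jv : V → V') (je : E → E') (π : F' → F)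
    (hjv : Function.Injective jv)
    (hends : ∀ e, R.ends (je e) = (C.ends e).map jv)
    (hon : ∀ e o, R.N (je e) o → C.On e (π o))
    (hex : ∀ e f, C.On e f → ∃ o, π o = f ∧ R.N (je e) o ∧ ∀ o', π o' = f → R.N (je e) o' → o' = o)
    (hvon : ∀ v o, R.VN (jv v) o → C.VOn v (π o))
    (hfib : ∀ v o o', R.VN (jv v) o → R.VN (jv v) o' → π o = π o' → EqvGen (R.rel (jv v)) o o')
    (hnew : ∀ e', (∀ e, e' ≠ je e) → ∃ f f', f ≠ f' ∧ ∀ o, R.N e' o ↔ o = f ∨ o = f')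
    (hnews : ∀ v', (∀ v, v' ≠ jv v) → ∀ o o', R.VN v' o → R.VN v' o' → EqvGen (R.rel v') o o')
    (hnewc : ∀ v', (∀ v, v' ≠ jv v) → ∃ e' v, R.ends e' = s(v', jv v)) :
    ∃ C' : Cx V' E' F', C'.ends = R.ends ∧ C'.len = R.len ∧ (∀ v o, C'.VOn v o ↔ R.VN v o) ∧
      (∀ f i, i < R.len f → C'.vtx f i = R.a f i) := by
  have hmem : ∀ v e, v ∈ C.ends e → jv v ∈ R.ends (je e) := by
    intro v e h; rw [hends]; exact Sym2.mem_map.2 ⟨v, h, rfl⟩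
  have hrep : ∀ v f, C.VOn v f → ∃ o, π o = f ∧ R.VN (jv v) o := by
    intro v f h
    obtain ⟨e, he, hv⟩ := C.edge_at h
    obtain ⟨o, h1, h2, -⟩ := hex e f he
    exact ⟨o, h1, R.VN_of h2 (hmem v e hv)⟩
  refine ⟨R.toCx ?_ ?_ ?_, rfl, rfl, fun v o => R.VN_iff v o, fun f i h => ?_⟩
  · intro e'
    by_cases he : ∃ e, e' = je e
    · obtain ⟨e, rfl⟩ := he
      obtain ⟨f, f', hne, h1, h2, h3⟩ := C.two' e
      obtain ⟨o, p1, p2, p3⟩ := hex e f h1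
      obtain ⟨o', q1, q2, q3⟩ := hex e f' h2
      refine ⟨o, o', fun h => hne (by rw [← p1, ← q1, h]), fun x => ⟨fun hx => ?_, ?_⟩⟩
      · rcases h3 _ (hon e x hx) with h | h
        · exact Or.inl (p3 x h hx)
        · exact Or.inr (q3 x h hx)
      · rintro (rfl | rfl) <;> assumption
    · push Not at he; exact hnew e' he
  · intro v' o o' ho ho'
    by_cases hv : ∃ v, v' = jv v
    · obtain ⟨v, rfl⟩ := hv
      have key : ∀ f f', EqvGen (fun o o' => ∃ e, v ∈ C.ends e ∧ (∃ i, C.edge o i = e) ∧ (∃ i, C.edge o' i = e)) f f' →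
          (C.VOn v f ↔ C.VOn v f') ∧ ∀ o o', π o = f → π o' = f' → R.VN (jv v) o → R.VN (jv v) o' →
            EqvGen (R.rel (jv v)) o o' := by
        intro f f' h
        induction h with
        | rel f f' h =>
          obtain ⟨e, hv, h1, h2⟩ := h
          refine ⟨⟨fun _ => C.VOn_of_mem h2 hv, fun _ => C.VOn_of_mem h1 hv⟩, ?_⟩
          intro o o' ho ho' hvo hvo'
          obtain ⟨x, x1, x2, -⟩ := hex e f h1
          obtain ⟨y, y1, y2, -⟩ := hex e f' h2
          refine EqvGen.trans _ x _ (hfib v o x hvo (R.VN_of x2 (hmem v e hv)) (by rw [ho, x1])) ?_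
          refine EqvGen.trans _ y _ (EqvGen.rel _ _ ⟨je e, hmem v e hv, x2, y2⟩) ?_
          exact hfib v y o' (R.VN_of y2 (hmem v e hv)) hvo' (by rw [ho', y1])
        | refl f => exact ⟨Iff.rfl, fun o o' h1 h2 h3 h4 => hfib v o o' h3 h4 (by rw [h1, h2])⟩
        | symm f f' _ ih => exact ⟨ih.1.symm, fun o o' h1 h2 h3 h4 => EqvGen.symm _ _ (ih.2 o' o h2 h1 h4 h3)⟩
        | trans f f' f'' _ _ ih1 ih2 =>
          refine ⟨ih1.1.trans ih2.1, fun o o' h1 h2 h3 h4 => ?_⟩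
          obtain ⟨x, x1, x2⟩ := hrep v f' (ih2.1.2 (h2 ▸ hvon v o' h4))
          exact EqvGen.trans _ x _ (ih1.2 o x h1 x1 h3 x2) (ih2.2 x o' x1 h2 x2 h4)
      exact (key _ _ (C.star v (π o) (π o') (hvon v o ho) (hvon v o' ho'))).2 o o' rfl rfl ho ho'
    · push Not at hv; exact hnews v' hv o o' ho ho'
  · have hold : ∀ u v, ReflTransGen (fun a b => ∃ e, R.ends e = s(a, b)) (jv u) (jv v) := by
      intro u v
      refine ReflTransGen.lift jv ?_ _ _ (C.conn u v)
      rintro a b ⟨e, he⟩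
      exact ⟨je e, by rw [hends, he]; rfl⟩
    have hto : ∀ u, ∃ v, ReflTransGen (fun a b => ∃ e, R.ends e = s(a, b)) u (jv v) ∧
        ReflTransGen (fun a b => ∃ e, R.ends e = s(a, b)) (jv v) u := by
      intro u
      by_cases hv : ∃ v, u = jv v
      · obtain ⟨v, rfl⟩ := hv; exact ⟨v, ReflTransGen.refl, ReflTransGen.refl⟩
      · push Not at hv
        obtain ⟨e', v, h⟩ := hnewc u hv
        exact ⟨v, ReflTransGen.single ⟨e', h⟩, ReflTransGen.single ⟨e', h.trans Sym2.eq_swap⟩⟩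
    intro u v
    obtain ⟨u', h1, -⟩ := hto u
    obtain ⟨v', -, h2⟩ := hto v
    exact h1.trans ((hold u' v').trans h2)
  · show R.a f (i % R.len f) = _
    rw [Nat.mod_eq_of_lt h]

end raw

variable {V E F : Type} [Fintype V] [Fintype E] [Fintype F]

/-- splitting off a triangle from a long face -/
theorem Cx.chord (C : Cx V E F) (f0 : F) (h4 : 4 ≤ C.len f0) :
    ∃ C' : Cx V (Option E) (Option F), (∀ e, C'.ends (some e) = C.ends e) ∧ C'.len none = 3 ∧
      (∀ f, C'.len (some f) = if f = f0 then C.len f0 - 1 else C.len f) ∧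
      (∀ f v, f ≠ f0 → C.VOn v f → C'.VOn v (some f)) := by
  let R : Raw V (Option E) (Option F) :=
  { ends := fun e => e.elim s(C.vtx f0 0, C.vtx f0 2) C.ends
    len := fun o => o.elim 3 (fun f => if f = f0 then C.len f0 - 1 else C.len f)
    a := fun o i => o.elim (C.vtx f0 i) (fun f => if f = f0 then (if i = 0 then C.vtx f0 0 else C.vtx f0 (i + 1)) else C.vtx f i)
    b := fun o i => o.elim (if i = 2 then none else some (C.edge f0 i)) 
      (fun f => if f = f0 then (if i = 0 then none else some (C.edge f0 (i + 1))) else some (C.edge f i))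
    two_le := by
      rintro (_ | f)
      · simp
      · have := C.two_le f
        simp only [Option.elim]
        split_ifs <;> omega
    compat := by
      rintro (_ | f) i hi
      · simp only [Option.elim] at hi ⊢
        rw [if_neg (by omega)]
        exact C.compat f0 i
      · simp only [Option.elim] at hi ⊢
        by_cases h1 : f = f0
        · simp only [h1, if_true] at hi ⊢
          by_cases h2 : i = 0
          · subst h2; rfl
          · rw [if_neg h2, if_neg h2, if_neg (by omega)]
            exact C.compat f0 (i + 1)
        · simp only [h1, if_false]
          exact C.compat f i
    compat' := by
      rintro (_ | f) i hi
      · simp only [Option.elim] at hi ⊢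
        rw [if_pos (by omega)]
        have : i = 2 := by omega
        subst this
        exact Sym2.eq_swap
      · simp only [Option.elim] at hi ⊢
        by_cases h1 : f = f0
        · simp only [h1, if_true] at hi ⊢
          rw [if_neg (by omega), if_neg (by omega)]
          simp only
          rw [C.compat, show i + 1 + 1 = 0 + C.len f0 by omega, C.vper]
        · simp only [h1, if_false] at hi ⊢
          rw [C.compat, show i + 1 = 0 + C.len f by omega, C.vper]
    ainj := by
      rintro (_ | f) i j hi hj h
      · simp only [Option.elim] at hi hj h
        exact C.vinj f0 i j (by omega) (by omega) h
      · simp only [Option.elim] at hi hj h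
        by_cases h1 : f = f0
        · simp only [h1, if_true] at hi hj h
          split_ifs at h with a1 a2 a2
          · omega
          · have := C.vinj f0 _ _ (by omega) (by omega) h; omega
          · have := C.vinj f0 _ _ (by omega) (by omega) h; omega
          · have := C.vinj f0 _ _ (by omega) (by omega) h; omega
        · simp only [h1, if_false] at hi hj h
          exact C.vinj f _ _ hi hj h
    binj := by
      rintro (_ | f) i j hi hj h
      · simp only [Option.elim] at hi hj h
        split_ifs at h with a1 a2 a2
        · omega
        · simp only [Option.some.injEq] at h
          exact C.einj f0 i j (by omega) (by omega) h
      · simp only [Option.elim] at hi hj h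
        by_cases h1 : f = f0
        · simp only [h1, if_true] at hi hj h
          split_ifs at h with a1 a2 a2
          · omega
          · simp only [Option.some.injEq] at h
            have := C.einj f0 _ _ (by omega) (by omega) h; omega
        · simp only [h1, if_false, Option.some.injEq] at hi hj h
          exact C.einj f _ _ hi hj h }
  have hN0 : ∀ e, R.N (some e) none ↔ e = C.edge f0 0 ∨ e = C.edge f0 1 := by
    intro e
    constructor
    · rintro ⟨i, hi, h⟩
      change i < 3 at hi
      change (if i = 2 then none else some (C.edge f0 i)) = some e at h
      interval_cases i <;> simp at h <;> simp [h]
    · rintro (rfl | rfl)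
      · exact ⟨0, by show 0 < 3; omega, rfl⟩
      · exact ⟨1, by show 1 < 3; omega, rfl⟩
  have hN1 : ∀ e, R.N (some e) (some f0) ↔ ∃ i, 2 ≤ i ∧ i < C.len f0 ∧ C.edge f0 i = e := by
    intro e
    constructor
    · rintro ⟨i, hi, h⟩
      change i < (if f0 = f0 then C.len f0 - 1 else C.len f0) at hi
      change (if f0 = f0 then (if i = 0 then none else some (C.edge f0 (i + 1))) else some (C.edge f0 i)) = some e at h
      rw [if_pos rfl] at hi h
      split_ifs at h with h0
      exact ⟨i + 1, by omega, by omega, by simpa using h⟩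
    · rintro ⟨i, h2, hi, rfl⟩
      refine ⟨i - 1, ?_, ?_⟩
      · show i - 1 < (if f0 = f0 then C.len f0 - 1 else C.len f0)
        rw [if_pos rfl]; omega
      · show (if f0 = f0 then (if i - 1 = 0 then none else some (C.edge f0 (i - 1 + 1))) else some (C.edge f0 (i-1))) = _
        rw [if_pos rfl, if_neg (by omega), show i - 1 + 1 = i by omega]
  have hN2 : ∀ e f, f ≠ f0 → (R.N (some e) (some f) ↔ C.On e f) := by
    intro e f hf
    constructor
    · rintro ⟨i, hi, h⟩
      change (if f = f0 then (if i = 0 then none else some (C.edge f0 (i + 1))) else some (C.edge f i)) = some e at h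
      rw [if_neg hf] at h
      exact ⟨i, by simpa using h⟩
    · intro h
      obtain ⟨i, hi, rfl⟩ := h.lt
      refine ⟨i, ?_, ?_⟩
      · show i < (if f = f0 then C.len f0 - 1 else C.len f)
        rw [if_neg hf]; exact hi
      · show (if f = f0 then (if i = 0 then none else some (C.edge f0 (i + 1))) else some (C.edge f i)) = _
        rw [if_neg hf]
  have hV0 : ∀ v, R.VN v none ↔ v = C.vtx f0 0 ∨ v = C.vtx f0 1 ∨ v = C.vtx f0 2 := by
    intro v
    constructor
    · rintro ⟨i, hi, h⟩
      change i < 3 at hi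
      change C.vtx f0 i = v at h
      subst h
      interval_cases i <;> simp
    · rintro (rfl | rfl | rfl)
      · exact ⟨0, by show 0 < 3; omega, rfl⟩
      · exact ⟨1, by show 1 < 3; omega, rfl⟩
      · exact ⟨2, by show 2 < 3; omega, rfl⟩
  have hV1 : ∀ v, R.VN v (some f0) → ∃ i, i < C.len f0 ∧ i ≠ 1 ∧ C.vtx f0 i = v := by
    rintro v ⟨i, hi, h⟩
    change i < (if f0 = f0 then C.len f0 - 1 else C.len f0) at hi
    change (if f0 = f0 then (if i = 0 then C.vtx f0 0 else C.vtx f0 (i + 1)) else C.vtx f0 i) = v at h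
    rw [if_pos rfl] at hi h
    split_ifs at h with h0
    · exact ⟨0, by omega, by omega, h⟩
    · exact ⟨i + 1, by omega, by omega, h⟩
  have hV2 : ∀ v f, f ≠ f0 → (R.VN v (some f) ↔ C.VOn v f) := by
    intro v f hf
    constructor
    · rintro ⟨i, hi, h⟩
      change (if f = f0 then (if i = 0 then C.vtx f0 0 else C.vtx f0 (i + 1)) else C.vtx f i) = v at h
      rw [if_neg hf] at h
      exact ⟨i, h⟩
    · intro h
      obtain ⟨i, hi, rfl⟩ := h.lt
      refine ⟨i, ?_, ?_⟩
      · show i < (if f = f0 then C.len f0 - 1 else C.len f)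
        rw [if_neg hf]; exact hi
      · show (if f = f0 then (if i = 0 then C.vtx f0 0 else C.vtx f0 (i + 1)) else C.vtx f i) = _
        rw [if_neg hf]
  have hnn : R.N none none := ⟨2, by show 2 < 3; omega, rfl⟩
  have hns : R.N none (some f0) := ⟨0, by
    show 0 < (if f0 = f0 then C.len f0 - 1 else C.len f0)
    rw [if_pos rfl]; omega, by
    show (if f0 = f0 then (if 0 = 0 then none else some (C.edge f0 (0 + 1))) else some (C.edge f0 0)) = none
    simp⟩
  have hno : ∀ f, f ≠ f0 → ¬ R.N none (some f) := by
    rintro f hf ⟨i, hi, h⟩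
    change (if f = f0 then (if i = 0 then none else some (C.edge f0 (i + 1))) else some (C.edge f i)) = none at h
    rw [if_neg hf] at h
    simp at h
  have hfv : ∀ v, R.VN v none → R.VN v (some f0) → EqvGen (R.rel v) none (some f0) := by
    intro v h1 h2
    refine EqvGen.rel _ _ ⟨none, ?_, hnn, hns⟩
    show v ∈ s(C.vtx f0 0, C.vtx f0 2)
    rw [Sym2.mem_iff]
    obtain ⟨i, hi, hi1, h⟩ := hV1 v h2
    rcases (hV0 v).1 h1 with h3 | h3 | h3
    · exact Or.inl h3
    · rw [h3] at h
      exact absurd (C.vinj f0 _ _ hi (by omega) h) hi1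
    · exact Or.inr h3
  obtain ⟨C', p1, p2, p3, -⟩ := R.lift C id some (fun o => o.elim f0 id) Function.injective_id
    (fun e => by rw [Sym2.map_id]; rfl)
    (by
      rintro e (_ | f) h
      · rcases (hN0 e).1 h with rfl | rfl
        · exact C.on_edge f0 0
        · exact C.on_edge f0 1
      · by_cases hf : f = f0
        · subst hf
          obtain ⟨i, -, -, rfl⟩ := (hN1 e).1 h
          exact C.on_edge _ i
        · exact (hN2 e f hf).1 h)
    (by
      intro e f h
      by_cases hf : f = f0
      · subst hf
        obtain ⟨i, hi, rfl⟩ := h.lt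
        by_cases h2 : 2 ≤ i
        · refine ⟨some f, rfl, (hN1 _).2 ⟨i, h2, hi, rfl⟩, ?_⟩
          rintro (_ | o) ho hN
          · exfalso
            rcases (hN0 _).1 hN with h5 | h5
            · have := C.einj f _ _ hi (by omega) h5; omega
            · have := C.einj f _ _ hi (by omega) h5; omega
          · rw [show o = f from ho]
        · refine ⟨none, rfl, (hN0 _).2 ?_, ?_⟩
          · have : i = 0 ∨ i = 1 := by omega
            rcases this with rfl | rfl <;> simp
          · rintro (_ | o) ho hN
            · rfl
            · exfalso
              rw [show o = f from ho] at hN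
              obtain ⟨k, hk, hk2, h5⟩ := (hN1 _).1 hN
              have := C.einj f _ _ hk2 hi h5; omega
      · refine ⟨some f, rfl, (hN2 e f hf).2 h, ?_⟩
        rintro (_ | o) ho hN
        · exact absurd ho.symm hf
        · rw [show o = f from ho])
    (by
      rintro v (_ | f) h
      · rcases (hV0 v).1 h with rfl | rfl | rfl <;> exact C.von_vtx f0 _
      · by_cases hf : f = f0
        · subst hf
          obtain ⟨i, -, -, rfl⟩ := hV1 v h
          exact C.von_vtx _ i
        · exact (hV2 v f hf).1 h)
    (by
      rintro v (_ | f) (_ | f') h1 h2 h3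
      · exact EqvGen.refl _
      · have : f0 = f' := h3
        subst this
        exact hfv v h1 h2
      · have : f = f0 := h3
        subst this
        exact EqvGen.symm _ _ (hfv v h2 h1)
      · have : f = f' := h3
        subst this
        exact EqvGen.refl _)
    (by
      rintro (_ | e) he
      · refine ⟨none, some f0, by simp, ?_⟩
        rintro (_ | f)
        · simp [hnn]
        · by_cases hf : f = f0
          · subst hf; simp [hns]
          · simp [hf, hno f hf]
      · exact absurd rfl (he e))
    (fun v' h => absurd rfl (h v'))
    (fun v' h => absurd rfl (h v'))
  refine ⟨C', fun e => by rw [p1]; rfl, by rw [p2]; rfl, fun f => by rw [p2]; rfl, fun f v hf h => ?_⟩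
  rw [p3]
  exact (hV2 v f hf).2 h

end
end FPS


set_option linter.unusedSectionVars false
set_option linter.unusedVariables false
namespace FPS
noncomputable section
open Finset Relation
open scoped Classical
variable {V E F : Type} [Fintype V] [Fintype E] [Fintype F]

/-- stellar subdivision of a triangular face -/
theorem Cx.stellar (C : Cx V E F) (f0 : F) (h3 : C.len f0 = 3) :
    ∃ (C' : Cx (Option V) (E ⊕ Fin 3) ({f : F // f ≠ f0} ⊕ Fin 3)) (w : Fin 3 → V),
      Function.Injective w ∧ (∀ v, C.VOn v f0 ↔ ∃ i, w i = v) ∧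
      (∀ e, C'.ends (Sum.inl e) = (C.ends e).map some) ∧
      (∀ k, C'.ends (Sum.inr k) = s(some (w k), none)) ∧
      (∀ f, C'.len (Sum.inl f) = C.len f.1) ∧ (∀ i, C'.len (Sum.inr i) = 3) ∧
      (∀ v f, C'.VOn (some v) (Sum.inl f) ↔ C.VOn v f.1) ∧
      (∀ f, ¬ C'.VOn none (Sum.inl f)) ∧
      (∀ v i, C'.VOn (some v) (Sum.inr i) ↔ v = w i ∨ v = w (i + 1)) ∧
      (∀ i, C'.VOn none (Sum.inr i)) := by
  obtain ⟨w, hw⟩ : ∃ w : Fin 3 → V, w = fun i => C.vtx f0 i.val := ⟨_, rfl⟩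
  obtain ⟨ε, hε⟩ : ∃ w : Fin 3 → E, w = fun i => C.edge f0 i.val := ⟨_, rfl⟩
  have winj : Function.Injective w := by
    intro i j h
    rw [hw] at h
    exact Fin.ext (C.vinj f0 _ _ (by omega) (by omega) h)
  have einj : Function.Injective ε := by
    intro i j h
    rw [hε] at h
    exact Fin.ext (C.einj f0 _ _ (by omega) (by omega) h)
  have hww : ∀ i : Fin 3, w (i + 1) = C.vtx f0 (i.val + 1) := by
    intro i
    rw [hw]
    fin_cases i
    · rfl
    · rfl
    · show C.vtx f0 0 = C.vtx f0 3
      have := C.vper f0 0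
      rw [h3] at this
      exact this.symm
  have hends : ∀ i, C.ends (ε i) = s(w i, w (i + 1)) := by
    intro i
    rw [hww, hε, hw]
    exact C.compat f0 i.val
  have hvo : ∀ v, C.VOn v f0 ↔ ∃ i, w i = v := by
    intro v
    constructor
    · intro h
      obtain ⟨i, hi, h⟩ := h.lt
      exact ⟨⟨i, by omega⟩, by rw [hw]; exact h⟩
    · rintro ⟨i, rfl⟩
      rw [hw]; exact C.von_vtx f0 _
  have heo : ∀ v, C.On v f0 ↔ ∃ i, ε i = v := by
    intro v
    constructor
    · intro h
      obtain ⟨i, hi, h⟩ := h.lt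
      exact ⟨⟨i, by omega⟩, by rw [hε]; exact h⟩
    · rintro ⟨i, rfl⟩
      rw [hε]; exact C.on_edge f0 _
  have hne : ∀ i : Fin 3, i + 1 ≠ i := by decide
  let R : Raw (Option V) (E ⊕ Fin 3) ({f : F // f ≠ f0} ⊕ Fin 3) :=
  { ends := Sum.elim (fun e => (C.ends e).map some) (fun k => s(some (w k), none))
    len := Sum.elim (fun f => C.len f.1) (fun _ => 3)
    a := fun o n => Sum.elim (fun f => some (C.vtx f.1 n))
      (fun i => if n = 0 then some (w i) else if n = 1 then some (w (i + 1)) else none) o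
    b := fun o n => Sum.elim (fun f => Sum.inl (C.edge f.1 n))
      (fun i => if n = 0 then Sum.inl (ε i) else if n = 1 then Sum.inr (i + 1) else Sum.inr i) o
    two_le := by
      rintro (f | i)
      · exact C.two_le f.1
      · show 2 ≤ 3
        omega
    compat := by
      rintro (f | i) n hn
      · show (C.ends (C.edge f.1 n)).map some = _
        rw [C.compat]; rfl
      · change n + 1 < 3 at hn
        have : n = 0 ∨ n = 1 := by omega
        rcases this with rfl | rfl
        · show (C.ends (ε i)).map some = _
          rw [hends]; rfl
        · rfl
    compat' := by
      rintro (f | i) n hn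
      · change n + 1 = C.len f.1 at hn
        show (C.ends (C.edge f.1 n)).map some = _
        rw [C.compat, hn]
        have := C.vper f.1 0
        rw [zero_add] at this
        rw [this]; rfl
      · change n + 1 = 3 at hn
        have : n = 2 := by omega
        subst this
        exact Sym2.eq_swap
    ainj := by
      rintro (f | i) m n hm hn h
      · exact C.vinj f.1 _ _ hm hn (by simpa using h)
      · change m < 3 at hm
        change n < 3 at hn
        have h1 : w i ≠ w (i + 1) := fun h => hne i (winj h).symm
        interval_cases m <;> interval_cases n <;> simp_all
    binj := by
      rintro (f | i) m n hm hn h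
      · exact C.einj f.1 _ _ hm hn (by simpa using h)
      · change m < 3 at hm
        change n < 3 at hn
        have h1 := hne i
        have h2 := (hne i).symm
        interval_cases m <;> interval_cases n <;> simp_all }
  have N1 : ∀ e f, R.N (Sum.inl e) (Sum.inl f) ↔ C.On e f.1 := by
    intro e f
    constructor
    · rintro ⟨i, hi, h⟩
      exact ⟨i, by simpa using (show (Sum.inl (C.edge f.1 i) : E ⊕ Fin 3) = Sum.inl e from h)⟩
    · intro h
      obtain ⟨i, hi, rfl⟩ := h.lt
      exact ⟨i, hi, rfl⟩
  have N2 : ∀ e i, R.N (Sum.inl e) (Sum.inr i) ↔ e = ε i := by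
    intro e i
    constructor
    · rintro ⟨n, hn, h⟩
      change n < 3 at hn
      change (if n = 0 then Sum.inl (ε i) else if n = 1 then Sum.inr (i + 1) else Sum.inr i) = Sum.inl e at h
      interval_cases n <;> simp at h
      exact h.symm
    · rintro rfl
      exact ⟨0, by show 0 < 3; omega, rfl⟩
  have N3 : ∀ k f, ¬ R.N (Sum.inr k) (Sum.inl f) := by
    rintro k f ⟨n, hn, h⟩
    change (Sum.inl _ : E ⊕ Fin 3) = Sum.inr _ at h
    simp at h
  have N4 : ∀ k i, R.N (Sum.inr k) (Sum.inr i) ↔ k = i ∨ k = i + 1 := by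
    intro k i
    constructor
    · rintro ⟨n, hn, h⟩
      change n < 3 at hn
      change (if n = 0 then Sum.inl (ε i) else if n = 1 then Sum.inr (i + 1) else Sum.inr i) = Sum.inr k at h
      interval_cases n <;> simp at h <;> simp [h]
    · rintro (rfl | rfl)
      · exact ⟨2, by show 2 < 3; omega, rfl⟩
      · exact ⟨1, by show 1 < 3; omega, rfl⟩
  have V1 : ∀ v f, R.VN (some v) (Sum.inl f) ↔ C.VOn v f.1 := by
    intro e f
    constructor
    · rintro ⟨i, hi, h⟩
      exact ⟨i, by simpa using (show some (C.vtx f.1 i) = some e from h)⟩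
    · intro h
      obtain ⟨i, hi, rfl⟩ := h.lt
      exact ⟨i, hi, rfl⟩
  have V2 : ∀ f, ¬ R.VN none (Sum.inl f) := by
    rintro f ⟨i, hi, h⟩
    change some _ = none at h
    simp at h
  have V3 : ∀ v i, R.VN (some v) (Sum.inr i) ↔ v = w i ∨ v = w (i + 1) := by
    intro v i
    constructor
    · rintro ⟨n, hn, h⟩
      change n < 3 at hn
      change (if n = 0 then some (w i) else if n = 1 then some (w (i + 1)) else none) = some v at h
      interval_cases n <;> simp at h <;> simp [h]
    · rintro (rfl | rfl)
      · exact ⟨0, by show 0 < 3; omega, rfl⟩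
      · exact ⟨1, by show 1 < 3; omega, rfl⟩
  have V4 : ∀ i, R.VN none (Sum.inr i) := fun i => ⟨2, by show 2 < 3; omega, rfl⟩
  have M1 : ∀ k, some (w k) ∈ R.ends (Sum.inr k) := fun k => by
    show _ ∈ s(some (w k), none); simp
  have M2 : ∀ k, none ∈ R.ends (Sum.inr k) := fun k => by
    show _ ∈ s(some (w k), none); simp
  have hc3 : ∀ i j : Fin 3, i = j ∨ j = i + 1 ∨ i = j + 1 := by decide
  have hd3 : ∀ i : Fin 3, i + 1 + 1 ≠ i := by decide
  obtain ⟨C', p1, p2, p3, -⟩ := R.lift C some Sum.inl (Sum.elim (fun f => f.1) (fun _ => f0))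
    (Option.some_injective V) (fun e => rfl)
    (by
      rintro e (f | i) h
      · exact (N1 e f).1 h
      · exact (heo e).2 ⟨i, ((N2 e i).1 h).symm⟩)
    (by
      intro e f h
      by_cases hf : f = f0
      · subst hf
        obtain ⟨i, rfl⟩ := (heo e).1 h
        refine ⟨Sum.inr i, rfl, (N2 _ i).2 rfl, ?_⟩
        rintro (o | j) ho hN
        · exact absurd ho o.2
        · rw [einj ((N2 _ _).1 hN)]
      · refine ⟨Sum.inl ⟨f, hf⟩, rfl, (N1 _ _).2 h, ?_⟩
        rintro (o | j) ho hN
        · exact congrArg _ (Subtype.ext ho)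
        · exact absurd ho.symm hf)
    (by
      rintro v (f | i) h
      · exact (V1 v f).1 h
      · rcases (V3 v i).1 h with h | h
        · exact (hvo v).2 ⟨_, h.symm⟩
        · exact (hvo v).2 ⟨_, h.symm⟩)
    (by
      rintro v (f | i) (f' | j) h1 h2 h
      · have : f = f' := Subtype.ext h
        subst this; exact EqvGen.refl _
      · exact absurd h f.2
      · exact absurd h.symm f'.2
      · have key : ∀ k, v = w k → (k = i ∨ k = i + 1) → (k = j ∨ k = j + 1) → EqvGen (R.rel (some v)) (Sum.inr i) (Sum.inr j) := by
          intro k hk hi hj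
          exact EqvGen.rel _ _ ⟨Sum.inr k, hk ▸ M1 k, (N4 _ _).2 hi, (N4 _ _).2 hj⟩
        rcases (V3 v i).1 h1 with a | a <;> rcases (V3 v j).1 h2 with b | b
        · exact key _ a (Or.inl rfl) (Or.inl (winj (a.symm.trans b)))
        · exact key _ a (Or.inl rfl) (Or.inr (winj (a.symm.trans b)))
        · exact key _ a (Or.inr rfl) (Or.inl (winj (a.symm.trans b)))
        · exact key _ a (Or.inr rfl) (Or.inr (winj (a.symm.trans b))))
    (by
      rintro (e | k) h
      · exact absurd rfl (h e)
      · refine ⟨Sum.inr k, Sum.inr (k + 2), by simp, ?_⟩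
        rintro (f | i)
        · simp [N3]
        · rw [N4]
          simp only [Sum.inr.injEq]
          clear h
          revert k i
          decide)
    (by
      rintro (_ | v) h
      · rintro (f | i) (f' | j) h1 h2
        · exact absurd h1 (V2 f)
        · exact absurd h1 (V2 f)
        · exact absurd h2 (V2 f')
        · have : ∀ i j : Fin 3, ∃ k, (k = i ∨ k = i + 1) ∧ (k = j ∨ k = j + 1) := by decide
          obtain ⟨k, hi, hj⟩ := this i j
          exact EqvGen.rel _ _ ⟨Sum.inr k, M2 k, (N4 _ _).2 hi, (N4 _ _).2 hj⟩
      · exact absurd rfl (h v))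
    (by
      rintro (_ | v) h
      · exact ⟨Sum.inr 0, w 0, Sym2.eq_swap⟩
      · exact absurd rfl (h v))
  refine ⟨C', w, winj, hvo, fun e => by rw [p1]; rfl, fun e => by rw [p1]; rfl,
    fun e => by rw [p2]; rfl, fun e => by rw [p2]; rfl, ?_, ?_, ?_, ?_⟩
  · intro v f; rw [p3]; exact V1 v f
  · intro f; rw [p3]; exact V2 f
  · intro v f; rw [p3]; exact V3 v f
  · intro f; rw [p3]; exact V4 f

/-- the two-faced triangle -/
theorem Cx.base3 : ∃ C : Cx (Fin 3) (Fin 3) Bool, (∀ i, C.ends i = s(i, i + 1)) ∧ (∀ f, C.len f = 3) ∧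
    (∀ v f, C.VOn v f) := by
  let R : Raw (Fin 3) (Fin 3) Bool :=
  { ends := fun i => s(i, i + 1)
    len := fun _ => 3
    a := fun _ n => Fin.ofNat 3 n
    b := fun _ n => Fin.ofNat 3 n
    two_le := fun f => by decide
    compat := by
      intro f n hn
      have : n = 0 ∨ n = 1 := by omega
      rcases this with rfl | rfl <;> rfl
    compat' := by
      intro f n hn
      have : n = 2 := by omega
      subst this; rfl
    ainj := by
      intro f i j hi hj h
      have := congrArg Fin.val h
      simpa [Nat.mod_eq_of_lt hi, Nat.mod_eq_of_lt hj] using this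
    binj := by
      intro f i j hi hj h
      have := congrArg Fin.val h
      simpa [Nat.mod_eq_of_lt hi, Nat.mod_eq_of_lt hj] using this }
  have hN : ∀ e o, R.N e o := fun e o => ⟨e.val, e.2, by
    show Fin.ofNat 3 e.val = e
    simp⟩
  have hV : ∀ e o, R.VN e o := fun e o => ⟨e.val, e.2, by
    show Fin.ofNat 3 e.val = e
    simp⟩
  refine ⟨R.toCx ?_ ?_ ?_, fun i => rfl, fun f => rfl, fun v f => (R.VN_iff v f).2 (hV v f)⟩
  · intro e
    exact ⟨false, true, by decide, fun o => by simp [hN]⟩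
  · intro v f f' _ _
    exact EqvGen.rel _ _ ⟨v, by show v ∈ s(v, v + 1); simp, hN _ _, hN _ _⟩
  · intro u v
    have : ∀ i j : Fin 3, i = j ∨ s(i, i + 1) = s(i, j) ∨ s(j, j + 1) = s(i, j) := by decide
    rcases this u v with rfl | h | h
    · exact ReflTransGen.refl
    · exact ReflTransGen.single ⟨u, h⟩
    · exact ReflTransGen.single ⟨v, h⟩

end
end FPS


set_option linter.unusedSectionVars false
set_option linter.unusedVariables false
namespace FPS
noncomputable section
open Finset Relation
open scoped Classical

section emb
variable {V E F : Type}

def Cx.bdry (C : Cx V E F) (f : F) : (⟨C.ends⟩ : Multigraph V E).CWalk where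
  len := C.len f
  len_pos := by have := C.two_le f; omega
  vtx := C.vtx f
  edge := C.edge f
  vtx_per := C.vper f
  edge_per := C.eper f
  compat := C.compat f

theorem Cx.toEmb [Fintype V] [Fintype E] [Fintype F] [Nonempty V] (C : Cx V E F) :
    Nonempty ((⟨C.ends⟩ : Multigraph V E).Embedding F) := by
  refine ⟨⟨C.bdry, ?_, ?_, ?_⟩⟩
  · have : (⟨C.ends⟩ : Multigraph V E).simple.Preconnected := by
      intro u v
      have h := C.conn u v
      induction h with
      | refl => exact SimpleGraph.Reachable.refl _
      | @tail b c _ h ih =>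
        by_cases hbc : b = c
        · rw [← hbc]; exact ih
        · obtain ⟨e, he⟩ := h
          exact ih.trans (SimpleGraph.Adj.reachable ⟨hbc, e, he⟩)
    exact SimpleGraph.Connected.mk this
  · intro e
    obtain ⟨f, f', hne, h1, h2, h3⟩ := C.two' e
    obtain ⟨i, hi, hie⟩ := h1.lt
    obtain ⟨j, hj, hje⟩ := h2.lt
    have : {p : F × ℕ | Multigraph.IsOcc C.bdry e p} = {(f, i), (f', j)} := by
      ext ⟨o, k⟩
      simp only [Set.mem_ofPred_eq, Set.mem_insert_iff, Set.mem_singleton_iff, Prod.mk.injEq]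
      constructor
      · rintro ⟨hk, hke⟩
        change k < C.len o at hk
        change C.edge o k = e at hke
        rcases h3 o ⟨k, hke⟩ with rfl | rfl
        · exact Or.inl ⟨rfl, C.einj _ _ _ hk hi (hke.trans hie.symm)⟩
        · exact Or.inr ⟨rfl, C.einj _ _ _ hk hj (hke.trans hje.symm)⟩
      · rintro (⟨rfl, rfl⟩ | ⟨rfl, rfl⟩)
        · exact ⟨hi, hie⟩
        · exact ⟨hj, hje⟩
    rw [this]
    exact Set.ncard_pair (by simp [hne])
  · have key : ∀ v f f', EqvGen (fun o o' => ∃ e, v ∈ C.ends e ∧ (∃ i, C.edge o i = e) ∧ (∃ i, C.edge o' i = e)) f f' →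
        (C.VOn v f ↔ C.VOn v f') ∧ ∀ i i', Multigraph.IsCorner C.bdry v (f, i) → Multigraph.IsCorner C.bdry v (f', i') →
          EqvGen (Multigraph.CornerLinked C.bdry v) (f, i) (f', i') := by
      intro v f f' h
      have same : ∀ f i i', Multigraph.IsCorner C.bdry v (f, i) → Multigraph.IsCorner C.bdry v (f, i') →
          EqvGen (Multigraph.CornerLinked C.bdry v) (f, i) (f, i') := by
        rintro f i i' ⟨h1, h2⟩ ⟨h3, h4⟩
        have := C.vinj f i i' h1 h3 (h2.trans h4.symm)
        subst this; exact EqvGen.refl _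
      have endof : ∀ f i j e, Multigraph.IsCorner C.bdry v (f, i) → v ∈ C.ends e → j < C.len f → C.edge f j = e →
          Multigraph.EndOf C.bdry (f, i) (f, j) := by
        rintro f i j e ⟨h1, h2⟩ hv hj rfl
        change i < C.len f at h1
        change C.vtx f i = v at h2
        refine ⟨rfl, ?_⟩
        show i = j ∨ i = (j + 1) % C.len f
        rw [C.compat, Sym2.mem_iff] at hv
        rcases hv with hv | hv
        · exact Or.inl (C.vinj f _ _ h1 hj (h2.trans hv))
        · right
          refine C.vinj f _ _ h1 (Nat.mod_lt _ (by omega)) ?_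
          rw [C.vmod]; exact h2.trans hv
      induction h with
      | rel f f' h =>
        obtain ⟨e, hv, h1, h2⟩ := h
        refine ⟨⟨fun _ => C.VOn_of_mem h2 hv, fun _ => C.VOn_of_mem h1 hv⟩, ?_⟩
        intro i i' hi hi'
        by_cases hff : f = f'
        · subst hff; exact same f i i' hi hi'
        obtain ⟨j, hj, hje⟩ := Cx.On.lt h1
        obtain ⟨k, hk, hke⟩ := Cx.On.lt h2
        refine EqvGen.rel _ _ ⟨hi, hi', e, (f, j), (f', k), by simp [hff], ⟨hj, hje⟩, ⟨hk, hke⟩, ?_, ?_⟩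
        · exact endof f i j e hi hv hj hje
        · exact endof f' i' k e hi' hv hk hke
      | refl f => exact ⟨Iff.rfl, same f⟩
      | symm f f' _ ih => exact ⟨ih.1.symm, fun i i' h h' => EqvGen.symm _ _ (ih.2 i' i h' h)⟩
      | trans f f' f'' _ _ ih1 ih2 =>
        refine ⟨ih1.1.trans ih2.1, fun i i' h h' => ?_⟩
        obtain ⟨k, hk, hke⟩ := Cx.VOn.lt (ih1.1.1 ⟨i, h.2⟩)
        exact EqvGen.trans _ (f', k) _ (ih1.2 i k h ⟨hk, hke⟩) (ih2.2 k i' ⟨hk, hke⟩ h')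
    rintro v ⟨f, i⟩ ⟨f', i'⟩ h h'
    exact (key v f f' (C.star v f f' ⟨i, h.2⟩ ⟨i', h'.2⟩)).2 i i' h h'

end emb

theorem Apo.cx {n 𝓕 𝓑} (h : Apo n 𝓕 𝓑) : ∃ (V E F : Type) (_ : Fintype V) (_ : Fintype E) (_ : Fintype F)
    (C : Cx V E F) (φ : ℕ → V), Fintype.card E + 2 ≤ Fintype.card V + Fintype.card F ∧
      (∀ x y, x < n → y < n → φ x = φ y → x = y) ∧
      (∀ t ∈ 𝓕, ∃ f, C.len f = 3 ∧ ∀ v, C.VOn v f ↔ ∃ x ∈ t, φ x = v) ∧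
      (∀ b ∈ 𝓑, ∀ u ∈ b, ∀ v ∈ b, u ≠ v → ∃ e, C.ends e = s(φ u, φ v)) := by
  induction h with
  | base =>
    obtain ⟨C, h1, h2, h3⟩ := Cx.base3
    refine ⟨Fin 3, Fin 3, Bool, inferInstance, inferInstance, inferInstance, C, fun x => Fin.ofNat 3 x, by simp, ?_, ?_, ?_⟩
    · intro x y hx hy h
      have := congrArg Fin.val h
      simpa [Nat.mod_eq_of_lt hx, Nat.mod_eq_of_lt hy] using this
    · rintro t ht
      rw [Set.mem_singleton_iff] at ht
      subst ht
      refine ⟨true, h2 _, fun v => ⟨fun _ => ⟨v.val, ?_, by simp⟩, fun _ => h3 _ _⟩⟩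
      have := v.2
      simp only [Finset.mem_insert, Finset.mem_singleton]
      omega
    · rintro b hb u hu v hv huv
      rw [Set.mem_singleton_iff] at hb
      subst hb
      simp only [h1]
      have key : ∀ i j : Fin 3, i ≠ j → ∃ e : Fin 3, s(e, e + 1) = s(i, j) := by decide
      apply key
      simp only [Finset.mem_insert, Finset.mem_singleton] at hu hv
      intro h
      have := congrArg Fin.val h
      simp only [Fin.val_ofNat] at this
      omega
  | @step n 𝓕 𝓑 t h ht ih =>
    obtain ⟨V, E, F, i1, i2, i3, C, φ, hc, hφ, hF, hB⟩ := ih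
    obtain ⟨hlt, hltB⟩ := h.lt
    obtain ⟨f0, hl0, hv0⟩ := hF t ht
    obtain ⟨C', w, winj, hw, q1, q2, q3, q4, q5, q6, q7, q8⟩ := C.stellar f0 hl0
    have hS : ∀ x ∈ t, ∃ k, φ x = w k := by
      intro x hx
      obtain ⟨k, hk⟩ := (hw _).1 ((hv0 _).2 ⟨x, hx, rfl⟩)
      exact ⟨k, hk.symm⟩
    refine ⟨Option V, E ⊕ Fin 3, {f : F // f ≠ f0} ⊕ Fin 3, inferInstance, inferInstance, inferInstance, C',
      fun x => if x = n then none else some (φ x), ?_, ?_, ?_, ?_⟩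
    · have : Fintype.card {f : F // f ≠ f0} = Fintype.card F - 1 := by
        rw [Fintype.card_subtype_compl, Fintype.card_subtype_eq]
      have h1 : 0 < Fintype.card F := Fintype.card_pos_iff.2 ⟨f0⟩
      simp only [Fintype.card_sum, Fintype.card_option, Fintype.card_fin]
      omega
    · intro x y hx hy hxy
      dsimp only at hxy
      split_ifs at hxy with h1 h2 h2
      · omega
      · exact hφ x y (by omega) (by omega) (Option.some_injective _ hxy)
    · rintro s (⟨hs, hst⟩ | ⟨x, hx, rfl⟩)
      · obtain ⟨f, hl, hv⟩ := hF s hs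
        have hff : f ≠ f0 := by
          rintro rfl
          apply hst
          show s = t
          have key : ∀ s' t' : Finset ℕ, (∀ v, (∃ x ∈ s', φ x = v) ↔ C.VOn v f) → (∀ v, (∃ x ∈ t', φ x = v) ↔ C.VOn v f) →
              (∀ x ∈ s', x < n) → (∀ x ∈ t', x < n) → s' ⊆ t' := by
            intro s' t' a b c d x hx
            obtain ⟨y, hy, hxy⟩ := (b (φ x)).2 ((a _).1 ⟨x, hx, rfl⟩)
            rwa [← hφ y x (d y hy) (c x hx) hxy]
          exact Finset.Subset.antisymm
            (key s t (fun v => (hv v).symm) (fun v => (hv0 v).symm) (hlt s hs).2 (hlt t ht).2)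
            (key t s (fun v => (hv0 v).symm) (fun v => (hv v).symm) (hlt t ht).2 (hlt s hs).2)
        refine ⟨Sum.inl ⟨f, hff⟩, (q3 _).trans hl, ?_⟩
        rintro (_ | v)
        · refine iff_of_false (q6 _) ?_
          rintro ⟨x, hx, h⟩
          have := (hlt s hs).2 x hx
          beta_reduce at h
          rw [if_neg (by omega)] at h
          simp at h
        · rw [q5, hv]
          refine exists_congr fun x => and_congr_right fun hx => ?_
          have := (hlt s hs).2 x hx
          beta_reduce
          rw [if_neg (by omega)]
          simp
      · obtain ⟨k, hk⟩ := hS x hx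
        have hxn := (hlt t ht).2 x hx
        refine ⟨Sum.inr (k + 1), q4 _, ?_⟩
        rintro (_ | v)
        · refine iff_of_true (q8 _) ⟨n, by simp, by simp⟩
        · rw [q7]
          have h3 : ∀ k j : Fin 3, (j = k + 1 ∨ j = k + 1 + 1) ↔ j ≠ k := by decide
          constructor
          · intro hv
            have : ∃ j, v = w j ∧ j ≠ k := by
              rcases hv with hv | hv
              · exact ⟨_, hv, (h3 k _).1 (Or.inl rfl)⟩
              · exact ⟨_, hv, (h3 k _).1 (Or.inr rfl)⟩
            obtain ⟨j, rfl, hjk⟩ := this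
            obtain ⟨y, hy, hyj⟩ := (hv0 _).1 ((hw _).2 ⟨j, rfl⟩)
            refine ⟨y, ?_, ?_⟩
            · simp only [Finset.mem_insert, Finset.mem_erase]
              refine Or.inr ⟨?_, hy⟩
              rintro rfl
              exact hjk (winj (hyj.symm.trans hk))
            · have := (hlt t ht).2 y hy
              beta_reduce
              rw [if_neg (by omega), hyj]
          · rintro ⟨y, hy, hyv⟩
            simp only [Finset.mem_insert, Finset.mem_erase] at hy
            rcases hy with rfl | ⟨hyx, hy⟩
            · simp at hyv
            · have := (hlt t ht).2 y hy
              beta_reduce at hyv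
              rw [if_neg (by omega)] at hyv
              have hyv := Option.some_injective _ hyv
              obtain ⟨j, hj⟩ := hS y hy
              have hjk : j ≠ k := by
                rintro rfl
                exact hyx (hφ _ _ this hxn (hj.trans hk.symm))
              rw [← hyv, hj]
              exact ((h3 k j).2 hjk).imp (congrArg w) (congrArg w)
    · have hold : ∀ b ∈ 𝓑, ∀ u ∈ b, ∀ v ∈ b, u ≠ v → ∃ e, C'.ends e = s((if u = n then none else some (φ u)), (if v = n then none else some (φ v))) := by
        intro b hb u hu v hv huv
        obtain ⟨e, he⟩ := hB b hb u hu v hv huv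
        have := (hltB b hb).2 u hu
        have := (hltB b hb).2 v hv
        refine ⟨Sum.inl e, ?_⟩
        rw [q1, he, if_neg (by omega), if_neg (by omega)]; rfl
      have hsp : ∀ y ∈ t, ∃ e, C'.ends e = s((if y = n then none else some (φ y)), none) := by
        intro y hy
        obtain ⟨k, hk⟩ := hS y hy
        have := (hlt t ht).2 y hy
        exact ⟨Sum.inr k, by rw [q2, if_neg (by omega), hk]⟩
      rintro b hb u hu v hv huv
      rcases hb with rfl | hb
      · obtain ⟨b', hb', hsub⟩ := h.bag.1 t ht
        rw [Finset.mem_insert] at hu hv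
        rcases hu with rfl | hu <;> rcases hv with rfl | hv
        · exact absurd rfl huv
        · obtain ⟨e, he⟩ := hsp v hv
          exact ⟨e, by rw [he]; simp [Sym2.eq_swap]⟩
        · obtain ⟨e, he⟩ := hsp u hu
          exact ⟨e, by rw [he]; simp⟩
        · exact hold b' hb' u (hsub hu) v (hsub hv) huv
      · exact hold b hb u hu v hv huv

theorem Apo.planar {n 𝓕 𝓑} (h : Apo n 𝓕 𝓑) : IsPlanar (Apo.gr n 𝓑) := by
  obtain ⟨V, E, F, i1, i2, i3, C, φ, hc, hφ, hF, hB⟩ := h.cx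
  have : Nonempty V := ⟨φ 0⟩
  obtain ⟨emb⟩ := C.toEmb
  refine ⟨V, E, F, inferInstance, inferInstance, inferInstance, ⟨C.ends⟩, emb, ?_, ?_⟩
  · unfold Multigraph.Embedding.eulerGenus
    simp only [Nat.card_eq_fintype_card]
    push_cast
    omega
  · refine ⟨⟨fun x => φ x.val, ?_⟩, ?_⟩
    · rintro u v ⟨hne, b, hb, hu, hv⟩
      have hne' : u.val ≠ v.val := fun h => hne (Fin.ext h)
      exact ⟨fun h => hne' (hφ _ _ u.2 v.2 h), hB b hb _ hu _ hv hne'⟩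
    · intro u v huv
      exact Fin.ext (hφ _ _ u.2 v.2 huv)

end
end FPS


set_option linter.unusedSectionVars false
set_option linter.unusedVariables false
namespace FPS
noncomputable section
open Finset Relation
open scoped Classical

theorem Apo.dec {n 𝓕 𝓑} (h : Apo n 𝓕 𝓑) : ∃ (m : ℕ) (bag : ℕ → Finset ℕ) (par : ℕ → ℕ), 0 < m ∧
    (∀ i, 0 < i → i < m → par i < i) ∧ (∀ b ∈ 𝓑, ∃ i, i < m ∧ bag i = b) ∧ (∀ i, i < m → bag i ∈ 𝓑) ∧
    ∀ v, v < n → ∃ τ, τ < m ∧ v ∈ bag τ ∧ ∀ i, i < m → v ∈ bag i → i = τ ∨ (0 < i ∧ v ∈ bag (par i)) := by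
  induction h with
  | base =>
    refine ⟨1, fun _ => {0, 1, 2}, fun _ => 0, by omega, by intros; omega, ?_, ?_, ?_⟩
    · intro b hb
      exact ⟨0, by omega, (Set.mem_singleton_iff.1 hb).symm⟩
    · intro i hi; simp
    · intro v hv
      refine ⟨0, by omega, ?_, fun i hi _ => Or.inl (by omega)⟩
      simp only [Finset.mem_insert, Finset.mem_singleton]; omega
  | @step n 𝓕 𝓑 t h ht ih =>
    obtain ⟨m, bag, par, hm, hp, hb1, hb2, hv⟩ := ih
    obtain ⟨hlt, hltB⟩ := h.lt
    obtain ⟨b, hb, htb⟩ := h.bag.1 t ht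
    obtain ⟨i0, hi0, rfl⟩ := hb1 b hb
    refine ⟨m + 1, fun i => if i = m then insert n t else bag i, fun i => if i = m then i0 else par i,
      by omega, ?_, ?_, ?_, ?_⟩
    · intro i h0 hi
      beta_reduce
      split_ifs with h1
      · omega
      · exact hp i h0 (by omega)
    · intro b hb
      rcases hb with rfl | hb
      · exact ⟨m, by omega, by simp⟩
      · obtain ⟨i, hi, h1⟩ := hb1 b hb
        exact ⟨i, by omega, by beta_reduce; rw [if_neg (by omega)]; exact h1⟩
    · intro i hi
      beta_reduce
      split_ifs with h1
      · exact Set.mem_insert _ _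
      · exact Set.mem_insert_of_mem _ (hb2 i (by omega))
    · intro v hvn
      by_cases hn : v = n
      · subst hn
        refine ⟨m, by omega, by simp, ?_⟩
        intro i hi hvi
        left
        by_contra h1
        beta_reduce at hvi
        rw [if_neg h1] at hvi
        have := (hltB _ (hb2 i (by omega))).2 _ hvi
        omega
      · obtain ⟨τ, h1, h2, h3⟩ := hv v (by omega)
        refine ⟨τ, by omega, by beta_reduce; rw [if_neg (by omega)]; exact h2, ?_⟩
        intro i hi hvi
        beta_reduce at hvi ⊢
        by_cases him : i = m
        · rw [if_pos him] at hvi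
          right
          refine ⟨by omega, ?_⟩
          rw [if_pos him, if_neg (by omega)]
          rcases Finset.mem_insert.1 hvi with h | h
          · exact absurd h hn
          · exact htb h
        · rw [if_neg him] at hvi
          rcases h3 i (by omega) hvi with h | ⟨h, h'⟩
          · exact Or.inl h
          · right
            have := hp i h (by omega)
            refine ⟨h, ?_⟩
            rw [if_neg him, if_neg (by omega)]
            exact h'

def ptree (m : ℕ) (par : ℕ → ℕ) : SimpleGraph (Fin m) where
  Adj i j := i ≠ j ∧ ((0 < i.val ∧ par i.val = j.val) ∨ (0 < j.val ∧ par j.val = i.val))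
  symm := ⟨fun i j h => ⟨h.1.symm, h.2.symm⟩⟩
  loopless := ⟨fun i h => h.1 rfl⟩

theorem ptree_conn (m : ℕ) (par : ℕ → ℕ) (hp : ∀ i, 0 < i → i < m → par i < i) (S : Set (Fin m)) (τ : Fin m) (hτ : τ ∈ S)
    (hS : ∀ i ∈ S, i = τ ∨ (0 < i.val ∧ ∃ j ∈ S, j.val = par i.val)) : ((ptree m par).induce S).Connected := by
  have key : ∀ n, ∀ i : S, i.1.val = n → ((ptree m par).induce S).Reachable i ⟨τ, hτ⟩ := by
    intro n
    induction n using Nat.strong_induction_on with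
    | _ n ih =>
      rintro ⟨i, hi⟩ hin
      rcases hS i hi with rfl | ⟨h0, j, hj, hjp⟩
      · exact SimpleGraph.Reachable.refl _
      · have hlt := hp i.val h0 i.2
        have hin' : i.val = n := hin
        refine SimpleGraph.Reachable.trans (SimpleGraph.Adj.reachable ?_) (ih j.val (by omega) ⟨j, hj⟩ rfl)
        show (ptree m par).Adj i j
        exact ⟨fun h => by rw [h] at hjp hlt; omega, Or.inl ⟨h0, hjp.symm⟩⟩
  have : Nonempty S := ⟨⟨τ, hτ⟩⟩
  exact SimpleGraph.Connected.mk fun i j => (key _ i rfl).trans (key _ j rfl).symm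

theorem ptree_tree (m : ℕ) (par : ℕ → ℕ) (hm : 0 < m) (hp : ∀ i, 0 < i → i < m → par i < i) : (ptree m par).IsTree := by
  have hc : (ptree m par).Connected := by
    have := ptree_conn m par hp Set.univ ⟨0, hm⟩ trivial (by
      intro i _
      by_cases h : i.val = 0
      · exact Or.inl (Fin.ext h)
      · right
        have := hp i.val (by omega) i.2
        exact ⟨by omega, ⟨par i.val, by omega⟩, trivial, rfl⟩)
    exact (SimpleGraph.induceUnivIso _).connected_iff.1 this
  rw [SimpleGraph.isTree_iff_connected_and_card]
  refine ⟨hc, ?_⟩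
  have h1 := hc.card_vert_le_card_edgeSet_add_one
  have h2 : Nat.card (ptree m par).edgeSet ≤ m - 1 := by
    rw [Nat.card_coe_set_eq]
    let φ : ℕ → Sym2 (Fin m) := fun i => if h : i < m ∧ par i < m then s(⟨i, h.1⟩, ⟨par i, h.2⟩) else s(⟨0, hm⟩, ⟨0, hm⟩)
    have hsub : (ptree m par).edgeSet ⊆ ((Finset.Ico 1 m).image φ : Finset (Sym2 (Fin m))) := by
      have hk : ∀ i j : Fin m, 0 < i.val → par i.val = j.val → s(i, j) ∈ (Finset.Ico 1 m).image φ := by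
        intro i j h0 h
        rw [Finset.mem_image]
        refine ⟨i.val, by rw [Finset.mem_Ico]; omega, ?_⟩
        have hj := j.2
        show dite _ _ _ = _
        rw [dif_pos ⟨i.2, by omega⟩]
        congr 2
      intro e
      induction e using Sym2.ind with
      | _ i j =>
        rintro ⟨-, ⟨h0, h⟩ | ⟨h0, h⟩⟩
        · exact hk i j h0 h
        · rw [Sym2.eq_swap]; exact hk j i h0 h
    refine (Set.ncard_le_ncard hsub (Finset.finite_toSet _)).trans ?_
    rw [Set.ncard_coe_finset]
    exact Finset.card_image_le.trans (by simp)
  simp only [Nat.card_eq_fintype_card, Fintype.card_fin] at h1 h2 ⊢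
  omega

theorem Apo.tw {n 𝓕 𝓑} (h : Apo n 𝓕 𝓑) : TreewidthLE (Apo.gr n 𝓑) 3 := by
  obtain ⟨m, bag, par, hm, hp, hb1, hb2, hv⟩ := h.dec
  refine ⟨Fin m, ptree m par, fun i => {x | x.val ∈ bag i.val}, ptree_tree m par hm hp, ?_, ?_, ?_, ?_⟩
  · intro v
    obtain ⟨τ, h1, h2, -⟩ := hv v.val v.2
    exact ⟨⟨τ, h1⟩, h2⟩
  · rintro u v ⟨-, b, hb, hu, hv⟩
    obtain ⟨i, hi, rfl⟩ := hb1 b hb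
    exact ⟨⟨i, hi⟩, hu, hv⟩
  · intro v
    obtain ⟨τ, h1, h2, h3⟩ := hv v.val v.2
    refine ptree_conn m par hp _ ⟨τ, h1⟩ h2 ?_
    intro i hi
    rcases h3 i.val i.2 hi with h | ⟨h, h'⟩
    · exact Or.inl (Fin.ext h)
    · have := hp i.val h i.2
      exact Or.inr ⟨h, ⟨par i.val, by omega⟩, h', rfl⟩
  · intro i
    have hc := (h.lt.2 _ (hb2 i.val i.2)).1
    have h1 : ({x : Fin n | x.val ∈ bag i.val}).encard ≤ ((bag i.val : Finset ℕ) : Set ℕ).encard :=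
      Set.encard_le_encard_of_injOn (f := Fin.val) (fun x hx => hx) (Fin.val_injective.injOn)
    refine h1.trans ?_
    rw [Set.encard_coe_eq_coe_finsetCard]
    exact_mod_cast hc

end
end FPS


set_option linter.unusedSectionVars false
set_option linter.unusedVariables false
namespace FPS
noncomputable section
open Finset Relation
open scoped Classical

theorem Cx.reduce {V : Type} [Fintype V] (d : ℕ) (hd : 3 ≤ d) : ∀ (k : ℕ) (E F : Type) (_ : Fintype E) (_ : Fintype F) (C : Cx V E F),
    ∑ f, (C.len f - d) = k → ∃ (E' F' : Type) (_ : Fintype E') (_ : Fintype F') (C' : Cx V E' F'),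
      Fintype.card E' + Fintype.card F = Fintype.card E + Fintype.card F' ∧ (∀ f, C'.len f ≤ d) ∧
      (∀ e, ∃ e', C'.ends e' = C.ends e) ∧ (∀ f, C.len f ≤ d → ∃ f', ∀ v, C.VOn v f → C'.VOn v f') := by
  intro k
  induction k with
  | zero =>
    intro E F i1 i2 C hk
    refine ⟨E, F, i1, i2, C, rfl, fun f => ?_, fun e => ⟨e, rfl⟩, fun f _ => ⟨f, fun v h => h⟩⟩
    rw [Finset.sum_eq_zero_iff] at hk
    have := hk f (Finset.mem_univ _)
    omega
  | succ k ih =>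
    intro E F i1 i2 C hk
    obtain ⟨f0, -, hf0⟩ := Finset.exists_ne_zero_of_sum_ne_zero (s := Finset.univ) (f := fun f => C.len f - d) (by rw [hk]; omega)
    obtain ⟨C1, h1, h2, h3, h4⟩ := C.chord f0 (by omega)
    obtain ⟨E', F', j1, j2, C', q1, q2, q3, q4⟩ := ih (Option E) (Option F) inferInstance inferInstance C1 (by
      rw [Fintype.sum_option, h2]
      have e1 := Finset.sum_erase_add Finset.univ (fun f => C1.len (some f) - d) (Finset.mem_univ f0)
      have e2 := Finset.sum_erase_add Finset.univ (fun f => C.len f - d) (Finset.mem_univ f0)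
      have e3 : ∑ f ∈ Finset.univ.erase f0, (C1.len (some f) - d) = ∑ f ∈ Finset.univ.erase f0, (C.len f - d) := by
        refine Finset.sum_congr rfl fun f hf => ?_
        rw [h3, if_neg (Finset.ne_of_mem_erase hf)]
      have e4 : C1.len (some f0) = C.len f0 - 1 := by rw [h3, if_pos rfl]
      rw [← e1, e3, e4]
      omega)
    refine ⟨E', F', j1, j2, C', ?_, q2, ?_, ?_⟩
    · simp only [Fintype.card_option] at q1; omega
    · intro e
      obtain ⟨e', he'⟩ := q3 (some e)
      exact ⟨e', he'.trans (h1 e)⟩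
    · intro f hf
      have hff : f ≠ f0 := by rintro rfl; omega
      obtain ⟨f', hf'⟩ := q4 (some f) (by rw [h3, if_neg hff]; exact hf)
      exact ⟨f', fun v hv => hf' v (h4 f v hff hv)⟩

section emb
variable {V E F : Type} {G : Multigraph V E}

theorem cw_vmod (W : G.CWalk) (i : ℕ) : W.vtx (i % W.len) = W.vtx i :=
  Function.Periodic.map_mod_nat (f := W.vtx) W.vtx_per i
theorem cw_emod (W : G.CWalk) (i : ℕ) : W.edge (i % W.len) = W.edge i :=
  Function.Periodic.map_mod_nat (f := W.edge) W.edge_per i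

theorem occ_two (emb : G.Embedding F) (hcyc : ∀ f, (emb.boundary f).IsCycle) (e : E) :
    ∃ p p' : F × ℕ, p.1 ≠ p'.1 ∧ ∀ q, Multigraph.IsOcc emb.boundary e q ↔ q = p ∨ q = p' := by
  obtain ⟨p, p', hne, h⟩ := Set.ncard_eq_two.1 (emb.edge_twice e)
  have h' : ∀ q, Multigraph.IsOcc emb.boundary e q ↔ q = p ∨ q = p' := by
    intro q
    have : q ∈ {p : F × ℕ | Multigraph.IsOcc emb.boundary e p} ↔ q ∈ ({p, p'} : Set (F × ℕ)) := by rw [h]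
    simpa using this
  refine ⟨p, p', fun h1 => hne ?_, h'⟩
  obtain ⟨a1, a2⟩ := (h' p).2 (Or.inl rfl)
  obtain ⟨b1, b2⟩ := (h' p').2 (Or.inr rfl)
  refine Prod.ext h1 ?_
  rw [h1] at a1 a2
  exact (hcyc p'.1).2 _ _ a1 b1 (a2.trans b2.symm)

theorem occ_mod (emb : G.Embedding F) (f : F) (i : ℕ) :
    Multigraph.IsOcc emb.boundary ((emb.boundary f).edge i) (f, i % (emb.boundary f).len) :=
  ⟨Nat.mod_lt _ (emb.boundary f).len_pos, cw_emod _ _⟩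

theorem len_two [Nontrivial V] (emb : G.Embedding F) (hcyc : ∀ f, (emb.boundary f).IsCycle) (f : F) :
    2 ≤ (emb.boundary f).len := by
  by_contra hlt
  have h1 : (emb.boundary f).len = 1 := by have := (emb.boundary f).len_pos; omega
  obtain ⟨e, he⟩ : ∃ e, (emb.boundary f).edge 0 = e := ⟨_, rfl⟩
  obtain ⟨v, hv⟩ : ∃ v, (emb.boundary f).vtx 0 = v := ⟨_, rfl⟩
  have hends : G.ends e = s(v, v) := by
    rw [← he, (emb.boundary f).compat, hv]
    have := (emb.boundary f).vtx_per 0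
    rw [h1] at this
    rw [this, hv]
  -- every face through e has length one
  have hone : ∀ o i, (emb.boundary o).edge i = e → (emb.boundary o).len = 1 := by
    intro o i hi
    have hc := (emb.boundary o).compat i
    rw [hi, hends] at hc
    have h2 : (emb.boundary o).vtx i = (emb.boundary o).vtx (i + 1) := by
      rw [Sym2.eq_iff] at hc
      rcases hc with ⟨a, b⟩ | ⟨a, b⟩ <;> rw [← a, ← b]
    have hpos := (emb.boundary o).len_pos
    rw [← cw_vmod _ i, ← cw_vmod _ (i + 1)] at h2
    have h3 := (hcyc o).1 _ _ (Nat.mod_lt _ hpos) (Nat.mod_lt _ hpos) h2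
    by_contra hne
    have h4 := Nat.mod_lt i hpos
    rw [Nat.add_mod, Nat.mod_eq_of_lt (show 1 < (emb.boundary o).len by omega)] at h3
    by_cases h5 : i % (emb.boundary o).len + 1 < (emb.boundary o).len
    · rw [Nat.mod_eq_of_lt h5] at h3; omega
    · rw [show i % (emb.boundary o).len + 1 = (emb.boundary o).len by omega, Nat.mod_self] at h3; omega
  let P : F → Prop := fun o => (emb.boundary o).edge 0 = e
  have hP : ∀ o i, P o → (emb.boundary o).edge i = e := by
    intro o i ho
    have h := hone o 0 ho
    rw [← cw_emod, h, Nat.mod_one]; exact ho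
  have hP' : ∀ o i, (emb.boundary o).edge i = e → P o := by
    intro o i hi
    have h := hone o i hi
    rw [← cw_emod, h, Nat.mod_one] at hi; exact hi
  have hcl : ∀ c c', EqvGen (Multigraph.CornerLinked emb.boundary v) c c' → (P c.1 ↔ P c'.1) := by
    intro c c' h
    induction h with
    | rel c c' h =>
      obtain ⟨-, -, e', p, p', -, ⟨-, o1⟩, ⟨-, o2⟩, ⟨l1, -⟩, ⟨l2, -⟩⟩ := h
      rw [l1, l2]
      constructor
      · intro h
        have := hP _ p.2 h
        exact hP' _ p'.2 (o2.trans (o1.symm.trans this))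
      · intro h
        have := hP _ p'.2 h
        exact hP' _ p.2 (o1.trans (o2.symm.trans this))
    | refl => exact Iff.rfl
    | symm _ _ _ ih => exact ih.symm
    | trans _ _ _ _ _ ih1 ih2 => exact ih1.trans ih2
  obtain ⟨u, huv⟩ := exists_ne v
  obtain ⟨x, hx⟩ : ∃ x, G.simple.Adj v x := by
    obtain ⟨w⟩ := emb.conn.preconnected v u
    cases w with
    | nil => exact absurd rfl huv
    | cons h _ => exact ⟨_, h⟩
  obtain ⟨hvx, e2, he2⟩ := hx
  obtain ⟨p, p', -, hp⟩ := occ_two emb hcyc e2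
  obtain ⟨a1, a2⟩ := (hp p).2 (Or.inl rfl)
  have hpos := (emb.boundary p.1).len_pos
  have hcor : ∃ i, Multigraph.IsCorner emb.boundary v (p.1, i) := by
    have hc := (emb.boundary p.1).compat p.2
    rw [a2, he2] at hc
    have hm : v ∈ s((emb.boundary p.1).vtx p.2, (emb.boundary p.1).vtx (p.2 + 1)) := by rw [← hc]; simp
    rw [Sym2.mem_iff] at hm
    rcases hm with hm | hm
    · exact ⟨p.2, a1, hm.symm⟩
    · exact ⟨(p.2 + 1) % _, Nat.mod_lt _ hpos, (cw_vmod _ _).trans hm.symm⟩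
  obtain ⟨i, hi⟩ := hcor
  have := (hcl (f, 0) (p.1, i) (emb.link_conn v _ _ ⟨(emb.boundary f).len_pos, hv⟩ hi)).1 he
  have h5 := hP _ p.2 this
  rw [a2] at h5
  rw [h5, hends, Sym2.eq_iff] at he2
  rcases he2 with ⟨a, b⟩ | ⟨a, b⟩
  · exact hvx b
  · exact hvx a

def embCx [Nontrivial V] (emb : G.Embedding F) (hcyc : ∀ f, (emb.boundary f).IsCycle) : Cx V E F where
  ends := G.ends
  len f := (emb.boundary f).len
  vtx f := (emb.boundary f).vtx
  edge f := (emb.boundary f).edge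
  two_le := len_two emb hcyc
  vper f := (emb.boundary f).vtx_per
  eper f := (emb.boundary f).edge_per
  compat f := (emb.boundary f).compat
  vinj f := (hcyc f).1
  einj f := (hcyc f).2
  two e := by
    obtain ⟨p, p', hne, h⟩ := occ_two emb hcyc e
    refine ⟨p.1, p'.1, hne, fun o => ⟨?_, ?_⟩⟩
    · rintro ⟨i, rfl⟩
      rcases (h _).1 (occ_mod emb o i) with h | h
      · exact Or.inl (congrArg Prod.fst h)
      · exact Or.inr (congrArg Prod.fst h)
    · rintro (rfl | rfl)
      · exact ⟨p.2, ((h p).2 (Or.inl rfl)).2⟩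
      · exact ⟨p'.2, ((h p').2 (Or.inr rfl)).2⟩
  star v f f' := by
    rintro ⟨i, hi⟩ ⟨i', hi'⟩
    have h := emb.link_conn v (f, i % _) (f', i' % _)
      ⟨Nat.mod_lt _ (emb.boundary f).len_pos, (cw_vmod _ _).trans hi⟩
      ⟨Nat.mod_lt _ (emb.boundary f').len_pos, (cw_vmod _ _).trans hi'⟩
    have key : ∀ c c', EqvGen (Multigraph.CornerLinked emb.boundary v) c c' →
        EqvGen (fun o o' => ∃ e, v ∈ G.ends e ∧ (∃ i, (emb.boundary o).edge i = e) ∧ (∃ i, (emb.boundary o').edge i = e)) c.1 c'.1 := by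
      intro c c' h
      induction h with
      | rel c c' h =>
        obtain ⟨⟨c1, c2⟩, -, e, p, p', -, ⟨o0, o1⟩, ⟨-, o2⟩, ⟨l1, l1'⟩, ⟨l2, -⟩⟩ := h
        refine EqvGen.rel _ _ ⟨e, ?_, ⟨p.2, by rw [l1]; exact o1⟩, ⟨p'.2, by rw [l2]; exact o2⟩⟩
        rw [← o1, (emb.boundary p.1).compat, Sym2.mem_iff, ← c2, l1]
        rcases l1' with h | h
        · left; rw [h]
        · right; rw [h, cw_vmod]
      | refl => exact EqvGen.refl _
      | symm _ _ _ ih => exact EqvGen.symm _ _ ih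
      | trans _ _ _ _ _ ih1 ih2 => exact EqvGen.trans _ _ _ ih1 ih2
    exact key _ _ h
  conn u v := by
    have h := emb.conn.preconnected u v
    rw [SimpleGraph.reachable_iff_reflTransGen] at h
    exact ReflTransGen.mono (fun a b h => h.2) _ _ h

end emb

theorem main (g d : ℕ) (hd : 3 ≤ d)
    {V E F : Type} [Fintype V] [Fintype E] [Fintype F]
    (G : Multigraph V E) (emb : G.Embedding F)
    (hcyc : ∀ f, (emb.boundary f).IsCycle)
    (hg : emb.eulerGenus ≤ (g : ℤ)) :
    ∃ (W : Type) (H : SimpleGraph W) (n : ℕ),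
      IsPlanar H ∧ TreewidthLE H 3 ∧
      (Multigraph.framedGraph emb d).IsContainedIn
        ((H.strongProd (SimpleGraph.pathGraph n)).strongProd
          (SimpleGraph.completeGraph (Fin (max (2 * g * (d / 2)) (d + 3 * (d / 2) - 3))))) := by
  obtain ⟨r⟩ := emb.conn.nonempty
  rcases subsingleton_or_nontrivial V with hs | hnt
  · refine ⟨_, Apo.gr 3 {{0, 1, 2}}, 1, Apo.base.planar, Apo.base.tw, ?_⟩
    have hpos : 0 < max (2 * g * (d / 2)) (d + 3 * (d / 2) - 3) := lt_max_of_lt_right (by omega)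
    refine ⟨⟨fun _ => ((0, 0), ⟨0, hpos⟩), ?_⟩, fun u v _ => Subsingleton.elim _ _⟩
    intro u v h
    exact absurd (Subsingleton.elim u v) h.1
  · obtain ⟨E', F', j1, j2, C', q1, q2, q3, q4⟩ := Cx.reduce d hd _ E F inferInstance inferInstance (embCx emb hcyc) rfl
    have hne : Nonempty E' := by
      obtain ⟨u, hu⟩ := exists_ne r
      rcases ReflTransGen.cases_head (C'.conn u r) with h | ⟨_, ⟨e, _⟩, _⟩
      · exact absurd h hu
      · exact ⟨e⟩
    unfold Multigraph.Embedding.eulerGenus at hg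
    simp only [Nat.card_eq_fintype_card] at hg
    obtain ⟨n, 𝓕, 𝓑, N, hA, hGr⟩ := C'.fin r g d hd q2 (by omega)
    refine ⟨_, Apo.gr n 𝓑, N, hA.planar, hA.tw, hGr _ ?_⟩
    rintro u v ⟨-, ⟨e, he⟩ | ⟨f, hf, ⟨i, -, hi⟩, ⟨j, -, hj⟩⟩⟩
    · obtain ⟨e', he'⟩ := q3 e
      have h1 : C'.ends e' = s(u, v) := he'.trans he
      obtain ⟨f, hf⟩ := C'.exists_face e'
      exact ⟨f, C'.VOn_of_mem hf (by rw [h1]; simp), C'.VOn_of_mem hf (by rw [h1]; simp)⟩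
    · obtain ⟨f', hf'⟩ := q4 f hf
      exact ⟨f', hf' u ⟨i, hi⟩, hf' v ⟨j, hj⟩⟩

end
end FPS

/-- For all integers `g ≥ 0` and `d ≥ 3`, every `(g,d)`-framed multigraph is contained
in `H ⊠ P ⊠ K_ℓ` for some planar graph `H` with treewidth at most 3 and some path
`P`, where `ℓ = max{2g⌊d/2⌋, d + 3⌊d/2⌋ − 3}`. -/
theorem framed_product_structure (g d : ℕ) (hd : 3 ≤ d)
    {V E F : Type} [Fintype V] [Fintype E] [Fintype F]
    (G : Multigraph V E) (emb : G.Embedding F)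
    (hcyc : ∀ f, (emb.boundary f).IsCycle)
    (hg : emb.eulerGenus ≤ (g : ℤ)) :
    ∃ (W : Type) (H : SimpleGraph W) (n : ℕ),
      IsPlanar H ∧ TreewidthLE H 3 ∧
      (Multigraph.framedGraph emb d).IsContainedIn
        ((H.strongProd (SimpleGraph.pathGraph n)).strongProd
          (SimpleGraph.completeGraph (Fin (max (2 * g * (d / 2)) (d + 3 * (d / 2) - 3))))) := by
  exact FPS.main g d hd G emb hcyc hg
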